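/- Let (X, 𝓕, μ) be a probability space and T : X → X a measure-preserving transformation that is ergodic. Suppose F₁, F₂ ∈ L^∞(μ) are real-valued with ‖F₁‖_∞ ≤ 1 and ‖F₂‖_∞ ≤ 1, and that ⦀F₁⦀₂ = 0 (i.e. F₁ lies in the orthogonal complement of the Kronecker factor). Then for μ-almost every x ∈ X, lim_{N→∞} (1/N) ∑_{n=1}^{N} F₁(T^{n}x) F₂(T^{2n}x) = 0. -/

import Mathlib

open MeasureTheory Filter

/-- The 4th power of the Host–Kra seminorm `⦀f⦀₂`. -/
noncomputable def hkSeminorm2pow4 {X : Type*} [MeasurableSpace X] (μ : Measure X)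
    (T : X → X) (f : X → ℝ) : ℝ :=
  limsup (fun H : ℕ => (1 / (H : ℝ)) * ∑ h ∈ Finset.Icc 1 H,
    |∫ x, f x * f (T^[h] x) ∂μ| ^ 2) atTop

namespace DoubleRec
open Finset

/-- The additive character `t ↦ exp (2πit)`. -/
noncomputable def e (t : ℝ) : ℂ := Complex.exp (2 * Real.pi * Complex.I * t)

lemma e_add (s t : ℝ) : e (s + t) = e s * e t := by
  simp only [e, ← Complex.exp_add]; congr 1; push_cast; ring

lemma e_zero : e 0 = 1 := by simp [e]

lemma norm_e (t : ℝ) : ‖e t‖ = 1 := by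
  rw [e, Complex.norm_exp]; simp

lemma e_neg (t : ℝ) : e (-t) = (starRingEnd ℂ) (e t) := by
  simp only [e, ← Complex.exp_conj]; congr 1; simp [map_ofNat]

lemma e_natCast_mul (k : ℕ) (t : ℝ) : e (k * t) = e t ^ k := by
  simp only [e, ← Complex.exp_nat_mul]; congr 1; push_cast; ring

lemma e_eq_one_iff (t : ℝ) : e t = 1 ↔ ∃ m : ℤ, t = m := by
  rw [e, Complex.exp_eq_one_iff]
  have h : (2 * Real.pi * Complex.I : ℂ) ≠ 0 := Complex.two_pi_I_ne_zero
  constructor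
  · rintro ⟨m, hm⟩
    refine ⟨m, ?_⟩
    rw [mul_comm] at hm
    exact_mod_cast mul_right_cancel₀ h hm
  · rintro ⟨m, rfl⟩
    exact ⟨m, by push_cast; ring⟩

lemma sum_e_eq_zero {n : ℕ} {t : ℝ} (hn : ∃ m : ℤ, n * t = m) (ht : ¬ ∃ m : ℤ, t = m) :
    ∑ j ∈ range n, e (j * t) = 0 := by
  simp_rw [e_natCast_mul]
  rw [← e_eq_one_iff] at ht
  rw [geom_sum_eq ht, ← e_natCast_mul, (e_eq_one_iff _).2 hn]; simp

/-- Normalised Fourier coefficient of `u` on `[b, b + n)` at the frequency `θ`. -/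
noncomputable def coef (b n : ℕ) (u : ℕ → ℂ) (θ : ℝ) : ℂ :=
  (1 / (n : ℂ)) * ∑ y ∈ Ico b (b + n), u y * e (-(θ * y))

lemma sum_e_div_eq_zero {n y z : ℕ} (hn : 0 < n) {b : ℕ} (hy : y ∈ Ico b (b + n))
    (hz : z ∈ Ico b (b + n)) (h : y ≠ z) :
    ∑ j ∈ range n, e (j * (((y : ℝ) - z) / n)) = 0 := by
  simp only [mem_Ico] at hy hz
  have hn' : (n : ℝ) ≠ 0 := by positivity
  refine sum_e_eq_zero ⟨(y : ℤ) - z, by push_cast; field_simp⟩ ?_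
  rintro ⟨m, hm⟩
  rw [div_eq_iff hn'] at hm
  have hm' : (y : ℤ) - z = m * n := by exact_mod_cast hm
  have : m = 0 := by
    by_contra h0
    rcases lt_or_gt_of_ne h0 with h1 | h1 <;> nlinarith
  subst this; omega

lemma sum_coef_mul_e {b n : ℕ} (u : ℕ → ℂ) {y : ℕ} (hy : y ∈ Ico b (b + n)) :
    ∑ j ∈ range n, coef b n u (j / n) * e (j * (y / n)) = u y := by
  have hn : 0 < n := by simp only [mem_Ico] at hy; omega
  have hn' : (n : ℂ) ≠ 0 := by exact_mod_cast hn.ne'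
  have h1 : ∑ j ∈ range n, coef b n u (j / n) * e (j * (y / n)) =
      (1 / (n : ℂ)) * ∑ z ∈ Ico b (b + n), u z *
        ∑ j ∈ range n, e (j * (((y : ℝ) - z) / n)) := by
    simp only [coef, mul_sum, sum_mul]
    rw [sum_comm]
    refine sum_congr rfl fun z _ => sum_congr rfl fun j _ => ?_
    rw [show (j : ℝ) * (((y : ℝ) - z) / n) = -(j / n * z) + j * (y / n) by ring, e_add]
    ring
  rw [h1, sum_eq_single_of_mem y hy]
  · simp [e_zero]; field_simp
  · intro z hz hzy
    rw [sum_e_div_eq_zero hn hy hz hzy.symm, mul_zero]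

lemma sum_norm_sq_eq_of_orthogonal {n : ℕ} {S : Finset ℕ} {g : ℕ → ℝ}
    (hS : ∀ y ∈ S, ∀ z ∈ S, y ≠ z → ∑ j ∈ range n, e (j * (g y - g z)) = 0) (c : ℕ → ℂ) :
    ∑ j ∈ range n, ‖∑ z ∈ S, c z * e (j * g z)‖ ^ 2 = n * ∑ z ∈ S, ‖c z‖ ^ 2 := by
  have h : ((∑ j ∈ range n, ‖∑ z ∈ S, c z * e (j * g z)‖ ^ 2 : ℝ) : ℂ) =
      ((n * ∑ z ∈ S, ‖c z‖ ^ 2 : ℝ) : ℂ) := by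
    push_cast
    simp_rw [← Complex.mul_conj', map_sum, sum_mul_sum]
    rw [sum_comm]
    rw [mul_sum]
    refine sum_congr rfl fun y hy => ?_
    rw [sum_comm, sum_eq_single_of_mem y hy]
    · simp only [map_mul, ← e_neg]
      rw [sum_congr rfl (g := fun _ => c y * (starRingEnd ℂ) (c y))]
      · simp
      · intro j _
        have := e_add (j * g y) (-(j * g y))
        rw [add_neg_cancel, e_zero] at this
        linear_combination - c y * (starRingEnd ℂ) (c y) * this
    · intro z hz hzy
      have : ∀ j ∈ range n, c y * e (j * g y) * (starRingEnd ℂ) (c z * e (j * g z)) =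
          c y * (starRingEnd ℂ) (c z) * e (j * (g y - g z)) := by
        intro j _
        rw [map_mul, ← e_neg, show (j : ℝ) * (g y - g z) = j * g y + -(j * g z) by ring, e_add]
        ring
      rw [sum_congr rfl this, ← mul_sum, hS y hy z hz hzy.symm, mul_zero]
  exact_mod_cast h

lemma sum_norm_sq_le_of_orthogonal {n : ℕ} {S : Finset ℕ} {g : ℕ → ℝ}
    (hS : ∀ y ∈ S, ∀ z ∈ S, y ≠ z → ∑ j ∈ range n, e (j * (g y - g z)) = 0) (c : ℕ → ℂ) :
    ∑ x ∈ S, ‖∑ j ∈ range n, c j * e (j * g x)‖ ^ 2 ≤ n * ∑ j ∈ range n, ‖c j‖ ^ 2 := by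
  set G : ℕ → ℂ := fun x => ∑ j ∈ range n, c j * e (j * g x) with hG
  set A := ∑ x ∈ S, ‖G x‖ ^ 2 with hA
  set B := ∑ j ∈ range n, ‖c j‖ ^ 2
  have hdual := sum_norm_sq_eq_of_orthogonal hS (fun x => (starRingEnd ℂ) (G x))
  simp only [RCLike.norm_conj] at hdual
  have h1 : ((A : ℝ) : ℂ) = ∑ j ∈ range n, c j * ∑ x ∈ S, (starRingEnd ℂ) (G x) * e (j * g x) := by
    rw [hA]; push_cast
    simp_rw [← Complex.mul_conj', mul_sum]
    rw [sum_comm]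
    refine sum_congr rfl fun x _ => ?_
    conv_lhs => rw [hG]
    simp only [sum_mul]
    exact sum_congr rfl fun j _ => by ring
  have hA0 : 0 ≤ A := by positivity
  have h2 : A ≤ ∑ j ∈ range n, ‖c j‖ * ‖∑ x ∈ S, (starRingEnd ℂ) (G x) * e (j * g x)‖ := by
    calc A = ‖((A : ℝ) : ℂ)‖ := by simp [abs_of_nonneg hA0]
      _ ≤ _ := by
        rw [h1]; refine (norm_sum_le _ _).trans (sum_le_sum fun j _ => ?_)
        rw [norm_mul]
  have h3 := sum_mul_sq_le_sq_mul_sq (range n) (fun j => ‖c j‖)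
    (fun j : ℕ => ‖∑ x ∈ S, (starRingEnd ℂ) (G x) * e (j * g x)‖)
  rw [hdual] at h3
  have h4 : A ^ 2 ≤ B * (n * A) := (pow_le_pow_left₀ hA0 h2 2).trans h3
  rcases hA0.eq_or_lt with h | h
  · rw [← h]; positivity
  · nlinarith

/-- The elements of `[b, b + n)` of parity `p`. -/
def parityIco (p b n : ℕ) : Finset ℕ := (Ico b (b + n)).filter (fun z => z % 2 = p)

lemma mem_parityIco {p b n z : ℕ} : z ∈ parityIco p b n ↔ (b ≤ z ∧ z < b + n) ∧ z % 2 = p := by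
  simp [parityIco]

lemma sum_e_parity_eq_zero {p b n y z : ℕ} (hy : y ∈ parityIco p b n)
    (hz : z ∈ parityIco p b n) (h : y ≠ z) :
    ∑ j ∈ range n, e (j * ((y : ℝ) / (2 * n) - z / (2 * n))) = 0 := by
  rw [mem_parityIco] at hy hz
  have hn : 0 < n := by omega
  have key := sum_e_div_eq_zero hn (b := b / 2) (y := y / 2) (z := z / 2)
    (by simp; omega) (by simp; omega) (by omega)
  rw [← key]
  refine sum_congr rfl fun j _ => ?_
  congr 2
  have h1 : (y : ℝ) = 2 * (y / 2 : ℕ) + p := by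
    exact_mod_cast (show y = 2 * (y / 2) + p by omega)
  have h2 : (z : ℝ) = 2 * (z / 2 : ℕ) + p := by
    exact_mod_cast (show z = 2 * (z / 2) + p by omega)
  have hn' : (n : ℝ) ≠ 0 := by positivity
  rw [h1, h2]; field_simp; ring

lemma card_parityIco_le (p b n : ℕ) : (parityIco p b n).card ≤ n :=
  (card_filter_le _ _).trans (by simp)

/-- Bilinear averages over a fixed window `S` of the second variable. -/
noncomputable def bil (n : ℕ) (S : Finset ℕ) (u f : ℕ → ℂ) (x : ℕ) : ℂ :=
  (1 / (n : ℂ)) * ∑ z ∈ S with z % 2 = x % 2, u ((x + z) / 2) * f z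

lemma bil_eq_sum_coef {b n p x : ℕ} {S : Finset ℕ} (hS : S ⊆ Ico b (b + n)) (u f : ℕ → ℂ)
    (hx : x ∈ parityIco p b n) :
    bil n S u f x = (1 / (n : ℂ)) * ∑ j ∈ range n, (coef b n u (j / n) *
      ∑ z ∈ S with z % 2 = p, f z * e (j * (z / (2 * n)))) * e (j * (x / (2 * n))) := by
  rw [mem_parityIco] at hx
  have hn : (n : ℝ) ≠ 0 := by
    have : n ≠ 0 := by omega
    exact_mod_cast this
  rw [bil]
  congr 1
  simp only [mul_sum, sum_mul]
  rw [sum_comm, hx.2]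
  refine sum_congr rfl fun z hz => ?_
  rw [mem_filter] at hz
  have hz' := mem_Ico.1 (hS hz.1)
  rw [← sum_coef_mul_e u (b := b) (n := n) (y := (x + z) / 2) (by rw [mem_Ico]; omega), sum_mul]
  refine sum_congr rfl fun j _ => ?_
  have : (((x + z) / 2 : ℕ) : ℝ) = ((x : ℝ) + z) / 2 := by
    rw [Nat.cast_div (by omega) (by norm_num)]; push_cast; ring
  rw [this, show (j : ℝ) * (((x : ℝ) + z) / 2 / n) = j * (z / (2 * n)) + j * (x / (2 * n)) by
    field_simp; ring, e_add]
  ring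

/-- `u` has all its Fourier coefficients on `[b, b + n)` bounded by `ρ`. -/
def Light (b n : ℕ) (ρ : ℝ) (u : ℕ → ℂ) : Prop := ∀ θ : ℝ, ‖coef b n u θ‖ ≤ ρ

lemma sum_norm_sq_bil_le {b n p : ℕ} (hn : 0 < n) {S : Finset ℕ} (hS : S ⊆ Ico b (b + n))
    {u f : ℕ → ℂ} (hf : ∀ z, ‖f z‖ ≤ 1) {lam : ℝ} (hu : Light b n lam u) :
    ∑ x ∈ parityIco p b n, ‖bil n S u f x‖ ^ 2 ≤ lam ^ 2 * n := by
  have hn' : (0 : ℝ) < n := by exact_mod_cast hn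
  set c : ℕ → ℂ := fun j => coef b n u (j / n) *
      ∑ z ∈ S with z % 2 = p, f z * e (j * (z / (2 * n))) with hc
  have hSp : S.filter (fun z => z % 2 = p) ⊆ parityIco p b n := filter_subset_filter _ hS
  have h1 : ∑ x ∈ parityIco p b n, ‖bil n S u f x‖ ^ 2 =
      (1 / (n : ℝ)) ^ 2 * ∑ x ∈ parityIco p b n,
        ‖∑ j ∈ range n, c j * e (j * ((x : ℝ) / (2 * n)))‖ ^ 2 := by
    rw [mul_sum]
    refine sum_congr rfl fun x hx => ?_
    rw [bil_eq_sum_coef hS u f hx, norm_mul, mul_pow]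
    simp [hc]
  have h2 := sum_norm_sq_le_of_orthogonal (n := n) (S := parityIco p b n)
    (g := fun x => (x : ℝ) / (2 * n)) (fun y hy z hz h => sum_e_parity_eq_zero hy hz h) c
  have h3 : ∑ j ∈ range n, ‖c j‖ ^ 2 ≤ lam ^ 2 * (n * n) := by
    have h4 := sum_norm_sq_eq_of_orthogonal (n := n) (S := S.filter (fun z => z % 2 = p))
      (g := fun x => (x : ℝ) / (2 * n))
      (fun y hy z hz h => sum_e_parity_eq_zero (hSp hy) (hSp hz) h) f
    calc ∑ j ∈ range n, ‖c j‖ ^ 2 ≤ ∑ j ∈ range n, lam ^ 2 *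
          ‖∑ z ∈ S with z % 2 = p, f z * e (j * (z / (2 * n)))‖ ^ 2 := by
          refine sum_le_sum fun j _ => ?_
          rw [hc, norm_mul, mul_pow]
          gcongr; exact hu _
      _ = lam ^ 2 * (n * ∑ z ∈ S with z % 2 = p, ‖f z‖ ^ 2) := by rw [← mul_sum, h4]
      _ ≤ _ := by
        gcongr
        calc ∑ z ∈ S with z % 2 = p, ‖f z‖ ^ 2 ≤ ∑ z ∈ S with z % 2 = p, (1 : ℝ) :=
              sum_le_sum fun z _ => pow_le_one₀ (norm_nonneg _) (hf z)
          _ = ((S.filter (fun z => z % 2 = p)).card : ℝ) := by simp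
          _ ≤ n := by exact_mod_cast (card_le_card hSp).trans (card_parityIco_le _ _ _)
  rw [h1]
  calc _ ≤ (1 / (n : ℝ)) ^ 2 * (n * (lam ^ 2 * (n * n))) := by gcongr; exact h2.trans (by gcongr)
    _ = lam ^ 2 * n := by field_simp

/-- The odd polynomial with derivative `(1 - t ^ 2) ^ q`. -/
noncomputable def clipFun (q : ℕ) (t : ℝ) : ℝ :=
  ∑ i ∈ range (q + 1), (-1) ^ i * (q.choose i) / (2 * i + 1) * t ^ (2 * i + 1)

/-- The even polynomial with derivative `clipFun q`. -/
noncomputable def clipPrim (q : ℕ) (t : ℝ) : ℝ :=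
  ∑ i ∈ range (q + 1), (-1) ^ i * (q.choose i) / (2 * i + 1) / (2 * i + 2) * t ^ (2 * i + 2)

lemma hasDerivAt_clipFun (q : ℕ) (t : ℝ) : HasDerivAt (clipFun q) ((1 - t ^ 2) ^ q) t := by
  have h : (1 - t ^ 2) ^ q = ∑ i ∈ range (q + 1),
      (-1 : ℝ) ^ i * (q.choose i) / (2 * i + 1) * ((2 * i + 1 : ℕ) * t ^ (2 * i + 1 - 1)) := by
    rw [sub_eq_neg_add, add_pow]
    refine sum_congr rfl fun i _ => ?_
    have : (2 * (i : ℝ) + 1) ≠ 0 := by positivity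
    rw [neg_pow, ← pow_mul, Nat.add_sub_cancel]
    push_cast
    field_simp
    simp
  rw [h]
  exact HasDerivAt.fun_sum fun i _ => (hasDerivAt_pow _ t).const_mul _

lemma hasDerivAt_clipPrim (q : ℕ) (t : ℝ) : HasDerivAt (clipPrim q) (clipFun q t) t := by
  have h : clipFun q t = ∑ i ∈ range (q + 1), (-1 : ℝ) ^ i * (q.choose i) / (2 * i + 1) /
      (2 * i + 2) * ((2 * i + 2 : ℕ) * t ^ (2 * i + 2 - 1)) := by
    refine sum_congr rfl fun i _ => ?_
    have : (2 * (i : ℝ) + 1) ≠ 0 := by positivity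
    have : (2 * (i : ℝ) + 2) ≠ 0 := by positivity
    rw [show 2 * i + 2 - 1 = 2 * i + 1 by omega]
    push_cast
    field_simp
  rw [h]
  exact HasDerivAt.fun_sum fun i _ => (hasDerivAt_pow _ t).const_mul _

lemma clipFun_zero (q : ℕ) : clipFun q 0 = 0 := by simp [clipFun]
lemma clipPrim_zero (q : ℕ) : clipPrim q 0 = 0 := by simp [clipPrim]

lemma le_of_hasDerivAt_nonneg {f f' : ℝ → ℝ} (h : ∀ x, HasDerivAt f (f' x) x)
    (h' : ∀ x, 0 ≤ x → x ≤ 1 → 0 ≤ f' x) {s t : ℝ} (hs : 0 ≤ s) (hst : s ≤ t) (ht : t ≤ 1) :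
    f s ≤ f t := by
  have := monotoneOn_of_deriv_nonneg (convex_Icc (0 : ℝ) 1)
    (fun x _ => (h x).continuousAt.continuousWithinAt)
    (fun x _ => (h x).differentiableAt.differentiableWithinAt) (fun x hx => by
      rw [(h x).deriv]; rw [interior_Icc] at hx; exact h' x hx.1.le hx.2.le)
  exact this ⟨hs, hst.trans ht⟩ ⟨hs.trans hst, ht⟩ hst

lemma tangent_le {f f' : ℝ → ℝ} (h : ∀ x, HasDerivAt f (f' x) x)
    (h' : ∀ x y, 0 ≤ x → x ≤ y → y ≤ 1 → f' x ≤ f' y) {s t : ℝ} (hs : 0 ≤ s) (hs1 : s ≤ 1)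
    (ht : 0 ≤ t) (ht1 : t ≤ 1) : f t + f' t * (s - t) ≤ f s := by
  rcases lt_trichotomy s t with hst | rfl | hst
  · obtain ⟨c, hc, hc'⟩ := exists_hasDerivAt_eq_slope f f' hst
      (fun x _ => (h x).continuousAt.continuousWithinAt) (fun x _ => h x)
    rw [eq_div_iff (by linarith)] at hc'
    have := h' c t (by linarith [hc.1]) hc.2.le ht1
    nlinarith
  · simp
  · obtain ⟨c, hc, hc'⟩ := exists_hasDerivAt_eq_slope f f' hst
      (fun x _ => (h x).continuousAt.continuousWithinAt) (fun x _ => h x)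
    rw [eq_div_iff (by linarith)] at hc'
    have := h' t c ht hc.1.le (by linarith [hc.2])
    nlinarith

section radial
variable {q : ℕ} {s t : ℝ}

lemma one_sub_sq_pow_nonneg (ht : 0 ≤ t) (ht1 : t ≤ 1) : 0 ≤ (1 - t ^ 2) ^ q :=
  pow_nonneg (by nlinarith) _

lemma one_sub_sq_pow_le_one (ht : 0 ≤ t) (ht1 : t ≤ 1) : (1 - t ^ 2) ^ q ≤ 1 :=
  pow_le_one₀ (by nlinarith) (by nlinarith)

lemma clipFun_mono (hs : 0 ≤ s) (hst : s ≤ t) (ht : t ≤ 1) : clipFun q s ≤ clipFun q t :=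
  le_of_hasDerivAt_nonneg (hasDerivAt_clipFun q) (fun _ h0 h1 => one_sub_sq_pow_nonneg h0 h1)
    hs hst ht

lemma sub_clipFun_mono (hs : 0 ≤ s) (hst : s ≤ t) (ht : t ≤ 1) :
    s - clipFun q s ≤ t - clipFun q t :=
  le_of_hasDerivAt_nonneg (f := fun x => x - clipFun q x)
    (fun x => (hasDerivAt_id x).sub (hasDerivAt_clipFun q x))
    (fun _ h0 h1 => by linarith [one_sub_sq_pow_le_one (q := q) h0 h1]) hs hst ht

lemma clipFun_nonneg (ht : 0 ≤ t) (ht1 : t ≤ 1) : 0 ≤ clipFun q t := by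
  simpa [clipFun_zero] using clipFun_mono (q := q) le_rfl ht ht1

lemma clipFun_le_self (ht : 0 ≤ t) (ht1 : t ≤ 1) : clipFun q t ≤ t := by
  have := sub_clipFun_mono (q := q) le_rfl ht ht1
  rw [clipFun_zero] at this; linarith

lemma sub_clipFun_le (ht : 0 ≤ t) (ht1 : t ≤ 1) : t - clipFun q t ≤ q * t ^ 3 := by
  have := le_of_hasDerivAt_nonneg (f := fun x => q * x ^ 3 - (x - clipFun q x))
    (fun x => ((hasDerivAt_pow 3 x).const_mul (q : ℝ)).sub
      ((hasDerivAt_id x).sub (hasDerivAt_clipFun q x)))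
    (fun x h0 h1 => by
      have := one_add_mul_le_pow (a := -x ^ 2) (by nlinarith) q
      rw [← sub_eq_add_neg] at this
      have h2 : 0 ≤ (q : ℝ) * x ^ 2 := by positivity
      norm_num
      nlinarith) le_rfl ht ht1
  simp [clipFun_zero] at this
  linarith

lemma clipFun_one_le (hq : 0 < q) : clipFun q 1 ≤ 2 / Real.sqrt q := by
  have hq0 : (0 : ℝ) < q := by exact_mod_cast hq
  have hq' : 0 < Real.sqrt q := Real.sqrt_pos.2 hq0
  have := le_of_hasDerivAt_nonneg
    (f := fun x => Real.arctan (Real.sqrt q * x) / Real.sqrt q - clipFun q x)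
    (fun x => (((hasDerivAt_id x).const_mul (Real.sqrt q)).arctan.div_const _).sub
      (hasDerivAt_clipFun q x)) (fun x h0 h1 => by
        have h2 := one_add_mul_le_pow (a := x ^ 2) (by nlinarith [sq_nonneg x]) q
        have h3 := one_sub_sq_pow_nonneg (q := q) h0 h1
        have h4 : (1 - x ^ 2) ^ q * (1 + x ^ 2) ^ q ≤ 1 := by
          rw [← mul_pow]
          have : x ^ 2 ≤ 1 := by nlinarith
          exact pow_le_one₀ (by nlinarith [sq_nonneg x]) (by nlinarith [sq_nonneg (x ^ 2)])
        have h5 : 0 < 1 + q * x ^ 2 := by positivity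
        have h6 : (1 - x ^ 2) ^ q ≤ 1 / (1 + q * x ^ 2) := by
          rw [le_div_iff₀ h5]; exact (mul_le_mul_of_nonneg_left h2 h3).trans h4
        have h7 : 1 / (1 + (Real.sqrt q * id x) ^ 2) * (Real.sqrt q * 1) / Real.sqrt q =
            1 / (1 + q * x ^ 2) := by
          rw [mul_pow, Real.sq_sqrt hq0.le]; simp; field_simp
        rw [h7]; linarith) le_rfl zero_le_one le_rfl
  simp only [mul_zero, Real.arctan_zero, zero_div, clipFun_zero, sub_zero, mul_one,
    sub_nonneg] at this
  refine this.trans ?_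
  gcongr
  linarith [Real.arctan_lt_pi_div_two (Real.sqrt q), Real.pi_lt_four]

lemma clipPrim_nonneg (ht : 0 ≤ t) (ht1 : t ≤ 1) : 0 ≤ clipPrim q t := by
  have := le_of_hasDerivAt_nonneg (hasDerivAt_clipPrim q)
    (fun _ h0 h1 => clipFun_nonneg h0 h1) le_rfl ht ht1
  simpa [clipPrim_zero] using this

lemma clipPrim_le (ht : 0 ≤ t) (ht1 : t ≤ 1) : clipPrim q t ≤ clipFun q 1 := by
  have := tangent_le (hasDerivAt_clipPrim q) (fun _ _ h0 h h1 => clipFun_mono h0 h h1)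
    le_rfl zero_le_one ht ht1
  rw [clipPrim_zero] at this
  have h1 := clipFun_mono (q := q) ht ht1 le_rfl
  have h2 := clipFun_nonneg (q := q) ht ht1
  nlinarith

end radial

/-- The radial polynomial clipping map on the unit disc. -/
noncomputable def chi (q : ℕ) (a : ℂ) : ℂ :=
  ∑ i ∈ range (q + 1), (((-1) ^ i * (q.choose i) / (2 * i + 1) : ℝ) : ℂ) *
    (a * (a * (starRingEnd ℂ) a) ^ i)

/-- The convex potential whose gradient is `chi`. -/
noncomputable def phi (q : ℕ) (a : ℂ) : ℝ := clipPrim q ‖a‖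

lemma norm_mul_chi (q : ℕ) (a : ℂ) : (‖a‖ : ℂ) * chi q a = a * (clipFun q ‖a‖ : ℝ) := by
  simp only [chi, clipFun, Complex.mul_conj', mul_sum]
  push_cast
  rw [mul_sum]
  refine sum_congr rfl fun i _ => ?_
  ring

section disc
variable {q : ℕ} {a b : ℂ}

lemma chi_zero (q : ℕ) : chi q 0 = 0 := by simp [chi]

lemma norm_chi (ha : ‖a‖ ≤ 1) : ‖chi q a‖ = clipFun q ‖a‖ := by
  rcases eq_or_ne a 0 with rfl | h
  · simp [chi_zero, clipFun_zero]
  · have h1 := congrArg norm (norm_mul_chi q a)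
    simp only [norm_mul, Complex.norm_real, Real.norm_eq_abs, abs_norm,
      abs_of_nonneg (clipFun_nonneg (q := q) (norm_nonneg a) ha)] at h1
    exact mul_left_cancel₀ (norm_ne_zero_iff.2 h) h1

lemma norm_sub_chi (ha : ‖a‖ ≤ 1) : ‖a - chi q a‖ = ‖a‖ - clipFun q ‖a‖ := by
  rcases eq_or_ne a 0 with rfl | h
  · simp [chi_zero, clipFun_zero]
  · have h2 : (‖a‖ : ℂ) * (a - chi q a) = a * ((‖a‖ - clipFun q ‖a‖ : ℝ) : ℂ) := by
      rw [mul_sub, norm_mul_chi]; push_cast; ring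
    have h1 := congrArg norm h2
    simp only [norm_mul, Complex.norm_real, Real.norm_eq_abs, abs_norm,
      abs_of_nonneg (sub_nonneg.2 (clipFun_le_self (q := q) (norm_nonneg a) ha))] at h1
    exact mul_left_cancel₀ (norm_ne_zero_iff.2 h) h1

lemma norm_sub_chi_le (ha : ‖a‖ ≤ 1) : ‖a - chi q a‖ ≤ q * ‖a‖ ^ 3 := by
  rw [norm_sub_chi ha]; exact sub_clipFun_le (norm_nonneg _) ha

lemma norm_chi_le (ha : ‖a‖ ≤ 1) : ‖chi q a‖ ≤ clipFun q 1 := by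
  rw [norm_chi ha]; exact clipFun_mono (norm_nonneg _) ha le_rfl

lemma phi_nonneg (ha : ‖a‖ ≤ 1) : 0 ≤ phi q a := clipPrim_nonneg (norm_nonneg _) ha

lemma phi_le (ha : ‖a‖ ≤ 1) : phi q a ≤ clipFun q 1 := clipPrim_le (norm_nonneg _) ha

/-- The real inner product `Re (conj a * b)`. -/
noncomputable def rdot (a b : ℂ) : ℝ := ((starRingEnd ℂ) a * b).re

lemma rdot_add_right (a b c : ℂ) : rdot a (b + c) = rdot a b + rdot a c := by
  simp [rdot, mul_add]

lemma rdot_sub_right (a b c : ℂ) : rdot a (b - c) = rdot a b - rdot a c := by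
  simp [rdot, mul_sub]

lemma rdot_sub_left (a b c : ℂ) : rdot (a - b) c = rdot a c - rdot b c := by
  simp [rdot, sub_mul]

lemma rdot_le (a b : ℂ) : rdot a b ≤ ‖a‖ * ‖b‖ := by
  refine (Complex.re_le_norm _).trans ?_
  rw [norm_mul, RCLike.norm_conj]

lemma abs_rdot_le (a b : ℂ) : |rdot a b| ≤ ‖a‖ * ‖b‖ := by
  refine (Complex.abs_re_le_norm _).trans ?_
  rw [norm_mul, RCLike.norm_conj]

lemma rdot_self (a : ℂ) : rdot a a = ‖a‖ ^ 2 := by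
  rw [rdot, mul_comm, Complex.mul_conj']; norm_cast

lemma rdot_chi_self (ha : ‖a‖ ≤ 1) : rdot (chi q a) a = clipFun q ‖a‖ * ‖a‖ := by
  rcases eq_or_ne a 0 with rfl | h
  · simp [rdot]
  · have h1 := congrArg (fun z => rdot z a) (norm_mul_chi q a)
    have h2 : rdot ((‖a‖ : ℂ) * chi q a) a = ‖a‖ * rdot (chi q a) a := by
      simp [rdot, map_mul, mul_assoc]
    have h3 : rdot (a * (clipFun q ‖a‖ : ℝ)) a = clipFun q ‖a‖ * rdot a a := by
      simp only [rdot, map_mul, Complex.conj_ofReal]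
      rw [mul_comm _ ((clipFun q ‖a‖ : ℝ) : ℂ), mul_assoc, Complex.re_ofReal_mul]
    simp only [h2, h3, rdot_self] at h1
    apply mul_left_cancel₀ (norm_ne_zero_iff.2 h)
    rw [h1]; ring

/-- The tangent inequality for `phi`. -/
lemma phi_add_rdot_le (ha : ‖a‖ ≤ 1) (hb : ‖b‖ ≤ 1) :
    phi q a + rdot (chi q a) (b - a) ≤ phi q b := by
  have h1 := tangent_le (hasDerivAt_clipPrim q) (fun _ _ h0 h h1 => clipFun_mono h0 h h1)
    (norm_nonneg b) hb (norm_nonneg a) ha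
  have h2 := rdot_le (chi q a) b
  rw [norm_chi ha] at h2
  rw [rdot_sub_right, rdot_chi_self ha, phi, phi]
  linarith

/-- The tangent inequality for `‖·‖ ^ 2 / 2 - phi`. -/
lemma phi_le_add_rdot (ha : ‖a‖ ≤ 1) (hb : ‖b‖ ≤ 1) :
    phi q b ≤ phi q a + rdot (chi q a) (b - a) + ‖b - a‖ ^ 2 / 2 := by
  have h1 := tangent_le (f := fun x => x ^ 2 / 2 - clipPrim q x) (f' := fun x => x - clipFun q x)
    (fun x => (((hasDerivAt_pow 2 x).div_const 2).sub (hasDerivAt_clipPrim q x)).congr_deriv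
      (by norm_num)) (fun _ _ h0 h h1 => sub_clipFun_mono h0 h h1)
    (norm_nonneg b) hb (norm_nonneg a) ha
  have h2 := rdot_le (a - chi q a) b
  rw [norm_sub_chi ha, rdot_sub_left] at h2
  have h3 : ‖b - a‖ ^ 2 = ‖b‖ ^ 2 + ‖a‖ ^ 2 - 2 * rdot a b := by
    have hc : rdot b a = rdot a b := by simp [rdot]; ring
    rw [← rdot_self, ← rdot_self, ← rdot_self, rdot_sub_right, rdot_sub_left, rdot_sub_left, hc]
    ring
  rw [rdot_sub_right, rdot_chi_self ha, phi, phi, h3]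
  nlinarith

/-- Cocoercivity of the gradient of `phi`. -/
lemma norm_chi_sub_chi_sq_le (ha : ‖a‖ ≤ 1) (hb : ‖b‖ ≤ 1) :
    ‖chi q a - chi q b‖ ^ 2 / 2 ≤ phi q a - phi q b - rdot (chi q b) (a - b) := by
  set w := a - chi q a + chi q b with hw
  have hwn : ‖w‖ ≤ 1 := by
    refine (norm_add_le _ _).trans ?_
    have h1 := norm_chi_le (q := q) hb
    have h2 := sub_clipFun_mono (q := q) (norm_nonneg a) ha le_rfl
    rw [norm_sub_chi ha]; linarith
  have h1 := phi_add_rdot_le (q := q) hb hwn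
  have h2 := phi_le_add_rdot (q := q) ha hwn
  have h3 : w - a = - (chi q a - chi q b) := by rw [hw]; ring
  rw [h3, norm_neg, ← rdot_self (chi q a - chi q b)] at h2
  rw [← rdot_self (chi q a - chi q b)]
  have h4 : rdot (chi q a) (-(chi q a - chi q b)) - rdot (chi q b) (w - b) =
      - rdot (chi q a - chi q b) (chi q a - chi q b) - rdot (chi q b) (a - b) := by
    rw [show w - b = (a - b) - (chi q a - chi q b) by rw [hw]; ring, rdot_sub_left,
      rdot_sub_right (chi q b) (a - b), show -(chi q a - chi q b) = 0 - (chi q a - chi q b) by ring,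
      rdot_sub_right]
    simp [rdot]; ring
  linarith

end disc

/-- The trigonometric sum with the given amplitudes and frequencies. -/
noncomputable def synth (L : Multiset (ℂ × ℝ)) (y : ℕ) : ℂ :=
  (L.map fun c => c.1 * e (c.2 * y)).sum

/-- The total squared amplitude. -/
noncomputable def energy (L : Multiset (ℂ × ℝ)) : ℝ := (L.map fun c => ‖c.1‖ ^ 2).sum

lemma synth_zero (y : ℕ) : synth 0 y = 0 := by simp [synth]
lemma synth_add (L M : Multiset (ℂ × ℝ)) (y : ℕ) : synth (L + M) y = synth L y + synth M y := by
  simp [synth]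
lemma energy_zero : energy 0 = 0 := by simp [energy]
lemma energy_add (L M : Multiset (ℂ × ℝ)) : energy (L + M) = energy L + energy M := by
  simp [energy]
lemma energy_nonneg (L : Multiset (ℂ × ℝ)) : 0 ≤ energy L :=
  Multiset.sum_nonneg fun x hx => by
    obtain ⟨c, _, rfl⟩ := Multiset.mem_map.1 hx; positivity

lemma sum_norm_sq_sub_coef {b n : ℕ} (hn : 0 < n) (u : ℕ → ℂ) (θ : ℝ) :
    ∑ y ∈ Ico b (b + n), ‖u y - coef b n u θ * e (θ * y)‖ ^ 2 =
      ∑ y ∈ Ico b (b + n), ‖u y‖ ^ 2 - n * ‖coef b n u θ‖ ^ 2 := by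
  set C := coef b n u θ with hC
  have hn' : (n : ℂ) ≠ 0 := by exact_mod_cast hn.ne'
  have h1 : ∑ y ∈ Ico b (b + n), u y * e (-(θ * y)) = n * C := by
    rw [hC, coef]; field_simp
  have h2 : ∀ y : ℕ, ‖u y - C * e (θ * y)‖ ^ 2 =
      ‖u y‖ ^ 2 - 2 * rdot C (u y * e (-(θ * y))) + ‖C‖ ^ 2 := by
    intro y
    have h3 : u y - C * e (θ * y) = (u y * e (-(θ * y)) - C) * e (θ * y) := by
      have : e (-(θ * y)) * e (θ * y) = 1 := by rw [← e_add]; simp [e_zero]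
      linear_combination -(u y) * this
    have hc : rdot (u y * e (-(θ * y))) C = rdot C (u y * e (-(θ * y))) := by
      simp only [rdot, Complex.mul_re, Complex.conj_re, Complex.conj_im]; ring
    rw [h3, norm_mul, norm_e, mul_one, ← rdot_self, rdot_sub_right, rdot_sub_left, rdot_sub_left,
      rdot_self, rdot_self, norm_mul, norm_e, mul_one, hc]
    ring
  have h4 : ∑ y ∈ Ico b (b + n), rdot C (u y * e (-(θ * y))) = n * ‖C‖ ^ 2 := by
    simp only [rdot]
    rw [← Complex.re_sum, ← mul_sum, h1, ← rdot_self, rdot,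
      show (starRingEnd ℂ) C * (n * C) = ((n : ℝ) : ℂ) * ((starRingEnd ℂ) C * C) by push_cast; ring,
      Complex.re_ofReal_mul]
  simp_rw [h2, sum_add_distrib, sum_sub_distrib, ← mul_sum, h4]
  simp; ring

theorem exists_greedy (b : ℕ) {n : ℕ} (hn : 0 < n) {ρ : ℝ} (hρ : 0 < ρ) (u : ℕ → ℂ) :
    ∃ L : Multiset (ℂ × ℝ), (∀ c ∈ L, ρ ≤ ‖c.1‖) ∧ Light b n ρ (fun y => u y - synth L y) ∧
      ∑ y ∈ Ico b (b + n), ‖u y - synth L y‖ ^ 2 + n * energy L ≤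
        ∑ y ∈ Ico b (b + n), ‖u y‖ ^ 2 ∧ (Light b n ρ u → L = 0) := by
  have hn' : (0 : ℝ) < n := by exact_mod_cast hn
  have key : ∀ (k : ℕ) (u : ℕ → ℂ), ∑ y ∈ Ico b (b + n), ‖u y‖ ^ 2 ≤ k * (n * ρ ^ 2) →
      ∃ L : Multiset (ℂ × ℝ), (∀ c ∈ L, ρ ≤ ‖c.1‖) ∧ Light b n ρ (fun y => u y - synth L y) ∧
      ∑ y ∈ Ico b (b + n), ‖u y - synth L y‖ ^ 2 + n * energy L ≤
        ∑ y ∈ Ico b (b + n), ‖u y‖ ^ 2 ∧ (Light b n ρ u → L = 0) := by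
    intro k
    induction k with
    | zero =>
      intro u hu
      refine ⟨0, by simp, ?_, by simp [synth_zero, energy_zero], fun _ => rfl⟩
      intro θ
      have h := sum_norm_sq_sub_coef (b := b) hn u θ
      have h0 : 0 ≤ ∑ y ∈ Ico b (b + n), ‖u y - coef b n u θ * e (θ * y)‖ ^ 2 := by positivity
      simp only [synth_zero, sub_zero]
      have : (n : ℝ) * ‖coef b n u θ‖ ^ 2 ≤ 0 := by
        rw [h] at h0; push_cast at hu; linarith
      have h2 : ‖coef b n u θ‖ ^ 2 ≤ 0 := by
        by_contra h3; push Not at h3; nlinarith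
      have h3 : ‖coef b n u θ‖ = 0 := by
        have := sq_nonneg ‖coef b n u θ‖
        exact pow_eq_zero_iff (two_ne_zero) |>.1 (le_antisymm h2 this)
      rw [h3]; exact hρ.le
    | succ k ih =>
      intro u hu
      by_cases hl : Light b n ρ u
      · exact ⟨0, by simp, by simpa [synth_zero] using hl, by simp [synth_zero, energy_zero],
          fun _ => rfl⟩
      · have hl' := hl
        simp only [Light, not_forall, not_le] at hl'
        obtain ⟨θ, hθ⟩ := hl'
        have h := sum_norm_sq_sub_coef (b := b) hn u θ
        have hsq : ρ ^ 2 ≤ ‖coef b n u θ‖ ^ 2 := pow_le_pow_left₀ hρ.le hθ.le 2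
        obtain ⟨L, hL1, hL2, hL3, -⟩ := ih (fun y => u y - coef b n u θ * e (θ * y)) (by
          rw [h]; push_cast at hu; nlinarith)
        have hs : ∀ y, u y - synth ((coef b n u θ, θ) ::ₘ L) y =
            u y - coef b n u θ * e (θ * y) - synth L y := by
          intro y; simp [synth]; ring
        refine ⟨(coef b n u θ, θ) ::ₘ L, ?_, ?_, ?_, fun h' => absurd h' hl⟩
        · intro c hc
          rcases Multiset.mem_cons.1 hc with rfl | hc
          · exact hθ.le
          · exact hL1 c hc
        · simp_rw [hs]; exact hL2
        · simp_rw [hs]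
          have : energy ((coef b n u θ, θ) ::ₘ L) = ‖coef b n u θ‖ ^ 2 + energy L := by
            simp [energy]
          rw [this]
          rw [h] at hL3
          linarith
  obtain ⟨k, hk⟩ := exists_nat_ge ((∑ y ∈ Ico b (b + n), ‖u y‖ ^ 2) / (n * ρ ^ 2))
  exact key k u ((div_le_iff₀ (by positivity)).1 hk)

open Classical in
/-- A multiset of frequencies with their amplitudes whose removal makes `u` light. -/
noncomputable def greedy (b n : ℕ) (ρ : ℝ) (u : ℕ → ℂ) : Multiset (ℂ × ℝ) :=
  if h : 0 < n ∧ 0 < ρ then (exists_greedy b h.1 h.2 u).choose else 0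

lemma greedy_spec (b : ℕ) {n : ℕ} (hn : 0 < n) {ρ : ℝ} (hρ : 0 < ρ) (u : ℕ → ℂ) :
    (∀ c ∈ greedy b n ρ u, ρ ≤ ‖c.1‖) ∧ Light b n ρ (fun y => u y - synth (greedy b n ρ u) y) ∧
      ∑ y ∈ Ico b (b + n), ‖u y - synth (greedy b n ρ u) y‖ ^ 2 + n * energy (greedy b n ρ u) ≤
        ∑ y ∈ Ico b (b + n), ‖u y‖ ^ 2 ∧ (Light b n ρ u → greedy b n ρ u = 0) := by
  rw [greedy, dif_pos ⟨hn, hρ⟩]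
  exact (exists_greedy b hn hρ u).choose_spec

/-- Cumulative selected frequencies along the dyadic tree on `[0, 2 ^ J)`. -/
noncomputable def births (J : ℕ) (ρ : ℝ) (f : ℕ → ℂ) : ℕ → ℕ → Multiset (ℂ × ℝ)
  | 0, j => greedy (j * 2 ^ J) (2 ^ J) ρ f
  | d + 1, j => greedy (j * 2 ^ (J - (d + 1))) (2 ^ (J - (d + 1))) ρ
      (fun y => f y - synth (births J ρ f d (j / 2)) y) + births J ρ f d (j / 2)

section births
variable (J : ℕ) {ρ : ℝ} (hρ : 0 < ρ) (f : ℕ → ℂ)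
include hρ

lemma births_amp (d j : ℕ) : ∀ c ∈ births J ρ f d j, ρ ≤ ‖c.1‖ := by
  induction d generalizing j with
  | zero => exact (greedy_spec _ (by positivity) hρ f).1
  | succ d ih =>
    intro c hc
    rw [births, Multiset.mem_add] at hc
    rcases hc with hc | hc
    · exact (greedy_spec _ (by positivity) hρ _).1 c hc
    · exact ih _ c hc

lemma births_light (d j : ℕ) :
    Light (j * 2 ^ (J - d)) (2 ^ (J - d)) ρ (fun y => f y - synth (births J ρ f d j) y) := by
  cases d with
  | zero => exact (greedy_spec _ (by positivity) hρ f).2.1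
  | succ d =>
    have h := (greedy_spec (j * 2 ^ (J - (d + 1))) (n := 2 ^ (J - (d + 1))) (by positivity) hρ
      (fun y => f y - synth (births J ρ f d (j / 2)) y)).2.1
    convert h using 2 with y
    rw [births, synth_add]; ring

omit hρ in
lemma births_mono (d j : ℕ) : births J ρ f d (j / 2) ≤ births J ρ f (d + 1) j :=
  Multiset.le_add_left _ _

lemma births_eq_zero (d j : ℕ)
    (h : ∀ k ≤ d, Light (j / 2 ^ (d - k) * 2 ^ (J - k)) (2 ^ (J - k)) ρ f) :
    births J ρ f d j = 0 := by
  induction d generalizing j with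
  | zero =>
    have := h 0 le_rfl
    simp only [Nat.sub_zero, pow_zero, Nat.div_one] at this
    exact (greedy_spec _ (by positivity) hρ f).2.2.2 this
  | succ d ih =>
    have h0 : births J ρ f d (j / 2) = 0 := ih _ fun k hk => by
      have := h k (by omega)
      rwa [Nat.div_div_eq_div_mul, ← pow_succ', show d - k + 1 = d + 1 - k by omega]
    have h1 := h (d + 1) le_rfl
    simp only [Nat.sub_self, pow_zero, Nat.div_one] at h1
    rw [births, h0, (greedy_spec _ (by positivity) hρ _).2.2.2 (by simpa [synth_zero] using h1)]
    simp

end births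

lemma sum_range_two_mul (n : ℕ) (F : ℕ → ℝ) :
    ∑ j ∈ range (2 * n), F j = ∑ j ∈ range n, (F (2 * j) + F (2 * j + 1)) := by
  induction n with
  | zero => simp
  | succ n ih => rw [show 2 * (n + 1) = 2 * n + 1 + 1 by ring, sum_range_succ, sum_range_succ, ih,
      sum_range_succ]; ring

lemma sum_range_two_pow_succ (d : ℕ) (F : ℕ → ℝ) :
    ∑ j ∈ range (2 ^ (d + 1)), F j = ∑ j ∈ range (2 ^ d), (F (2 * j) + F (2 * j + 1)) := by
  rw [pow_succ', sum_range_two_mul]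

lemma sum_node_eq {J d : ℕ} (hd : d < J) (j : ℕ) (F : ℕ → ℝ) :
    ∑ y ∈ Ico (j * 2 ^ (J - d)) (j * 2 ^ (J - d) + 2 ^ (J - d)), F y =
      ∑ y ∈ Ico (2 * j * 2 ^ (J - (d + 1))) (2 * j * 2 ^ (J - (d + 1)) + 2 ^ (J - (d + 1))), F y +
      ∑ y ∈ Ico ((2 * j + 1) * 2 ^ (J - (d + 1)))
        ((2 * j + 1) * 2 ^ (J - (d + 1)) + 2 ^ (J - (d + 1))), F y := by
  have h : 2 ^ (J - d) = 2 * 2 ^ (J - (d + 1)) := by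
    rw [← pow_succ']; congr 1; omega
  rw [h, show (2 * j + 1) * 2 ^ (J - (d + 1)) =
      2 * j * 2 ^ (J - (d + 1)) + 2 ^ (J - (d + 1)) by ring,
    sum_Ico_consecutive _ (by omega) (by omega)]
  congr 2 <;> ring

lemma births_energy (J : ℕ) {ρ : ℝ} (hρ : 0 < ρ) {f : ℕ → ℂ} (hf : ∀ y, ‖f y‖ ≤ 1) {d : ℕ}
    (hd : d ≤ J) : ∑ j ∈ range (2 ^ d), energy (births J ρ f d j) ≤ 2 ^ d := by
  set E : ℕ → ℕ → ℝ := fun d j =>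
    ∑ y ∈ Ico (j * 2 ^ (J - d)) (j * 2 ^ (J - d) + 2 ^ (J - d)),
      ‖f y - synth (births J ρ f d j) y‖ ^ 2 + (2 ^ (J - d) : ℕ) * energy (births J ρ f d j) with hE
  have key : ∀ d ≤ J, ∑ j ∈ range (2 ^ d), E d j ≤ 2 ^ J := by
    intro d
    induction d with
    | zero =>
      intro _
      have h := (greedy_spec (0 * 2 ^ J) (n := 2 ^ J) (by positivity) hρ f).2.2.1
      simp only [hE, pow_zero, range_one, sum_singleton, Nat.sub_zero, births]
      refine h.trans ((sum_le_sum fun y _ => pow_le_one₀ (norm_nonneg _) (hf y)).trans ?_)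
      simp
    | succ d ih =>
      intro hd
      refine le_trans ?_ (ih (by omega))
      rw [sum_range_two_pow_succ]
      refine sum_le_sum fun j _ => ?_
      have hc : ∀ i, E (d + 1) i ≤ ∑ y ∈ Ico (i * 2 ^ (J - (d + 1)))
          (i * 2 ^ (J - (d + 1)) + 2 ^ (J - (d + 1))),
            ‖f y - synth (births J ρ f d (i / 2)) y‖ ^ 2 +
              (2 ^ (J - (d + 1)) : ℕ) * energy (births J ρ f d (i / 2)) := by
        intro i
        have h := (greedy_spec (i * 2 ^ (J - (d + 1))) (n := 2 ^ (J - (d + 1))) (by positivity) hρ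
          (fun y => f y - synth (births J ρ f d (i / 2)) y)).2.2.1
        simp only [hE, births, energy_add, synth_add, mul_add]
        simp only [sub_sub, add_comm (synth (births J ρ f d (i / 2)) _)] at h
        linarith
      have h0 := hc (2 * j)
      have h1 := hc (2 * j + 1)
      rw [show 2 * j / 2 = j by omega] at h0
      rw [show (2 * j + 1) / 2 = j by omega] at h1
      have h2 : ((2 ^ (J - d) : ℕ) : ℝ) = 2 * (2 ^ (J - (d + 1)) : ℕ) := by
        rw [show J - d = J - (d + 1) + 1 by omega, pow_succ']; push_cast; ring
      simp only [hE] at h0 h1 ⊢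
      rw [sum_node_eq (by omega) j, h2]
      linarith
  have h1 := key d hd
  have h2 : ∑ j ∈ range (2 ^ d), 2 ^ (J - d) * energy (births J ρ f d j) ≤ 2 ^ J := by
    refine (sum_le_sum fun j _ => ?_).trans h1
    simp only [hE]
    push_cast
    have : 0 ≤ ∑ y ∈ Ico (j * 2 ^ (J - d)) (j * 2 ^ (J - d) + 2 ^ (J - d)),
      ‖f y - synth (births J ρ f d j) y‖ ^ 2 := by positivity
    linarith
  rw [← mul_sum] at h2
  have h3 : (2 : ℝ) ^ J = 2 ^ (J - d) * 2 ^ d := by rw [← pow_add]; congr 1; omega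
  rw [h3] at h2
  exact le_of_mul_le_mul_left h2 (by positivity)

lemma sum_Ico_mul {α : Type*} [AddCommMonoid α] (b n M : ℕ) (F : ℕ → α) :
    ∑ z ∈ Ico b (b + M * n), F z = ∑ c ∈ range M, ∑ z ∈ Ico (b + c * n) (b + c * n + n), F z := by
  induction M with
  | zero => simp
  | succ M ih =>
    rw [sum_range_succ, ← ih, sum_Ico_consecutive _ (by omega) (by omega)]
    congr 2; ring

/-- Space of trigonometric polynomials `η ↦ ∑ z ∈ S, c z * e (η * z)`. -/
noncomputable def trigSpan (S : Set ℤ) : Submodule ℂ (ℝ → ℂ) :=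
  Submodule.span ℂ ((fun z : ℤ => fun η : ℝ => e (η * z)) '' S)

lemma trigSpan_mono {S S' : Set ℤ} (h : S ⊆ S') : trigSpan S ≤ trigSpan S' :=
  Submodule.span_mono (Set.image_mono h)

lemma e_mem_trigSpan {S : Set ℤ} {z : ℤ} (hz : z ∈ S) : (fun η : ℝ => e (η * z)) ∈ trigSpan S :=
  Submodule.subset_span ⟨z, hz, rfl⟩

lemma mul_mem_trigSpan {S S' S'' : Set ℤ} (h : ∀ y ∈ S, ∀ z ∈ S', y + z ∈ S'') {g g' : ℝ → ℂ}
    (hg : g ∈ trigSpan S) (hg' : g' ∈ trigSpan S') : g * g' ∈ trigSpan S'' := by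
  have h1 := Submodule.mul_mem_mul hg hg'
  rw [trigSpan, trigSpan, Submodule.span_mul_span] at h1
  refine Submodule.span_le.2 ?_ h1
  rintro _ ⟨_, ⟨y, hy, rfl⟩, _, ⟨z, hz, rfl⟩, rfl⟩
  have h2 : (fun η : ℝ => e (η * y)) * (fun η : ℝ => e (η * z)) =
      fun η : ℝ => e (η * (y + z : ℤ)) := by
    ext η
    simp only [Pi.mul_apply, ← e_add]
    congr 1; push_cast; ring
  have h3 := e_mem_trigSpan (h y hy z hz)
  rw [← h2] at h3
  exact h3

/-- The sum of the amplitudes of `L`, weighted by `G` and modulated at half frequencies. -/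
noncomputable def pair (L : Multiset (ℂ × ℝ)) (G : ℝ → ℂ) (x : ℕ) : ℂ :=
  (L.map fun c => c.1 * e (c.2 / 2 * x) * G (c.2 / 2)).sum

lemma pair_add (L : Multiset (ℂ × ℝ)) (G G' : ℝ → ℂ) (x : ℕ) :
    pair L (G + G') x = pair L G x + pair L G' x := by
  simp [pair, mul_add, Multiset.sum_map_add]

lemma pair_smul (L : Multiset (ℂ × ℝ)) (r : ℂ) (G : ℝ → ℂ) (x : ℕ) :
    pair L (r • G) x = r * pair L G x := by
  rw [pair, pair, ← Multiset.sum_map_mul_left]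
  congr 2; ext c; simp; ring

lemma pair_sub (L : Multiset (ℂ × ℝ)) (G G' : ℝ → ℂ) (x : ℕ) :
    pair L (G - G') x = pair L G x - pair L G' x := by
  rw [sub_eq_add_neg, ← neg_one_smul ℂ G', pair_add, pair_smul]; ring

lemma pair_sum {ι : Type*} (L : Multiset (ℂ × ℝ)) (s : Finset ι) (G : ι → ℝ → ℂ) (x : ℕ) :
    pair L (∑ i ∈ s, G i) x = ∑ i ∈ s, pair L (G i) x := by
  classical
  induction s using Finset.induction_on with
  | empty => simp [pair]
  | insert a s ha ih => rw [sum_insert ha, sum_insert ha, pair_add, ih]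

lemma pair_add_left (L L' : Multiset (ℂ × ℝ)) (G : ℝ → ℂ) (x : ℕ) :
    pair (L + L') G x = pair L G x + pair L' G x := by simp [pair]

lemma pair_eq_sum_coef {b n p x : ℕ} (hx : x ∈ parityIco p b n) (L : Multiset (ℂ × ℝ))
    {G : ℝ → ℂ} (hG : G ∈ trigSpan ((fun z : ℕ => (z : ℤ)) '' (parityIco p b n : Set ℕ))) :
    pair L G x = ∑ j ∈ range n, coef b n (synth L) (j / n) * e (j * (x / (2 * n))) *
      G (j * (1 / (2 * n))) := by
  induction hG using Submodule.span_induction with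
  | mem G hG =>
    obtain ⟨_, ⟨z, hz, rfl⟩, rfl⟩ := hG
    have hz' := mem_parityIco.1 (Finset.mem_coe.1 hz)
    have hx' := mem_parityIco.1 hx
    have hn : (n : ℝ) ≠ 0 := by
      have : n ≠ 0 := by omega
      exact_mod_cast this
    have hc : (((x + z) / 2 : ℕ) : ℝ) = ((x : ℝ) + z) / 2 := by
      rw [Nat.cast_div (by omega) (by norm_num)]; push_cast; ring
    have h1 : pair L (fun η : ℝ => e (η * ((z : ℤ) : ℝ))) x = synth L ((x + z) / 2) := by
      rw [pair, synth]
      congr 2; ext c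
      rw [hc, mul_assoc, ← e_add]
      congr 2; push_cast; ring
    rw [h1, ← sum_coef_mul_e (synth L) (b := b) (n := n) (y := (x + z) / 2)
      (by rw [mem_Ico]; omega)]
    refine sum_congr rfl fun j _ => ?_
    rw [mul_assoc, ← e_add, hc]
    congr 2; push_cast; field_simp
  | zero => simp [pair]
  | add G G' _ _ h h' => rw [pair_add, h, h', ← sum_add_distrib]; simp [mul_add]
  | smul r G _ h =>
    rw [pair_smul, h, mul_sum]
    exact sum_congr rfl fun j _ => by simp only [Pi.smul_apply, smul_eq_mul]; ring

/-- Normalised exponential sum of `f` over the elements of parity `p` of a dyadic node. -/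
noncomputable def expAvg (J : ℕ) (f : ℕ → ℂ) (p d j : ℕ) (η : ℝ) : ℂ :=
  (1 / (2 ^ (J - d) : ℂ)) *
    ∑ z ∈ parityIco p (j * 2 ^ (J - d)) (2 ^ (J - d)), f z * e (η * z)

section expAvg
variable {J : ℕ} {f : ℕ → ℂ} {p d j : ℕ} {η : ℝ}

lemma norm_expAvg_le (hf : ∀ z, ‖f z‖ ≤ 1) : ‖expAvg J f p d j η‖ ≤ 1 := by
  rw [expAvg, norm_mul]
  have h1 : ‖∑ z ∈ parityIco p (j * 2 ^ (J - d)) (2 ^ (J - d)), f z * e (η * z)‖ ≤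
      2 ^ (J - d) := by
    refine (norm_sum_le _ _).trans ?_
    calc _ ≤ ∑ z ∈ parityIco p (j * 2 ^ (J - d)) (2 ^ (J - d)), (1 : ℝ) :=
          sum_le_sum fun z _ => by rw [norm_mul, norm_e, mul_one]; exact hf z
      _ = ((parityIco p (j * 2 ^ (J - d)) (2 ^ (J - d))).card : ℝ) := by simp
      _ ≤ _ := by exact_mod_cast card_parityIco_le _ _ _
  simp only [norm_div, norm_one, norm_pow, RCLike.norm_ofNat]
  rw [one_div, inv_mul_le_iff₀ (by positivity)]
  linarith

/-- A block of `M` nodes of the same depth. -/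
lemma sum_expAvg (M : ℕ) :
    (1 / (2 ^ (J - d) : ℂ)) * ∑ z ∈ parityIco p (j * 2 ^ (J - d)) (M * 2 ^ (J - d)),
      f z * e (η * z) = ∑ c ∈ range M, expAvg J f p d (j + c) η := by
  simp only [expAvg, ← mul_sum, parityIco, sum_filter]
  rw [sum_Ico_mul]
  simp only [add_mul]

lemma expAvg_eq_avg {k : ℕ} (hd : d + k ≤ J) :
    expAvg J f p d j η = (1 / (2 ^ k : ℂ)) *
      ∑ c ∈ range (2 ^ k), expAvg J f p (d + k) (j * 2 ^ k + c) η := by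
  rw [← sum_expAvg, expAvg]
  have h : 2 ^ (J - d) = 2 ^ k * 2 ^ (J - (d + k)) := by rw [← pow_add]; congr 1; omega
  have h' : (2 : ℂ) ^ (J - d) = 2 ^ k * 2 ^ (J - (d + k)) := by exact_mod_cast h
  rw [h, h', mul_assoc]
  field_simp

end expAvg

lemma expAvg_mem_trigSpan (J : ℕ) (f : ℕ → ℂ) (p d j : ℕ) :
    expAvg J f p d j ∈ trigSpan {z : ℤ | (j * 2 ^ (J - d) ≤ z ∧ z < j * 2 ^ (J - d) + 2 ^ (J - d)) ∧
      z % 2 = p} := by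
  have h : expAvg J f p d j = ∑ z ∈ parityIco p (j * 2 ^ (J - d)) (2 ^ (J - d)),
      ((1 / (2 ^ (J - d) : ℂ)) * f z) • fun η : ℝ => e (η * ((z : ℤ) : ℝ)) := by
    ext η
    simp only [expAvg, mul_sum, Finset.sum_apply, Pi.smul_apply, smul_eq_mul]
    exact sum_congr rfl fun z _ => by push_cast; ring
  rw [h]
  refine Submodule.sum_mem _ fun z hz => Submodule.smul_mem _ _ (e_mem_trigSpan ?_)
  rw [mem_parityIco] at hz
  simp only [Set.mem_ofPred_eq]
  refine ⟨⟨by exact_mod_cast hz.1.1, by exact_mod_cast hz.1.2⟩, by omega⟩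

lemma conj_expAvg_mem_trigSpan (J : ℕ) (f : ℕ → ℂ) (p d j : ℕ) :
    (fun η => (starRingEnd ℂ) (expAvg J f p d j η)) ∈ trigSpan
      {z : ℤ | (j * 2 ^ (J - d) ≤ -z ∧ -z < j * 2 ^ (J - d) + 2 ^ (J - d)) ∧
      (-z) % 2 = p} := by
  have h : (fun η => (starRingEnd ℂ) (expAvg J f p d j η)) =
      ∑ z ∈ parityIco p (j * 2 ^ (J - d)) (2 ^ (J - d)),
      (starRingEnd ℂ) ((1 / (2 ^ (J - d) : ℂ)) * f z) • fun η : ℝ => e (η * ((-z : ℤ) : ℝ)) := by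
    ext η
    simp only [expAvg, mul_sum, Finset.sum_apply, Pi.smul_apply, smul_eq_mul, map_sum]
    refine sum_congr rfl fun z _ => ?_
    have : η * ((-z : ℤ) : ℝ) = -(η * z) := by push_cast; ring
    rw [this, e_neg, ← map_mul, mul_assoc]
  rw [h]
  refine Submodule.sum_mem _ fun z hz => Submodule.smul_mem _ _ (e_mem_trigSpan ?_)
  rw [mem_parityIco] at hz
  simp only [Set.mem_ofPred_eq, neg_neg]
  refine ⟨⟨by exact_mod_cast hz.1.1, by exact_mod_cast hz.1.2⟩, by omega⟩

lemma chi_expAvg_mem_trigSpan (J : ℕ) (f : ℕ → ℂ) (p d j q : ℕ) :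
    (fun η => chi q (expAvg J f p d j η)) ∈ trigSpan
      {z : ℤ | (j * 2 ^ (J - d) - q * 2 ^ (J - d) ≤ z ∧
        z < j * 2 ^ (J - d) + 2 ^ (J - d) + q * 2 ^ (J - d)) ∧ z % 2 = p} := by
  set N : ℤ := 2 ^ (J - d) with hN
  have hN0 : 0 < N := by positivity
  set a := expAvg J f p d j with ha
  set a' : ℝ → ℂ := fun η => (starRingEnd ℂ) (a η) with ha'
  have h1 : a * a' ∈ trigSpan {z : ℤ | (-N < z ∧ z < N) ∧ z % 2 = 0} := by
    refine mul_mem_trigSpan ?_ (expAvg_mem_trigSpan J f p d j)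
      (conj_expAvg_mem_trigSpan J f p d j)
    rintro y ⟨⟨hy1, hy2⟩, hy3⟩ z ⟨⟨hz1, hz2⟩, hz3⟩
    rw [← hN] at hy1 hy2 hz1 hz2
    refine ⟨⟨by linarith, by linarith⟩, by omega⟩
  have h2 : ∀ i : ℕ, a * (a * a') ^ i ∈ trigSpan {z : ℤ | (j * N - i * N ≤ z ∧
      z < j * N + N + i * N) ∧ z % 2 = p} := by
    intro i
    induction i with
    | zero => simpa using expAvg_mem_trigSpan J f p d j
    | succ i ih =>
      rw [pow_succ, ← mul_assoc]
      refine mul_mem_trigSpan ?_ ih h1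
      rintro y ⟨⟨hy1, hy2⟩, hy3⟩ z ⟨⟨hz1, hz2⟩, hz3⟩
      push_cast
      refine ⟨⟨by linarith, by linarith⟩, by omega⟩
  have h3 : (fun η => chi q (a η)) = ∑ i ∈ range (q + 1),
      (((-1) ^ i * (q.choose i) / (2 * i + 1) : ℝ) : ℂ) • (a * (a * a') ^ i) := by
    ext η; simp [chi, Finset.sum_apply, ha']
  rw [h3]
  refine Submodule.sum_mem _ fun i hi => Submodule.smul_mem _ _ (trigSpan_mono ?_ (h2 i))
  have hi' : (i : ℤ) ≤ q := by
    have := mem_range.1 hi; omega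
  have : (i : ℤ) * N ≤ q * N := by gcongr
  rintro z ⟨⟨hz1, hz2⟩, hz3⟩
  exact ⟨⟨by linarith, by linarith⟩, hz3⟩

/-- Replacing `expAvg` by its clipped version costs little. -/
lemma norm_pair_sub_chi_le {J : ℕ} {f : ℕ → ℂ} (hf : ∀ z, ‖f z‖ ≤ 1) {p d j k i q x : ℕ} {lam : ℝ}
    (hd : d + k ≤ J) (hi1 : j * 2 ^ k + q ≤ i) (hi2 : i + 1 + q ≤ (j + 1) * 2 ^ k)
    {L : Multiset (ℂ × ℝ)}
    (hL : Light (j * 2 ^ (J - d)) (2 ^ (J - d)) lam (synth L))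
    (hx : x ∈ parityIco p (j * 2 ^ (J - d)) (2 ^ (J - d))) :
    ‖pair L (fun η => expAvg J f p (d + k) i η - chi q (expAvg J f p (d + k) i η)) x‖ ≤
      lam * q * 2 ^ k := by
  set N := 2 ^ (J - (d + k)) with hN
  have hn : 2 ^ (J - d) = 2 ^ k * N := by rw [hN, ← pow_add]; congr 1; omega
  have hlam : 0 ≤ lam := (norm_nonneg _).trans (hL 0)
  have hin1 : j * 2 ^ (J - d) + q * N ≤ i * N := by
    rw [hn]; nlinarith [Nat.mul_le_mul_right N hi1]
  have hin2 : i * N + N + q * N ≤ j * 2 ^ (J - d) + 2 ^ (J - d) := by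
    rw [hn]; nlinarith [Nat.mul_le_mul_right N hi2]
  have hG : (fun η => expAvg J f p (d + k) i η - chi q (expAvg J f p (d + k) i η)) ∈
      trigSpan ((fun z : ℕ => (z : ℤ)) ''
        (parityIco p (j * 2 ^ (J - d)) (2 ^ (J - d)) : Set ℕ)) := by
    refine Submodule.sub_mem _ (trigSpan_mono ?_ (expAvg_mem_trigSpan J f p (d + k) i))
      (trigSpan_mono ?_ (chi_expAvg_mem_trigSpan J f p (d + k) i q))
    · rintro z ⟨⟨hz1, hz2⟩, hz3⟩
      have hz0 : 0 ≤ z := le_trans (by positivity) hz1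
      lift z to ℕ using hz0
      refine ⟨z, ?_, rfl⟩
      have hz1' : i * N ≤ z := by exact_mod_cast hz1
      have hz2' : z < i * N + N := by exact_mod_cast hz2
      rw [Finset.mem_coe, mem_parityIco]
      omega
    · rintro z ⟨⟨hz1, hz2⟩, hz3⟩
      have hin1' : (j : ℤ) * 2 ^ (J - d) + q * 2 ^ (J - (d + k)) ≤ i * 2 ^ (J - (d + k)) := by
        exact_mod_cast hin1
      have hz0 : 0 ≤ z := le_trans (by positivity) (show (j : ℤ) * 2 ^ (J - d) ≤ z by linarith)
      lift z to ℕ using hz0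
      refine ⟨z, ?_, rfl⟩
      have hz1' : i * N ≤ z + q * N := by
        have : (i : ℤ) * 2 ^ (J - (d + k)) ≤ z + q * 2 ^ (J - (d + k)) := by linarith
        exact_mod_cast this
      have hz2' : z < i * N + N + q * N := by exact_mod_cast hz2
      rw [Finset.mem_coe, mem_parityIco]
      omega
  rw [pair_eq_sum_coef hx L hG]
  have hn0 : (0 : ℝ) < 2 ^ (J - d) := by positivity
  have hN0 : (0 : ℝ) < N := by rw [hN]; positivity
  set A : ℕ → ℂ := fun m => expAvg J f p (d + k) i (m * (1 / (2 * (2 ^ (J - d) : ℕ)))) with hA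
  have hpars : ∑ m ∈ range (2 ^ (J - d)), ‖A m‖ ^ 2 ≤ 2 ^ k := by
    have hsub : parityIco p (i * N) N ⊆ parityIco p (j * 2 ^ (J - d)) (2 ^ (J - d)) := by
      intro z hz
      rw [mem_parityIco] at hz ⊢
      omega
    have h := sum_norm_sq_eq_of_orthogonal (n := 2 ^ (J - d)) (S := parityIco p (i * N) N)
      (g := fun z => (z : ℝ) / (2 * (2 ^ (J - d) : ℕ)))
      (fun y hy z hz hyz => sum_e_parity_eq_zero (hsub hy) (hsub hz) hyz) f
    have h1 : ∀ m : ℕ, ‖A m‖ ^ 2 = (1 / (N : ℝ)) ^ 2 *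
        ‖∑ z ∈ parityIco p (i * N) N, f z * e (m * (z / (2 * (2 ^ (J - d) : ℕ))))‖ ^ 2 := by
      intro m
      rw [hA]
      simp only [expAvg]
      have h2 : ∀ z : ℕ, e (m * (1 / (2 * (2 ^ (J - d) : ℕ))) * z) =
          e (m * (z / (2 * (2 ^ (J - d) : ℕ)))) := fun z => by congr 1; ring
      simp_rw [h2]
      rw [norm_mul, mul_pow]
      simp [hN]
    simp_rw [h1, ← mul_sum, h]
    have h2 : ∑ z ∈ parityIco p (i * N) N, ‖f z‖ ^ 2 ≤ N := by
      calc _ ≤ ∑ z ∈ parityIco p (i * N) N, (1 : ℝ) :=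
            sum_le_sum fun z _ => pow_le_one₀ (norm_nonneg _) (hf z)
        _ = ((parityIco p (i * N) N).card : ℝ) := by simp
        _ ≤ _ := by exact_mod_cast card_parityIco_le _ _ _
    rw [hn]; push_cast
    calc _ ≤ (1 / (N : ℝ)) ^ 2 * (2 ^ k * N * N) := by gcongr
      _ = 2 ^ k := by field_simp
  calc _ ≤ ∑ m ∈ range (2 ^ (J - d)), lam * (q * ‖A m‖ ^ 2) := by
        refine (norm_sum_le _ _).trans (sum_le_sum fun m _ => ?_)
        rw [norm_mul, norm_mul, norm_e, mul_one]
        have h1 : ‖A m‖ ≤ 1 := norm_expAvg_le hf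
        refine mul_le_mul (hL _) ((norm_sub_chi_le h1).trans ?_) (norm_nonneg _) hlam
        gcongr 1
        rw [pow_succ]
        exact mul_le_of_le_one_right (by positivity) h1
    _ = lam * (q * ∑ m ∈ range (2 ^ (J - d)), ‖A m‖ ^ 2) := by rw [← mul_sum, ← mul_sum]
    _ ≤ lam * (q * 2 ^ k) := by gcongr
    _ = _ := by ring

/-- The clipped bilinear symbol of the node `(d, j)`. -/
noncomputable def clipAvg (J : ℕ) (f : ℕ → ℂ) (q k k0 κ p d j : ℕ) (η : ℝ) : ℂ :=
  (1 / (2 ^ k : ℂ)) * ∑ c ∈ range (2 ^ (k - k0)),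
    chi q (expAvg J f p (d + k) ((j * 2 ^ k0 + κ) * 2 ^ (k - k0) + c) η)

/-- The window of the bilinear averages. -/
def window (J k0 κ d j : ℕ) : Finset ℕ :=
  Ico ((j * 2 ^ k0 + κ) * 2 ^ (J - (d + k0))) ((j * 2 ^ k0 + κ) * 2 ^ (J - (d + k0)) +
    2 ^ (J - (d + k0)))

lemma window_subset {J k0 κ d j : ℕ} (hd : d + k0 ≤ J) (hκ : κ < 2 ^ k0) :
    window J k0 κ d j ⊆ Ico (j * 2 ^ (J - d)) (j * 2 ^ (J - d) + 2 ^ (J - d)) := by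
  have hn : 2 ^ (J - d) = 2 ^ k0 * 2 ^ (J - (d + k0)) := by rw [← pow_add]; congr 1; omega
  intro z hz
  rw [window, mem_Ico] at hz
  rw [mem_Ico, hn]
  constructor
  · refine le_trans ?_ hz.1
    rw [← mul_assoc]; gcongr; omega
  · refine lt_of_lt_of_le hz.2 ?_
    rw [← mul_assoc, ← add_mul, ← Nat.succ_mul]
    gcongr
    omega

lemma bil_window_eq_pair {J : ℕ} {f : ℕ → ℂ} {p d j k k0 κ x : ℕ}
    (hd : d + k ≤ J) (hk : k0 ≤ k) {L : Multiset (ℂ × ℝ)} (hxp : x % 2 = p) :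
    bil (2 ^ (J - d)) (window J k0 κ d j) (synth L) f x =
      pair L ((1 / (2 ^ k : ℂ)) • ∑ c ∈ range (2 ^ (k - k0)),
        expAvg J f p (d + k) ((j * 2 ^ k0 + κ) * 2 ^ (k - k0) + c)) x := by
  have hn : (2 : ℂ) ^ (J - d) = 2 ^ k * 2 ^ (J - (d + k)) := by rw [← pow_add]; congr 1; omega
  have hw : 2 ^ (J - (d + k0)) = 2 ^ (k - k0) * 2 ^ (J - (d + k)) := by
    rw [← pow_add]; congr 1; omega
  have hG : ((1 / (2 ^ k : ℂ)) • ∑ c ∈ range (2 ^ (k - k0)),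
        expAvg J f p (d + k) ((j * 2 ^ k0 + κ) * 2 ^ (k - k0) + c)) =
      (1 / (2 ^ (J - d) : ℂ)) • ∑ z ∈ window J k0 κ d j with z % 2 = p,
        f z • fun η : ℝ => e (η * z) := by
    ext η
    simp only [Pi.smul_apply, Finset.sum_apply, smul_eq_mul]
    rw [← sum_expAvg, hn, ← mul_assoc]
    congr 1
    · field_simp
    · rw [window, hw, parityIco, mul_assoc]
  rw [hG, pair_smul, pair_sum, bil, hxp]
  congr 1
  · push_cast; rfl
  refine sum_congr rfl fun z hz => ?_
  rw [pair_smul, mul_comm]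
  congr 1
  rw [pair, synth]
  have hc : (((x + z) / 2 : ℕ) : ℝ) = ((x : ℝ) + z) / 2 := by
    have := (mem_filter.1 hz).2
    rw [Nat.cast_div (by omega) (by norm_num)]; push_cast; ring
  congr 2; ext c
  rw [hc, mul_assoc, ← e_add]
  congr 2; ring

theorem norm_bil_sub_pair_le {J : ℕ} {f : ℕ → ℂ} (hf : ∀ z, ‖f z‖ ≤ 1) {p d j k k0 κ q x : ℕ}
    {lam : ℝ} (hd : d + k ≤ J) (hk : k0 ≤ k) (hq : 16 * q ≤ 2 ^ k) (hκ1 : 2 ^ k0 ≤ 16 * κ)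
    (hκ2 : 16 * κ + 16 ≤ 15 * 2 ^ k0) {L : Multiset (ℂ × ℝ)}
    (hL : Light (j * 2 ^ (J - d)) (2 ^ (J - d)) lam (synth L))
    (hx : x ∈ parityIco p (j * 2 ^ (J - d)) (2 ^ (J - d))) :
    ‖bil (2 ^ (J - d)) (window J k0 κ d j) (synth L) f x -
      pair L (clipAvg J f q k k0 κ p d j) x‖ ≤ lam * q * 2 ^ k := by
  have hlam : 0 ≤ lam := (norm_nonneg _).trans (hL 0)
  rw [bil_window_eq_pair hd hk (mem_parityIco.1 hx).2, ← pair_sub]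
  have hG : (1 / (2 ^ k : ℂ)) • ∑ c ∈ range (2 ^ (k - k0)),
        expAvg J f p (d + k) ((j * 2 ^ k0 + κ) * 2 ^ (k - k0) + c) - clipAvg J f q k k0 κ p d j =
      (1 / (2 ^ k : ℂ)) • ∑ c ∈ range (2 ^ (k - k0)), fun η =>
        expAvg J f p (d + k) ((j * 2 ^ k0 + κ) * 2 ^ (k - k0) + c) η -
        chi q (expAvg J f p (d + k) ((j * 2 ^ k0 + κ) * 2 ^ (k - k0) + c) η) := by
    ext η
    simp only [clipAvg, Pi.sub_apply, Pi.smul_apply, Finset.sum_apply, smul_eq_mul,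
      sum_sub_distrib]
    ring
  have hkk : 2 ^ k0 * 2 ^ (k - k0) = 2 ^ k := by rw [← pow_add]; congr 1; omega
  rw [hG, pair_smul, pair_sum, norm_mul]
  have h1 : ‖∑ c ∈ range (2 ^ (k - k0)), pair L (fun η =>
        expAvg J f p (d + k) ((j * 2 ^ k0 + κ) * 2 ^ (k - k0) + c) η -
        chi q (expAvg J f p (d + k) ((j * 2 ^ k0 + κ) * 2 ^ (k - k0) + c) η)) x‖ ≤
      2 ^ k * (lam * q * 2 ^ k) := by
    calc _ ≤ ∑ c ∈ range (2 ^ (k - k0)), lam * q * 2 ^ k := by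
          refine (norm_sum_le _ _).trans (sum_le_sum fun c hc => ?_)
          have hc' := mem_range.1 hc
          have hmul : (j * 2 ^ k0 + κ) * 2 ^ (k - k0) = j * 2 ^ k + κ * 2 ^ (k - k0) := by
            rw [← hkk]; ring
          have g1 := Nat.mul_le_mul_right (2 ^ (k - k0)) hκ1
          have g2 := Nat.mul_le_mul_right (2 ^ (k - k0)) hκ2
          rw [hkk] at g1
          rw [mul_assoc 15, hkk, add_mul] at g2
          refine norm_pair_sub_chi_le hf hd ?_ ?_ hL hx
          · rw [hmul]; nlinarith
          · rw [hmul, add_mul, one_mul]; nlinarith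
      _ = 2 ^ (k - k0) * (lam * q * 2 ^ k) := by simp
      _ ≤ _ := by gcongr <;> [norm_num; omega]
  simp only [norm_div, norm_one, norm_pow, RCLike.norm_ofNat]
  rw [one_div, inv_mul_le_iff₀ (by positivity)]
  exact h1

/-- Sum of `g` over a multiset. -/
noncomputable def msum {α : Type*} (L : Multiset α) (g : α → ℝ) : ℝ := (L.map g).sum

section msum
variable {α : Type*} {L L' : Multiset α} {g g' : α → ℝ}

lemma msum_add_left (L L' : Multiset α) (g : α → ℝ) : msum (L + L') g = msum L g + msum L' g := by
  simp [msum]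

lemma msum_add (L : Multiset α) (g g' : α → ℝ) :
    msum L (fun c => g c + g' c) = msum L g + msum L g' := by
  simp [msum, Multiset.sum_map_add]

lemma msum_mul_left (L : Multiset α) (r : ℝ) (g : α → ℝ) :
    msum L (fun c => r * g c) = r * msum L g := by
  simp [msum, Multiset.sum_map_mul_left]

lemma msum_nonneg (h : ∀ c ∈ L, 0 ≤ g c) : 0 ≤ msum L g :=
  Multiset.sum_nonneg fun x hx => by
    obtain ⟨c, hc, rfl⟩ := Multiset.mem_map.1 hx; exact h c hc

lemma msum_le_msum (h : ∀ c ∈ L, g c ≤ g' c) : msum L g ≤ msum L g' :=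
  Multiset.sum_map_le_sum_map _ _ h

lemma msum_mono (hL : L ≤ L') (h : ∀ c, 0 ≤ g c) : msum L g ≤ msum L' g := by
  obtain ⟨M, rfl⟩ := Multiset.le_iff_exists_add.1 hL
  rw [msum_add_left]
  linarith [msum_nonneg (L := M) (g := g) fun c _ => h c]

lemma msum_sum {ι : Type*} (s : Finset ι) (L : Multiset α) (G : ι → α → ℝ) :
    msum L (fun c => ∑ i ∈ s, G i c) = ∑ i ∈ s, msum L (G i) := by
  classical
  induction s using Finset.induction_on with
  | empty => simp [msum]
  | insert a s ha ih => simp_rw [sum_insert ha]; rw [msum_add, ih]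

lemma msum_const (L : Multiset α) (r : ℝ) : msum L (fun _ => r) = L.card * r := by
  simp [msum]

end msum

lemma energy_eq_msum (L : Multiset (ℂ × ℝ)) : energy L = msum L fun c => ‖c.1‖ ^ 2 := rfl

lemma energy_mono {L L' : Multiset (ℂ × ℝ)} (h : L ≤ L') : energy L ≤ energy L' :=
  msum_mono h fun _ => by positivity

lemma card_mul_le_energy {L : Multiset (ℂ × ℝ)} {ρ : ℝ} (hρ : 0 < ρ) (h : ∀ c ∈ L, ρ ≤ ‖c.1‖) :
    L.card * ρ ^ 2 ≤ energy L := by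
  rw [← msum_const]
  exact msum_le_msum fun c hc => pow_le_pow_left₀ hρ.le (h c hc) 2

/-- Average over the `2 ^ d` nodes of depth `d`. -/
noncomputable def av (d : ℕ) (F : ℕ → ℝ) : ℝ := (∑ j ∈ range (2 ^ d), F j) / 2 ^ d

section av
variable {d : ℕ} {F G : ℕ → ℝ}

lemma av_mono (h : ∀ j, F j ≤ G j) : av d F ≤ av d G := by
  unfold av; gcongr; exact h _

lemma av_nonneg (h : ∀ j, 0 ≤ F j) : 0 ≤ av d F :=
  div_nonneg (sum_nonneg fun j _ => h j) (by positivity)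

lemma av_add (F G : ℕ → ℝ) : av d (fun j => F j + G j) = av d F + av d G := by
  simp [av, sum_add_distrib, add_div]

lemma av_mul_left (r : ℝ) (F : ℕ → ℝ) : av d (fun j => r * F j) = r * av d F := by
  simp [av, ← mul_sum, mul_div_assoc]

lemma av_sub (F G : ℕ → ℝ) : av d (fun j => F j - G j) = av d F - av d G := by
  simp [av, sum_sub_distrib, sub_div]

lemma av_succ (F : ℕ → ℝ) :
    av (d + 1) F = av d (fun j => (F (2 * j) + F (2 * j + 1)) / 2) := by
  rw [av, av, sum_range_two_pow_succ, ← sum_div, pow_succ']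
  field_simp

lemma av_parent (F : ℕ → ℝ) : av (d + 1) (fun j => F (j / 2)) = av d F := by
  rw [av_succ]
  congr 1; ext j
  rw [show 2 * j / 2 = j by omega, show (2 * j + 1) / 2 = j by omega]; ring

lemma av_add_depth (k : ℕ) (F : ℕ → ℝ) :
    av (d + k) F = av d (fun j => (1 / 2 ^ k) * ∑ c ∈ range (2 ^ k), F (j * 2 ^ k + c)) := by
  have h := sum_Ico_mul 0 (2 ^ k) (2 ^ d) F
  rw [zero_add, ← range_eq_Ico] at h
  rw [av_mul_left, av, av, pow_add, h]
  have : ∀ c, ∑ z ∈ Ico (0 + c * 2 ^ k) (0 + c * 2 ^ k + 2 ^ k), F z =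
      ∑ i ∈ range (2 ^ k), F (c * 2 ^ k + i) := by
    intro c
    rw [sum_Ico_eq_sum_range]
    simp
  simp_rw [this]
  rw [pow_add]
  field_simp

end av

section freeze
variable (W : ℕ → ℕ → Multiset (ℂ × ℝ)) (X : ℕ → ℕ → ℝ → ℂ) (τ : ℝ)

/-- The node `P` differs substantially from the reference node `P₀`. -/
def Viol (P₀ P : ℕ × ℕ) : Prop :=
  τ ≤ msum (W P.1 P.2) (fun c => ‖c.1‖) - msum (W P₀.1 P₀.2) (fun c => ‖c.1‖) ∨
  τ ≤ msum (W P₀.1 P₀.2) (fun c => ‖c.1‖ * ‖X P.1 P.2 (c.2 / 2) - X P₀.1 P₀.2 (c.2 / 2)‖)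

open Classical in
/-- The reference node currently attached to the node `(d, j)`. -/
noncomputable def fz : ℕ → ℕ → ℕ × ℕ
  | 0, j => (0, j)
  | d + 1, j => if Viol W X τ (fz d (j / 2)) (d + 1, j) then (d + 1, j) else fz d (j / 2)

/-- The node `(d, j)` is its own reference node because of a substantial change. -/
def Halts : ℕ → ℕ → Prop
  | 0, _ => True
  | d + 1, j => Viol W X τ (fz W X τ d (j / 2)) (d + 1, j)

open Classical in
/-- Indicator of `Halts`. -/
noncomputable def haltInd (d j : ℕ) : ℝ := if Halts W X τ d j then 1 else 0

variable {W X τ}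

lemma fz_of_halts {d j : ℕ} (h : Halts W X τ d j) : fz W X τ d j = (d, j) := by
  cases d with
  | zero => rfl
  | succ d => rw [fz]; exact if_pos h

lemma fz_of_not_halts {d j : ℕ} (h : ¬ Halts W X τ (d + 1) j) :
    fz W X τ (d + 1) j = fz W X τ d (j / 2) := by
  rw [fz]; exact if_neg h

lemma haltInd_nonneg (d j : ℕ) : 0 ≤ haltInd W X τ d j := by
  unfold haltInd; split_ifs <;> norm_num

lemma haltInd_le_one (d j : ℕ) : haltInd W X τ d j ≤ 1 := by
  unfold haltInd; split_ifs <;> norm_num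

lemma W_fz_le (hW : ∀ d j, W d (j / 2) ≤ W (d + 1) j) (d j : ℕ) :
    W (fz W X τ d j).1 (fz W X τ d j).2 ≤ W d j := by
  induction d generalizing j with
  | zero => rfl
  | succ d ih =>
    by_cases h : Halts W X τ (d + 1) j
    · rw [fz_of_halts h]
    · rw [fz_of_not_halts h]; exact (ih _).trans (hW d j)

lemma fz_fst_le (d j : ℕ) : (fz W X τ d j).1 ≤ d := by
  induction d generalizing j with
  | zero => rfl
  | succ d ih =>
    by_cases h : Halts W X τ (d + 1) j
    · rw [fz_of_halts h]
    · rw [fz_of_not_halts h]; exact (ih _).trans (Nat.le_succ d)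

lemma not_viol_fz (hτ : 0 < τ) (d j : ℕ) : ¬ Viol W X τ (fz W X τ d j) (d, j) := by
  have self : ∀ P : ℕ × ℕ, ¬ Viol W X τ P P := by
    rintro P (h | h)
    · linarith
    · simp [msum] at h; linarith
  cases d with
  | zero => exact self _
  | succ d =>
    by_cases h : Halts W X τ (d + 1) j
    · rw [fz_of_halts h]; exact self _
    · rw [fz_of_not_halts h]; exact h

lemma av_fz_succ (δ : ℕ × ℕ → ℝ) (d : ℕ) :
    av (d + 1) (fun j => haltInd W X τ (d + 1) j * (δ (d + 1, j) - δ (fz W X τ d (j / 2)))) =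
      av (d + 1) (fun j => δ (fz W X τ (d + 1) j)) - av d (fun j => δ (fz W X τ d j)) := by
  rw [← av_parent (fun j => δ (fz W X τ d j)), ← av_sub]
  congr 1; ext j
  by_cases h : Halts W X τ (d + 1) j
  · rw [fz_of_halts h, haltInd, if_pos h, one_mul]
  · rw [fz_of_not_halts h, haltInd, if_neg h]; simp

lemma sum_av_fz (δ : ℕ × ℕ → ℝ) (D : ℕ) :
    ∑ d ∈ range D, av (d + 1) (fun j => haltInd W X τ (d + 1) j *
      (δ (d + 1, j) - δ (fz W X τ d (j / 2)))) =
      av D (fun j => δ (fz W X τ D j)) - av 0 (fun j => δ (0, j)) := by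
  simp_rw [av_fz_succ]
  rw [sum_range_sub (fun d => av d (fun j => δ (fz W X τ d j)))]
  rfl

lemma one_le_of_viol {ρ Λ : ℝ} (hρ : 0 < ρ) (hτ : 0 < τ) (hΛ : 0 < Λ) {P₀ P : ℕ × ℕ}
    (hP : W P₀.1 P₀.2 ≤ W P.1 P.2) (hamp : ∀ c ∈ W P.1 P.2, ρ ≤ ‖c.1‖)
    (hE : energy (W P.1 P.2) ≤ Λ) (hv : Viol W X τ P₀ P) :
    1 ≤ 1 / (ρ * τ) * (energy (W P.1 P.2) - energy (W P₀.1 P₀.2)) + Λ / τ ^ 2 *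
      msum (W P₀.1 P₀.2) (fun c => ‖X P.1 P.2 (c.2 / 2) - X P₀.1 P₀.2 (c.2 / 2)‖ ^ 2) := by
  obtain ⟨M, hM⟩ := Multiset.le_iff_exists_add.1 hP
  have hS : 0 ≤ msum (W P₀.1 P₀.2)
      (fun c => ‖X P.1 P.2 (c.2 / 2) - X P₀.1 P₀.2 (c.2 / 2)‖ ^ 2) :=
    msum_nonneg fun _ _ => by positivity
  have hEM : energy (W P.1 P.2) - energy (W P₀.1 P₀.2) = energy M := by
    rw [hM, energy_add]; ring
  rcases hv with h | h
  · have h1 : ρ * τ ≤ energy M := by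
      rw [hM, msum_add_left, add_sub_cancel_left] at h
      calc ρ * τ ≤ ρ * msum M (fun c => ‖c.1‖) := by gcongr
        _ = msum M (fun c => ρ * ‖c.1‖) := (msum_mul_left _ _ _).symm
        _ ≤ energy M := msum_le_msum fun c hc => by
          have := hamp c (by rw [hM]; exact Multiset.mem_add.2 (Or.inr hc))
          rw [sq]; gcongr
    have h2 : 1 ≤ 1 / (ρ * τ) * energy M := by
      rw [one_div, ← div_eq_inv_mul, le_div_iff₀ (by positivity)]; linarith
    rw [hEM]
    have : 0 ≤ Λ / τ ^ 2 * msum (W P₀.1 P₀.2)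
      (fun c => ‖X P.1 P.2 (c.2 / 2) - X P₀.1 P₀.2 (c.2 / 2)‖ ^ 2) := by positivity
    linarith
  · set S := msum (W P₀.1 P₀.2)
      (fun c => ‖X P.1 P.2 (c.2 / 2) - X P₀.1 P₀.2 (c.2 / 2)‖ ^ 2) with hSdef
    have h1 : τ ≤ τ / (2 * Λ) * energy (W P₀.1 P₀.2) + Λ / (2 * τ) * S := by
      refine h.trans ?_
      rw [energy_eq_msum, hSdef, ← msum_mul_left, ← msum_mul_left, ← msum_add]
      refine msum_le_msum fun c _ => ?_
      set y := ‖X P.1 P.2 (c.2 / 2) - X P₀.1 P₀.2 (c.2 / 2)‖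
      have h3 : τ / (2 * Λ) * ‖c.1‖ ^ 2 + Λ / (2 * τ) * y ^ 2 - ‖c.1‖ * y =
          (τ * ‖c.1‖ - Λ * y) ^ 2 / (2 * Λ * τ) := by field_simp; ring
      have h4 : 0 ≤ (τ * ‖c.1‖ - Λ * y) ^ 2 / (2 * Λ * τ) := by positivity
      linarith
    have h2 : τ / (2 * Λ) * energy (W P₀.1 P₀.2) ≤ τ / 2 := by
      calc _ ≤ τ / (2 * Λ) * Λ := by gcongr; exact (energy_mono hP).trans hE
        _ = τ / 2 := by field_simp
    have h3 : 1 ≤ Λ / τ ^ 2 * S := by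
      have h4 : τ / 2 ≤ Λ / (2 * τ) * S := by linarith
      have h5 : Λ / τ ^ 2 * S = (Λ / (2 * τ) * S) * (2 / τ) := by field_simp
      rw [h5]
      calc (1 : ℝ) = τ / 2 * (2 / τ) := by field_simp
        _ ≤ _ := by gcongr
    have h6 : 0 ≤ 1 / (ρ * τ) * energy M := mul_nonneg (by positivity) (energy_nonneg _)
    rw [hEM]; linarith

end freeze

/-- The Bregman divergence of `phi`. -/
noncomputable def breg (q : ℕ) (a b : ℂ) : ℝ := phi q a - phi q b - rdot (chi q b) (a - b)

lemma breg_nonneg {q : ℕ} {a b : ℂ} (ha : ‖a‖ ≤ 1) (hb : ‖b‖ ≤ 1) : 0 ≤ breg q a b := by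
  have := norm_chi_sub_chi_sq_le (q := q) ha hb
  have h2 := sq_nonneg ‖chi q a - chi q b‖
  unfold breg; linarith

/-- The tangent of `phi` at `b`, evaluated at `a` and shifted to be nonnegative. -/
noncomputable def tang (q : ℕ) (a b : ℂ) : ℝ :=
  phi q b + rdot (chi q b) (a - b) + 2 * clipFun q 1

lemma tang_nonneg {q : ℕ} {a b : ℂ} (ha : ‖a‖ ≤ 1) (hb : ‖b‖ ≤ 1) : 0 ≤ tang q a b := by
  have h1 := phi_nonneg (q := q) hb
  have h2 := abs_le.1 (abs_rdot_le (chi q b) (a - b))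
  have h3 : ‖chi q b‖ * ‖a - b‖ ≤ clipFun q 1 * 2 := by
    have h4 : ‖a - b‖ ≤ 2 := (norm_sub_le _ _).trans (by linarith)
    have := norm_chi_le (q := q) hb
    have h5 := (norm_nonneg (chi q b)).trans this
    gcongr
  unfold tang; linarith

lemma tang_le {q : ℕ} {a b : ℂ} (ha : ‖a‖ ≤ 1) (hb : ‖b‖ ≤ 1) :
    tang q a b ≤ 3 * clipFun q 1 := by
  have h1 := phi_add_rdot_le (q := q) hb ha
  have h2 := phi_le (q := q) ha
  unfold tang; linarith

lemma tang_self (q : ℕ) (a b : ℂ) : tang q a a = tang q a b + breg q a b := by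
  simp [tang, breg, rdot]; ring

lemma tang_midpoint (q : ℕ) (a a' b : ℂ) :
    tang q ((a + a') / 2) b = (tang q a b + tang q a' b) / 2 := by
  have : (a + a') / 2 - b = ((1 / 2 : ℝ) : ℂ) * ((a - b) + (a' - b)) := by push_cast; ring
  have h2 : rdot (chi q b) ((a + a') / 2 - b) =
      (rdot (chi q b) (a - b) + rdot (chi q b) (a' - b)) / 2 := by
    rw [this, rdot, mul_left_comm, Complex.re_ofReal_mul, ← rdot, rdot_add_right]; ring
  unfold tang; rw [h2]; ring

/-- Mean square oscillation of the clipped `a` over the descendants `k` levels below. -/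
noncomputable def dev (q k : ℕ) (a : ℕ → ℕ → ℝ → ℂ) (d j : ℕ) (η : ℝ) : ℝ :=
  (1 / 2 ^ k) * ∑ c ∈ range (2 ^ k), ‖chi q (a (d + k) (j * 2 ^ k + c) η) - chi q (a d j η)‖ ^ 2

/-- A monotone tree of frequencies `W`, a bounded martingale `a` and symbols `X` close to a
multiple of the clipped martingale. -/
structure TreeData (J k q : ℕ) (ρ : ℝ) (W : ℕ → ℕ → Multiset (ℂ × ℝ))
    (a X : ℕ → ℕ → ℝ → ℂ) : Prop where
  rho_pos : 0 < ρ
  W_mono : ∀ d j, W d (j / 2) ≤ W (d + 1) j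
  amp : ∀ d j, ∀ c ∈ W d j, ρ ≤ ‖c.1‖
  energy_le : ∀ d ≤ J, av d (fun j => energy (W d j)) ≤ 2
  norm_le : ∀ d j η, ‖a d j η‖ ≤ 1
  mart : ∀ d i j η, d + i ≤ J →
    a d j η = (1 / (2 ^ i : ℂ)) * ∑ c ∈ range (2 ^ i), a (d + i) (j * 2 ^ i + c) η
  symbol : ∃ s : ℂ, ‖s‖ ≤ 1 ∧ ∀ d j η, d + k ≤ J →
    ‖X d j η - s * chi q (a d j η)‖ ^ 2 ≤ dev q k a d j η

lemma dev_nonneg (q k : ℕ) (a : ℕ → ℕ → ℝ → ℂ) (d j : ℕ) (η : ℝ) : 0 ≤ dev q k a d j η := by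
  unfold dev; positivity

namespace TreeData
variable {J k q : ℕ} {ρ : ℝ} {W : ℕ → ℕ → Multiset (ℂ × ℝ)} {a X : ℕ → ℕ → ℝ → ℂ}
  (H : TreeData J k q ρ W a X)
include H

lemma W_mono_depth (d i j : ℕ) : W d (j / 2 ^ i) ≤ W (d + i) j := by
  induction i generalizing j with
  | zero => simp
  | succ i ih =>
    have h1 := ih (j / 2)
    rw [Nat.div_div_eq_div_mul, ← pow_succ'] at h1
    exact h1.trans (H.W_mono _ _)

lemma dev_le {d : ℕ} (hd : d + k ≤ J) (j : ℕ) (η : ℝ) : dev q k a d j η ≤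
    2 * ((1 / 2 ^ k) * ∑ c ∈ range (2 ^ k), phi q (a (d + k) (j * 2 ^ k + c) η) -
      phi q (a d j η)) := by
  set A : ℕ → ℂ := fun c => a (d + k) (j * 2 ^ k + c) η with hA
  set b := a d j η with hb
  have h0 : ∑ c ∈ range (2 ^ k), (A c - b) = 0 := by
    rw [sum_sub_distrib, hb, H.mart d k j η hd]; simp [hA]
  have h1 : ∑ c ∈ range (2 ^ k), rdot (chi q b) (A c - b) = 0 := by
    simp only [rdot]
    rw [← Complex.re_sum, ← mul_sum, h0]; simp
  have h2 : ∑ c ∈ range (2 ^ k), ‖chi q (A c) - chi q b‖ ^ 2 ≤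
      ∑ c ∈ range (2 ^ k), (2 * (phi q (A c) - phi q b) - 2 * rdot (chi q b) (A c - b)) :=
    sum_le_sum fun c _ => by
      have := norm_chi_sub_chi_sq_le (q := q) (H.norm_le (d + k) (j * 2 ^ k + c) η)
        (H.norm_le d j η)
      linarith
  rw [sum_sub_distrib, ← mul_sum, ← mul_sum, h1, sum_sub_distrib] at h2
  simp only [sum_const, card_range, nsmul_eq_mul, Nat.cast_pow, Nat.cast_ofNat] at h2
  unfold dev
  calc _ ≤ (1 / 2 ^ k) * (2 * (∑ c ∈ range (2 ^ k), phi q (A c) - 2 ^ k * phi q b) - 2 * 0) := by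
        gcongr
    _ = _ := by field_simp; ring

lemma av_card_le {d : ℕ} (hd : d ≤ J) : av d (fun j => ((W d j).card : ℝ)) ≤ 2 / ρ ^ 2 := by
  have hρ := H.rho_pos
  rw [le_div_iff₀ (by positivity), mul_comm, ← av_mul_left]
  refine le_trans (av_mono fun j => ?_) (H.energy_le d hd)
  rw [mul_comm]; exact card_mul_le_energy hρ (H.amp d j)

lemma av_msum_le {d : ℕ} (hd : d ≤ J) {g : ℕ → ℂ × ℝ → ℝ} {B : ℝ} (hB : 0 ≤ B)
    (hg : ∀ j c, g j c ≤ B) : av d (fun j => msum (W d j) (g j)) ≤ B * (2 / ρ ^ 2) := by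
  refine le_trans ?_ (mul_le_mul_of_nonneg_left (H.av_card_le hd) hB)
  rw [← av_mul_left]
  refine av_mono fun j => ?_
  rw [mul_comm, ← msum_const]
  exact msum_le_msum fun c _ => hg j c

lemma sum_av_dev_le {D : ℕ} (hD : D + k ≤ J) :
    ∑ d ∈ range (D + 1), av d (fun j => msum (W d j) (fun c => dev q k a d j (c.2 / 2))) ≤
      4 * k * clipFun q 1 / ρ ^ 2 := by
  have hρ := H.rho_pos
  have hr : 0 ≤ clipFun q 1 := clipFun_nonneg zero_le_one le_rfl
  set V : ℕ → ℝ := fun d => av d (fun j => msum (W d j) (fun c => phi q (a d j (c.2 / 2)))) with hV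
  have hV0 : ∀ d, 0 ≤ V d := fun d =>
    av_nonneg fun j => msum_nonneg fun c _ => phi_nonneg (H.norm_le _ _ _)
  have hV1 : ∀ d ≤ J, V d ≤ clipFun q 1 * (2 / ρ ^ 2) := fun d hd =>
    H.av_msum_le hd hr fun j c => phi_le (H.norm_le _ _ _)
  have step : ∀ d ∈ range (D + 1), av d (fun j => msum (W d j) (fun c => dev q k a d j (c.2 / 2)))
      ≤ 2 * (V (d + k) - V d) := by
    intro d hd
    have hdk : d + k ≤ J := by have := mem_range.1 hd; omega
    rw [hV]
    simp only
    rw [av_add_depth, ← av_sub, ← av_mul_left]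
    refine av_mono fun j => ?_
    have h1 : msum (W d j) (fun c => dev q k a d j (c.2 / 2)) ≤ msum (W d j) (fun c =>
        2 * ((1 / 2 ^ k) * ∑ i ∈ range (2 ^ k), phi q (a (d + k) (j * 2 ^ k + i) (c.2 / 2)) +
          (-1) * phi q (a d j (c.2 / 2)))) := msum_le_msum fun c _ => by
      have := H.dev_le hdk j (c.2 / 2); linarith
    refine h1.trans ?_
    rw [msum_mul_left, msum_add, msum_mul_left, msum_mul_left, msum_sum]
    have h2 : ∀ i ∈ range (2 ^ k),
        msum (W d j) (fun c => phi q (a (d + k) (j * 2 ^ k + i) (c.2 / 2))) ≤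
        msum (W (d + k) (j * 2 ^ k + i))
          (fun c => phi q (a (d + k) (j * 2 ^ k + i) (c.2 / 2))) := by
      intro i hi
      refine msum_mono ?_ fun c => phi_nonneg (H.norm_le _ _ _)
      have := H.W_mono_depth d k (j * 2 ^ k + i)
      rwa [show (j * 2 ^ k + i) / 2 ^ k = j by
        rw [mul_comm, Nat.mul_add_div (by positivity), Nat.div_eq_of_lt (mem_range.1 hi), add_zero]]
        at this
    have h3 := mul_le_mul_of_nonneg_left (sum_le_sum h2) (show (0 : ℝ) ≤ 1 / 2 ^ k by positivity)
    linarith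
  refine (sum_le_sum step).trans ?_
  rw [← mul_sum, sum_sub_distrib]
  have h1 := sum_range_add V (D + 1) k
  have h2 := sum_range_add V k (D + 1)
  rw [add_comm k (D + 1), h1] at h2
  have h3 : ∑ x ∈ range k, V (D + 1 + x) ≤ k * (clipFun q 1 * (2 / ρ ^ 2)) := by
    calc _ ≤ ∑ x ∈ range k, clipFun q 1 * (2 / ρ ^ 2) :=
          sum_le_sum fun x hx => hV1 _ (by have := mem_range.1 hx; omega)
      _ = _ := by simp
  have h4 : 0 ≤ ∑ x ∈ range k, V x := sum_nonneg fun x _ => hV0 x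
  simp_rw [add_comm k] at h2
  calc _ ≤ 2 * (k * (clipFun q 1 * (2 / ρ ^ 2))) := by linarith
    _ = _ := by ring

variable {τ : ℝ}

lemma sum_av_breg_le {D : ℕ} (hD : D ≤ J) :
    ∑ d ∈ range D, av (d + 1) (fun j => haltInd W X τ (d + 1) j *
      msum (W d (j / 2)) (fun c => breg q (a (d + 1) j (c.2 / 2))
        (a (fz W X τ d (j / 2)).1 (fz W X τ d (j / 2)).2 (c.2 / 2)))) ≤
      6 * clipFun q 1 / ρ ^ 2 := by
  have hr : 0 ≤ clipFun q 1 := clipFun_nonneg zero_le_one le_rfl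
  set b : ℕ → ℕ → ℂ × ℝ → ℂ := fun d j c =>
    a (fz W X τ d j).1 (fz W X τ d j).2 (c.2 / 2) with hb
  set U : ℕ → ℝ := fun d =>
    av d (fun j => msum (W d j) (fun c => tang q (a d j (c.2 / 2)) (b d j c)))
    with hU
  have hU0 : ∀ d, 0 ≤ U d := fun d =>
    av_nonneg fun j => msum_nonneg fun c _ => tang_nonneg (H.norm_le _ _ _) (H.norm_le _ _ _)
  have hU1 : U D ≤ 3 * clipFun q 1 * (2 / ρ ^ 2) :=
    H.av_msum_le hD (by positivity) fun j c => tang_le (H.norm_le _ _ _) (H.norm_le _ _ _)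
  have step : ∀ d ∈ range D, av (d + 1) (fun j => haltInd W X τ (d + 1) j *
      msum (W d (j / 2)) (fun c => breg q (a (d + 1) j (c.2 / 2)) (b d (j / 2) c))) ≤
      U (d + 1) - U d := by
    intro d hd
    have hd' := mem_range.1 hd
    have e1 : U d = av (d + 1) (fun j => msum (W d (j / 2))
        (fun c => tang q (a (d + 1) j (c.2 / 2)) (b d (j / 2) c))) := by
      rw [av_succ]
      simp only [hU]
      congr 1; ext j
      rw [show 2 * j / 2 = j by omega, show (2 * j + 1) / 2 = j by omega, ← msum_add,
        div_eq_inv_mul, ← msum_mul_left]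
      congr 1; ext c
      have hm := H.mart d 1 j (c.2 / 2) (by omega)
      have h2 : a d j (c.2 / 2) = (a (d + 1) (2 * j) (c.2 / 2) +
          a (d + 1) (2 * j + 1) (c.2 / 2)) / 2 := by
        rw [hm]; simp [sum_range_succ, mul_comm j 2]; ring
      rw [h2, tang_midpoint]; ring
    have e2 : av (d + 1) (fun j => haltInd W X τ (d + 1) j *
        msum (W d (j / 2)) (fun c => breg q (a (d + 1) j (c.2 / 2)) (b d (j / 2) c)) +
        msum (W d (j / 2)) (fun c => tang q (a (d + 1) j (c.2 / 2)) (b d (j / 2) c))) ≤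
        U (d + 1) := by
      simp only [hU]
      refine av_mono fun j => ?_
      have h3 : msum (W d (j / 2)) (fun c => tang q (a (d + 1) j (c.2 / 2)) (b (d + 1) j c)) ≤
          msum (W (d + 1) j) (fun c => tang q (a (d + 1) j (c.2 / 2)) (b (d + 1) j c)) :=
        msum_mono (H.W_mono d j) fun c => tang_nonneg (H.norm_le _ _ _) (H.norm_le _ _ _)
      refine le_trans (le_of_eq ?_) h3
      by_cases hs : Halts W X τ (d + 1) j
      · rw [haltInd, if_pos hs, one_mul, ← msum_add]
        congr 1; ext c
        have hbb : b (d + 1) j c = a (d + 1) j (c.2 / 2) := by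
          simp only [hb]; rw [fz_of_halts hs]
        rw [hbb, tang_self q _ (b d (j / 2) c), add_comm]
      · rw [haltInd, if_neg hs, zero_mul, zero_add]
        congr 1; ext c
        have hbb : b (d + 1) j c = b d (j / 2) c := by
          simp only [hb]; rw [fz_of_not_halts hs]
        rw [hbb]
    rw [av_add, ← e1] at e2
    linarith
  refine (sum_le_sum step).trans ?_
  rw [sum_range_sub U]
  have := hU0 0
  calc _ ≤ 3 * clipFun q 1 * (2 / ρ ^ 2) := by linarith
    _ = _ := by ring

/-- The total change of the symbols at the stopping nodes. -/
lemma sum_av_symbol_le {D : ℕ} (hD : D + k ≤ J) :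
    ∑ d ∈ range D, av (d + 1) (fun j => haltInd W X τ (d + 1) j *
      msum (W (fz W X τ d (j / 2)).1 (fz W X τ d (j / 2)).2) (fun c =>
        ‖X (d + 1) j (c.2 / 2) -
          X (fz W X τ d (j / 2)).1 (fz W X τ d (j / 2)).2 (c.2 / 2)‖ ^ 2)) ≤
      (24 * k + 36) * clipFun q 1 / ρ ^ 2 := by
  obtain ⟨s, hs, hsX⟩ := H.symbol
  set δ : ℕ × ℕ → ℝ := fun P => msum (W P.1 P.2) (fun c => dev q k a P.1 P.2 (c.2 / 2)) with hδ
  have hδ0 : ∀ P, 0 ≤ δ P := fun P => msum_nonneg fun c _ => dev_nonneg _ _ _ _ _ _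
  set B : ℕ → ℕ → ℝ := fun d j => msum (W d (j / 2)) (fun c => breg q (a (d + 1) j (c.2 / 2))
        (a (fz W X τ d (j / 2)).1 (fz W X τ d (j / 2)).2 (c.2 / 2))) with hB
  have point : ∀ d < D, ∀ j, haltInd W X τ (d + 1) j *
      msum (W (fz W X τ d (j / 2)).1 (fz W X τ d (j / 2)).2) (fun c =>
        ‖X (d + 1) j (c.2 / 2) -
          X (fz W X τ d (j / 2)).1 (fz W X τ d (j / 2)).2 (c.2 / 2)‖ ^ 2) ≤
      6 * δ (d + 1, j) + (-3 * (haltInd W X τ (d + 1) j *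
        (δ (d + 1, j) - δ (fz W X τ d (j / 2)))) + 6 * (haltInd W X τ (d + 1) j * B d j)) := by
    intro d hd j
    have hi0 := haltInd_nonneg (W := W) (X := X) (τ := τ) (d + 1) j
    have hi1 := haltInd_le_one (W := W) (X := X) (τ := τ) (d + 1) j
    set P₀ := fz W X τ d (j / 2) with hP₀
    have hP₀d : P₀.1 ≤ d := fz_fst_le _ _
    have hsub : W P₀.1 P₀.2 ≤ W d (j / 2) := W_fz_le H.W_mono _ _
    have hsub' : W P₀.1 P₀.2 ≤ W (d + 1) j := hsub.trans (H.W_mono d j)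
    have h1 : msum (W P₀.1 P₀.2) (fun c =>
        ‖X (d + 1) j (c.2 / 2) - X P₀.1 P₀.2 (c.2 / 2)‖ ^ 2) ≤
        3 * δ (d + 1, j) + 3 * δ P₀ + 6 * B d j := by
      have g1 : msum (W P₀.1 P₀.2) (fun c => dev q k a (d + 1) j (c.2 / 2)) ≤ δ (d + 1, j) :=
        msum_mono hsub' fun c => dev_nonneg _ _ _ _ _ _
      have g2 : msum (W P₀.1 P₀.2) (fun c => breg q (a (d + 1) j (c.2 / 2))
          (a P₀.1 P₀.2 (c.2 / 2))) ≤ B d j :=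
        msum_mono hsub fun c => breg_nonneg (H.norm_le _ _ _) (H.norm_le _ _ _)
      have g3 : msum (W P₀.1 P₀.2) (fun c =>
          ‖X (d + 1) j (c.2 / 2) - X P₀.1 P₀.2 (c.2 / 2)‖ ^ 2) ≤ msum (W P₀.1 P₀.2) (fun c =>
          (3 * dev q k a (d + 1) j (c.2 / 2) + 3 * dev q k a P₀.1 P₀.2 (c.2 / 2)) +
          6 * breg q (a (d + 1) j (c.2 / 2)) (a P₀.1 P₀.2 (c.2 / 2))) := by
        refine msum_le_msum fun c _ => ?_
        set η := c.2 / 2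
        have k1 := hsX (d + 1) j η (by omega)
        have k2 := hsX P₀.1 P₀.2 η (by omega)
        have k3 := norm_chi_sub_chi_sq_le (q := q) (H.norm_le (d + 1) j η) (H.norm_le P₀.1 P₀.2 η)
        have k4 : ‖X (d + 1) j η - X P₀.1 P₀.2 η‖ ≤
            ‖X (d + 1) j η - s * chi q (a (d + 1) j η)‖ +
            ‖X P₀.1 P₀.2 η - s * chi q (a P₀.1 P₀.2 η)‖ +
            ‖chi q (a (d + 1) j η) - chi q (a P₀.1 P₀.2 η)‖ := by
          have e1 : X (d + 1) j η - X P₀.1 P₀.2 η =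
              (X (d + 1) j η - s * chi q (a (d + 1) j η)) -
              (X P₀.1 P₀.2 η - s * chi q (a P₀.1 P₀.2 η)) +
              s * (chi q (a (d + 1) j η) - chi q (a P₀.1 P₀.2 η)) := by ring
          rw [e1]
          refine (norm_add_le _ _).trans (add_le_add (norm_sub_le _ _) ?_)
          rw [norm_mul]
          exact mul_le_of_le_one_left (norm_nonneg _) hs
        have k5 := pow_le_pow_left₀ (norm_nonneg _) k4 2
        unfold breg
        nlinarith [sq_nonneg (‖X (d + 1) j η - s * chi q (a (d + 1) j η)‖ -
            ‖X P₀.1 P₀.2 η - s * chi q (a P₀.1 P₀.2 η)‖),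
          sq_nonneg (‖X P₀.1 P₀.2 η - s * chi q (a P₀.1 P₀.2 η)‖ -
            ‖chi q (a (d + 1) j η) - chi q (a P₀.1 P₀.2 η)‖),
          sq_nonneg (‖X (d + 1) j η - s * chi q (a (d + 1) j η)‖ -
            ‖chi q (a (d + 1) j η) - chi q (a P₀.1 P₀.2 η)‖)]
      rw [msum_add, msum_add, msum_mul_left, msum_mul_left, msum_mul_left] at g3
      have g4 : msum (W P₀.1 P₀.2) (fun c => dev q k a P₀.1 P₀.2 (c.2 / 2)) = δ P₀ := rfl
      linarith
    have h2 := mul_le_mul_of_nonneg_left h1 hi0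
    have h3 : haltInd W X τ (d + 1) j * δ (d + 1, j) ≤ δ (d + 1, j) :=
      mul_le_of_le_one_left (hδ0 _) hi1
    nlinarith
  have h1 : ∑ d ∈ range D, av (d + 1) (fun j => haltInd W X τ (d + 1) j *
      msum (W (fz W X τ d (j / 2)).1 (fz W X τ d (j / 2)).2) (fun c =>
        ‖X (d + 1) j (c.2 / 2) -
          X (fz W X τ d (j / 2)).1 (fz W X τ d (j / 2)).2 (c.2 / 2)‖ ^ 2)) ≤
      6 * ∑ d ∈ range D, av (d + 1) (fun j => δ (d + 1, j)) +
      (-3 * ∑ d ∈ range D, av (d + 1) (fun j => haltInd W X τ (d + 1) j *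
        (δ (d + 1, j) - δ (fz W X τ d (j / 2)))) +
      6 * ∑ d ∈ range D, av (d + 1) (fun j => haltInd W X τ (d + 1) j * B d j)) := by
    simp_rw [mul_sum, ← sum_add_distrib, ← av_mul_left, ← av_add]
    exact sum_le_sum fun d hd => av_mono fun j => point d (mem_range.1 hd) j
  have h2 := sum_av_fz (W := W) (X := X) (τ := τ) δ D
  have h3 : 0 ≤ av D (fun j => δ (fz W X τ D j)) := av_nonneg fun j => hδ0 _
  have h4 := H.sum_av_dev_le hD
  rw [sum_range_succ'] at h4
  have h5 := H.sum_av_breg_le (τ := τ) (show D ≤ J by omega)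
  have h6 : 0 ≤ av 0 (fun j => δ (0, j)) := av_nonneg fun j => hδ0 _
  change ∑ d ∈ range D, av (d + 1) (fun j => δ (d + 1, j)) + av 0 (fun j => δ (0, j)) ≤ _ at h4
  change ∑ d ∈ range D, av (d + 1) (fun j => haltInd W X τ (d + 1) j * B d j) ≤ _ at h5
  calc _ ≤ 6 * (4 * k * clipFun q 1 / ρ ^ 2) + 6 * (6 * clipFun q 1 / ρ ^ 2) := by linarith
    _ = _ := by ring

open Classical in
/-- The weighted number of tame stopping nodes is controlled. -/
theorem sum_av_halts_le (hτ : 0 < τ) {Λ : ℝ} (hΛ : 0 < Λ) {D : ℕ} (hD : D + k ≤ J) :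
    ∑ d ∈ range (D + 1), av d (fun j =>
      if Halts W X τ d j ∧ energy (W d j) ≤ Λ then 1 else 0) ≤
      1 + 2 / (ρ * τ) + Λ / τ ^ 2 * ((24 * k + 36) * clipFun q 1 / ρ ^ 2) := by
  have hρ := H.rho_pos
  rw [sum_range_succ']
  have h0 : av 0 (fun j => if Halts W X τ 0 j ∧ energy (W 0 j) ≤ Λ then 1 else 0) ≤ 1 := by
    rw [av]; simp only [pow_zero, range_one, sum_singleton, div_one]; split_ifs <;> norm_num
  set en : ℕ × ℕ → ℝ := fun P => energy (W P.1 P.2) with hen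
  have h1 := sum_av_fz (W := W) (X := X) (τ := τ) en D
  have h2 : av D (fun j => en (fz W X τ D j)) ≤ 2 :=
    (av_mono fun j => energy_mono (W_fz_le H.W_mono D j)).trans (H.energy_le D (by omega))
  have h3 : 0 ≤ av 0 (fun j => en (0, j)) := av_nonneg fun j => energy_nonneg _
  have h4 := H.sum_av_symbol_le (τ := τ) hD
  have h5 : ∑ d ∈ range D, av (d + 1) (fun j =>
      if Halts W X τ (d + 1) j ∧ energy (W (d + 1) j) ≤ Λ then 1 else 0) ≤
      1 / (ρ * τ) * ∑ d ∈ range D, av (d + 1) (fun j => haltInd W X τ (d + 1) j *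
        (en (d + 1, j) - en (fz W X τ d (j / 2)))) +
      Λ / τ ^ 2 * ∑ d ∈ range D, av (d + 1) (fun j => haltInd W X τ (d + 1) j *
      msum (W (fz W X τ d (j / 2)).1 (fz W X τ d (j / 2)).2) (fun c =>
        ‖X (d + 1) j (c.2 / 2) -
          X (fz W X τ d (j / 2)).1 (fz W X τ d (j / 2)).2 (c.2 / 2)‖ ^ 2)) := by
    simp_rw [mul_sum, ← sum_add_distrib, ← av_mul_left, ← av_add]
    refine sum_le_sum fun d _ => av_mono fun j => ?_
    have hsub : W (fz W X τ d (j / 2)).1 (fz W X τ d (j / 2)).2 ≤ W (d + 1) j :=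
      (W_fz_le H.W_mono _ _).trans (H.W_mono d j)
    by_cases hs : Halts W X τ (d + 1) j
    · rw [haltInd, if_pos hs, one_mul, one_mul]
      split_ifs with hE
      · exact one_le_of_viol (P₀ := fz W X τ d (j / 2)) (P := (d + 1, j)) hρ hτ hΛ hsub
          (H.amp _ _) hE.2 hs
      · have g1 : en (fz W X τ d (j / 2)) ≤ en (d + 1, j) := energy_mono hsub
        refine add_nonneg (mul_nonneg (by positivity) (by linarith))
          (mul_nonneg (by positivity) (msum_nonneg fun c _ => by positivity))
    · rw [if_neg fun h => hs h.1, haltInd, if_neg hs]; simp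
  have h6 : 1 / (ρ * τ) * ∑ d ∈ range D, av (d + 1) (fun j => haltInd W X τ (d + 1) j *
        (en (d + 1, j) - en (fz W X τ d (j / 2)))) ≤ 1 / (ρ * τ) * 2 := by
    gcongr; linarith
  have h7 := mul_le_mul_of_nonneg_left h4 (show 0 ≤ Λ / τ ^ 2 by positivity)
  have h8 : 2 / (ρ * τ) = 1 / (ρ * τ) * 2 := by ring
  rw [h8]
  linarith

end TreeData

open Classical in
/-- Number of `x < 2 ^ J` with `P x`, as a real number. -/
noncomputable def cnt (J : ℕ) (P : ℕ → Prop) : ℝ := ∑ x ∈ range (2 ^ J), if P x then 1 else 0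

section cnt
variable {J : ℕ} {P Q : ℕ → Prop}

lemma cnt_mono (h : ∀ x < 2 ^ J, P x → Q x) : cnt J P ≤ cnt J Q :=
  sum_le_sum fun x hx => by
    have := h x (mem_range.1 hx)
    split_ifs with h1 h2 <;> first | exact absurd (this h1) h2 | norm_num

lemma cnt_or_le : cnt J (fun x => P x ∨ Q x) ≤ cnt J P + cnt J Q := by
  rw [cnt, cnt, cnt, ← sum_add_distrib]
  refine sum_le_sum fun x _ => ?_
  by_cases h1 : P x <;> by_cases h2 : Q x <;> simp [h1, h2]

lemma cnt_exists_le {ι : Type*} (s : Finset ι) (R : ι → ℕ → Prop) :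
    cnt J (fun x => ∃ i ∈ s, R i x) ≤ ∑ i ∈ s, cnt J (R i) := by
  classical
  induction s using Finset.induction_on with
  | empty => simp [cnt]
  | insert a s ha ih =>
    rw [sum_insert ha]
    refine le_trans (le_trans (cnt_mono fun x _ hx => ?_) (cnt_or_le (P := R a)
      (Q := fun x => ∃ i ∈ s, R i x))) (by gcongr)
    obtain ⟨i, hi, hx⟩ := hx
    rcases Finset.mem_insert.1 hi with rfl | hi
    · exact Or.inl hx
    · exact Or.inr ⟨i, hi, hx⟩

lemma mul_cnt_le {g : ℕ → ℝ} {t : ℝ} (hg : ∀ x, 0 ≤ g x) (h : ∀ x < 2 ^ J, P x → t ≤ g x) :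
    t * cnt J P ≤ ∑ x ∈ range (2 ^ J), g x := by
  rw [cnt, mul_sum]
  refine sum_le_sum fun x hx => ?_
  split_ifs with h1
  · simpa using h x (mem_range.1 hx) h1
  · simpa using hg x

end cnt

lemma div_node {J d j x : ℕ} (hx : x ∈ Ico (j * 2 ^ (J - d)) (j * 2 ^ (J - d) + 2 ^ (J - d))) :
    x / 2 ^ (J - d) = j := by
  rw [mem_Ico] at hx
  have : 0 < 2 ^ (J - d) := by positivity
  rw [Nat.div_eq_iff this]
  constructor <;> [linarith; omega]

lemma mem_node (J d x : ℕ) : x ∈ Ico (x / 2 ^ (J - d) * 2 ^ (J - d))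
    (x / 2 ^ (J - d) * 2 ^ (J - d) + 2 ^ (J - d)) := by
  rw [mem_Ico]
  have h := Nat.div_add_mod x (2 ^ (J - d))
  have h2 := Nat.mod_lt x (show 0 < 2 ^ (J - d) by positivity)
  rw [mul_comm] at h
  omega

lemma div_node_succ {J d : ℕ} (hd : d + 1 ≤ J) (x : ℕ) :
    x / 2 ^ (J - (d + 1)) / 2 = x / 2 ^ (J - d) := by
  rw [Nat.div_div_eq_div_mul, ← pow_succ]; congr 2; omega

lemma div_node_add {J d i : ℕ} (hd : d + i ≤ J) (x : ℕ) :
    x / 2 ^ (J - (d + i)) / 2 ^ i = x / 2 ^ (J - d) := by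
  rw [Nat.div_div_eq_div_mul, ← pow_add]; congr 2; omega

lemma sum_range_nodes {α : Type*} [AddCommMonoid α] {J d : ℕ} (hd : d ≤ J) (F : ℕ → α) :
    ∑ x ∈ range (2 ^ J), F x =
      ∑ j ∈ range (2 ^ d), ∑ x ∈ Ico (j * 2 ^ (J - d)) (j * 2 ^ (J - d) + 2 ^ (J - d)), F x := by
  have := sum_Ico_mul 0 (2 ^ (J - d)) (2 ^ d) F
  simp only [zero_add] at this
  rw [← this, range_eq_Ico, ← pow_add]; congr 3; omega

lemma sum_range_node_const {J d : ℕ} (hd : d ≤ J) (F : ℕ → ℝ) :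
    ∑ x ∈ range (2 ^ J), F (x / 2 ^ (J - d)) = 2 ^ J * av d F := by
  rw [sum_range_nodes hd, av, show (2 : ℝ) ^ J = 2 ^ (J - d) * 2 ^ d by
    rw [← pow_add]; congr 1; omega, mul_assoc, mul_div_cancel₀ _ (by positivity), mul_sum]
  refine sum_congr rfl fun j _ => ?_
  rw [sum_congr rfl (g := fun _ => F j) fun x hx => by rw [div_node hx]]
  simp

section level
variable {J k q k0 κ p : ℕ} {ρ lam : ℝ} {f : ℕ → ℂ} {W : ℕ → ℕ → Multiset (ℂ × ℝ)}

lemma norm_clipAvg_le (hf : ∀ z, ‖f z‖ ≤ 1) (hq : 4 ≤ q) (d j : ℕ) (η : ℝ) :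
    ‖clipAvg J f q k k0 κ p d j η‖ ≤ 1 := by
  have hc : clipFun q 1 ≤ 1 := by
    refine (clipFun_one_le (by omega)).trans ?_
    rw [div_le_one (by positivity)]
    refine Real.le_sqrt_of_sq_le ?_
    norm_num; exact_mod_cast hq
  rw [clipAvg, norm_mul]
  have h1 : ‖∑ c ∈ range (2 ^ (k - k0)), chi q
      (expAvg J f p (d + k) ((j * 2 ^ k0 + κ) * 2 ^ (k - k0) + c) η)‖ ≤ 2 ^ k := by
    refine (norm_sum_le _ _).trans ?_
    calc _ ≤ ∑ c ∈ range (2 ^ (k - k0)), (1 : ℝ) :=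
          sum_le_sum fun c _ => (norm_chi_le (norm_expAvg_le hf)).trans hc
      _ = 2 ^ (k - k0) := by simp
      _ ≤ 2 ^ k := pow_le_pow_right₀ (by norm_num) (by omega)
  simp only [norm_div, norm_one, norm_pow, RCLike.norm_ofNat]
  rw [one_div, inv_mul_le_iff₀ (by positivity)]
  linarith

lemma clipAvg_symbol (hk : k0 ≤ k) (hκ : κ < 2 ^ k0) (d j : ℕ) (η : ℝ) :
    ‖clipAvg J f q k k0 κ p d j η - (1 / 2 ^ k0 : ℂ) * chi q (expAvg J f p d j η)‖ ^ 2 ≤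
      dev q k (expAvg J f p) d j η := by
  obtain ⟨g, hg⟩ : ∃ g : ℕ → ℂ, ∀ c, g c = chi q (expAvg J f p (d + k) (j * 2 ^ k + c) η) -
    chi q (expAvg J f p d j η) := ⟨_, fun _ => rfl⟩
  have hpow : (2 : ℂ) ^ k = 2 ^ k0 * 2 ^ (k - k0) := by rw [← pow_add]; congr 1; omega
  have hpow' : 2 ^ k = 2 ^ k0 * 2 ^ (k - k0) := by rw [← pow_add]; congr 1; omega
  have h1 : clipAvg J f q k k0 κ p d j η - (1 / 2 ^ k0 : ℂ) * chi q (expAvg J f p d j η) =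
      (1 / 2 ^ k : ℂ) * ∑ c ∈ range (2 ^ (k - k0)), g (κ * 2 ^ (k - k0) + c) := by
    simp only [hg]
    rw [sum_sub_distrib, clipAvg, sum_const, card_range, nsmul_eq_mul, mul_sub]
    have hi : ∀ c, (j * 2 ^ k0 + κ) * 2 ^ (k - k0) + c = j * 2 ^ k + (κ * 2 ^ (k - k0) + c) := by
      intro c; rw [hpow']; ring
    have hr : (1 / 2 ^ k : ℂ) * ((2 ^ (k - k0) : ℕ) * chi q (expAvg J f p d j η)) =
        (1 / 2 ^ k0 : ℂ) * chi q (expAvg J f p d j η) := by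
      push_cast; rw [hpow]; field_simp
    rw [hr]
    simp only [hi]
  have h2 : ‖∑ c ∈ range (2 ^ (k - k0)), g (κ * 2 ^ (k - k0) + c)‖ ^ 2 ≤
      2 ^ k * ∑ c ∈ range (2 ^ k), ‖g c‖ ^ 2 := by
    have hsub : ∑ c ∈ range (2 ^ (k - k0)), ‖g (κ * 2 ^ (k - k0) + c)‖ ≤
        ∑ c ∈ range (2 ^ k), ‖g c‖ := by
      have hsh := sum_Ico_eq_sum_range (fun c => ‖g c‖) (κ * 2 ^ (k - k0))
        (κ * 2 ^ (k - k0) + 2 ^ (k - k0))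
      rw [add_tsub_cancel_left] at hsh
      rw [← hsh]
      refine sum_le_sum_of_subset_of_nonneg (fun c hc => ?_) fun _ _ _ => norm_nonneg _
      rw [mem_Ico] at hc
      rw [mem_range, hpow']
      calc c < (κ + 1) * 2 ^ (k - k0) := by linarith
        _ ≤ _ := Nat.mul_le_mul_right _ hκ
    calc _ ≤ (∑ c ∈ range (2 ^ k), ‖g c‖) ^ 2 := by
          gcongr; exact (norm_sum_le _ _).trans hsub
      _ ≤ _ := by
          have := sq_sum_le_card_mul_sum_sq (s := range (2 ^ k)) (f := fun c => ‖g c‖)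
          simpa using this
  rw [h1, norm_mul, mul_pow, dev]
  simp only [← hg]
  simp only [norm_div, norm_one, norm_pow, RCLike.norm_ofNat]
  calc _ ≤ (1 / 2 ^ k) ^ 2 * (2 ^ k * ∑ c ∈ range (2 ^ k), ‖g c‖ ^ 2) := by gcongr
    _ = _ := by field_simp

lemma treeData_clipAvg (hf : ∀ z, ‖f z‖ ≤ 1) (hρ : 0 < ρ) (hW : ∀ d j, W d (j / 2) ≤ W (d + 1) j)
    (hamp : ∀ d j, ∀ c ∈ W d j, ρ ≤ ‖c.1‖) (hE : ∀ d ≤ J, av d (fun j => energy (W d j)) ≤ 2)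
    (hk : k0 ≤ k) (hκ : κ < 2 ^ k0) :
    TreeData J k q ρ W (expAvg J f p) (clipAvg J f q k k0 κ p) where
  rho_pos := hρ
  W_mono := hW
  amp := hamp
  energy_le := hE
  norm_le _ _ _ := norm_expAvg_le hf
  mart _ _ _ _ h := expAvg_eq_avg h
  symbol := ⟨1 / 2 ^ k0, by
    simp only [norm_div, norm_one, norm_pow, RCLike.norm_ofNat]
    rw [div_le_one (by positivity)]; exact one_le_pow₀ (by norm_num),
    fun d j η _ => clipAvg_symbol hk hκ d j η⟩

lemma fz_chain {X : ℕ → ℕ → ℝ → ℂ} {τ : ℝ} (x : ℕ) {d : ℕ} (hd : d ≤ J) :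
    ∃ d₀ ≤ d, fz W X τ d (x / 2 ^ (J - d)) = (d₀, x / 2 ^ (J - d₀)) ∧
      Halts W X τ d₀ (x / 2 ^ (J - d₀)) := by
  induction d with
  | zero => exact ⟨0, le_rfl, rfl, trivial⟩
  | succ d ih =>
    by_cases h : Halts W X τ (d + 1) (x / 2 ^ (J - (d + 1)))
    · exact ⟨d + 1, le_rfl, fz_of_halts h, h⟩
    · obtain ⟨d₀, h0, h1, h2⟩ := ih (by omega)
      refine ⟨d₀, by omega, ?_, h2⟩
      rw [fz_of_not_halts h, div_node_succ hd, h1]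

lemma norm_pair_le (L : Multiset (ℂ × ℝ)) (G : ℝ → ℂ) (x : ℕ) :
    ‖pair L G x‖ ≤ msum L fun c => ‖c.1‖ * ‖G (c.2 / 2)‖ := by
  induction L using Multiset.induction_on with
  | empty => simp [pair, msum]
  | cons c L ih =>
    simp only [pair, msum, Multiset.map_cons, Multiset.sum_cons] at ih ⊢
    refine (norm_add_le _ _).trans ?_
    rw [norm_mul, norm_mul, norm_e, mul_one]
    gcongr

lemma norm_pair_sub_pair_le {X : ℕ → ℕ → ℝ → ℂ} {τ : ℝ} {P₀ P : ℕ × ℕ}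
    (hP : W P₀.1 P₀.2 ≤ W P.1 P.2) (hX : ∀ d j η, ‖X d j η‖ ≤ 1) (hv : ¬ Viol W X τ P₀ P) (x : ℕ) :
    ‖pair (W P.1 P.2) (X P.1 P.2) x - pair (W P₀.1 P₀.2) (X P₀.1 P₀.2) x‖ ≤ 2 * τ := by
  obtain ⟨M, hM⟩ := Multiset.le_iff_exists_add.1 hP
  unfold Viol at hv
  push Not at hv
  obtain ⟨h1, h2⟩ := hv
  rw [hM, msum_add_left, add_sub_cancel_left] at h1
  rw [hM, pair_add_left, add_sub_right_comm, ← pair_sub]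
  refine (norm_add_le _ _).trans ?_
  have h3 := norm_pair_le (W P₀.1 P₀.2) (X P.1 P.2 - X P₀.1 P₀.2) x
  have h4 : ‖pair M (X P.1 P.2) x‖ ≤ msum M fun c => ‖c.1‖ :=
    (norm_pair_le _ _ _).trans (msum_le_msum fun c _ =>
      mul_le_of_le_one_right (norm_nonneg _) (hX _ _ _))
  simp only [Pi.sub_apply] at h3
  linarith

/-- The localised bilinear average at depth `d`, evaluated at `x`. -/
noncomputable def locAvg (J k0 κ : ℕ) (f : ℕ → ℂ) (u : ℕ → ℕ → ℕ → ℂ) (d x : ℕ) : ℂ :=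
  bil (2 ^ (J - d)) (window J k0 κ d (x / 2 ^ (J - d))) (u d (x / 2 ^ (J - d))) f x

lemma sum_norm_sq_locAvg_le {u : ℕ → ℕ → ℕ → ℂ} (hf : ∀ z, ‖f z‖ ≤ 1) {d j : ℕ} (hd : d + k0 ≤ J)
    (hκ : κ < 2 ^ k0) (hu : Light (j * 2 ^ (J - d)) (2 ^ (J - d)) lam (u d j)) :
    ∑ x ∈ Ico (j * 2 ^ (J - d)) (j * 2 ^ (J - d) + 2 ^ (J - d)), ‖locAvg J k0 κ f u d x‖ ^ 2 ≤
      2 * lam ^ 2 * 2 ^ (J - d) := by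
  have key : ∀ p, ∑ x ∈ parityIco p (j * 2 ^ (J - d)) (2 ^ (J - d)),
      ‖locAvg J k0 κ f u d x‖ ^ 2 ≤ lam ^ 2 * 2 ^ (J - d) := fun p => by
    have := sum_norm_sq_bil_le (p := p) (show 0 < 2 ^ (J - d) by positivity)
      (window_subset hd hκ (j := j)) hf hu
    push_cast at this
    refine le_trans (le_of_eq (sum_congr rfl fun x hx => ?_)) this
    rw [mem_parityIco] at hx
    rw [locAvg, div_node (mem_Ico.2 hx.1)]
  have hsplit : ∑ x ∈ Ico (j * 2 ^ (J - d)) (j * 2 ^ (J - d) + 2 ^ (J - d)),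
      ‖locAvg J k0 κ f u d x‖ ^ 2 =
      ∑ x ∈ parityIco 0 (j * 2 ^ (J - d)) (2 ^ (J - d)), ‖locAvg J k0 κ f u d x‖ ^ 2 +
      ∑ x ∈ parityIco 1 (j * 2 ^ (J - d)) (2 ^ (J - d)), ‖locAvg J k0 κ f u d x‖ ^ 2 := by
    rw [parityIco, parityIco, ← sum_filter_add_sum_filter_not _ (fun x => x % 2 = 0)]
    congr 2
    ext x; simp
  rw [hsplit]
  linarith [key 0, key 1]

lemma norm_locAvg_le {u : ℕ → ℕ → ℕ → ℂ} (hf : ∀ z, ‖f z‖ ≤ 1) {d x : ℕ} (hd : d + k0 ≤ J)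
    (hκ : κ < 2 ^ k0)
    (hu : Light (x / 2 ^ (J - d) * 2 ^ (J - d)) (2 ^ (J - d)) lam (u d (x / 2 ^ (J - d)))) :
    ‖locAvg J k0 κ f u d x‖ ≤ lam * 2 ^ (J - d) := by
  set j := x / 2 ^ (J - d) with hj
  set n := 2 ^ (J - d) with hn
  have hn0 : (0 : ℝ) < n := by rw [hn]; positivity
  have hx := mem_node J d x
  rw [← hj, ← hn, mem_Ico] at hx
  have hlam : 0 ≤ lam := (norm_nonneg _).trans (hu 0)
  have hu' : ∀ y ∈ Ico (j * n) (j * n + n), ‖u d j y‖ ≤ lam * n := fun y hy => by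
    rw [← sum_coef_mul_e (u d j) hy]
    refine (norm_sum_le _ _).trans ?_
    calc _ ≤ ∑ i ∈ range n, lam := sum_le_sum fun i _ => by
          rw [norm_mul, norm_e, mul_one]; exact hu _
      _ = lam * n := by simp [mul_comm]
  have hnr : (n : ℝ) = 2 ^ (J - d) := by rw [hn]; push_cast; rfl
  rw [locAvg, ← hj, ← hn, bil, norm_mul, ← hnr]
  have hS := window_subset hd hκ (j := j)
  rw [← hn] at hS
  have h1 : ‖∑ z ∈ window J k0 κ d j with z % 2 = x % 2, u d j ((x + z) / 2) * f z‖ ≤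
      n * (lam * n) := by
    refine (norm_sum_le _ _).trans ?_
    calc _ ≤ ∑ z ∈ window J k0 κ d j with z % 2 = x % 2, lam * n := sum_le_sum fun z hz => by
          have hz' := mem_Ico.1 (hS (mem_filter.1 hz).1)
          rw [norm_mul]
          calc _ ≤ (lam * n) * 1 := by
                gcongr
                · exact hu' _ (by rw [mem_Ico]; omega)
                · exact hf z
            _ = _ := mul_one _
      _ = (#{z ∈ window J k0 κ d j | z % 2 = x % 2} : ℝ) * (lam * n) := by simp
      _ ≤ _ := by
        gcongr
        calc _ ≤ #(Ico (j * n) (j * n + n)) := card_le_card ((filter_subset _ _).trans hS)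
          _ = n := by simp
  simp only [norm_div, norm_one, Complex.norm_natCast]
  rw [one_div, inv_mul_le_iff₀ hn0]
  exact h1

end level

section level
variable {J k q k0 κ p : ℕ} {ρ lam τ Λ : ℝ} {f : ℕ → ℂ} {W : ℕ → ℕ → Multiset (ℂ × ℝ)}

open Classical in
lemma cnt_node_le {u : ℕ → ℕ → ℕ → ℂ} (hf : ∀ z, ‖f z‖ ≤ 1) {d : ℕ} (hd : d + k0 ≤ J)
    (hκ : κ < 2 ^ k0) (hτ : 0 < τ) (S : ℕ → Prop)
    (hu : ∀ j < 2 ^ d, Light (j * 2 ^ (J - d)) (2 ^ (J - d)) lam (u d j)) :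
    cnt J (fun x => S (x / 2 ^ (J - d)) ∧ τ < ‖locAvg J k0 κ f u d x‖) ≤
      2 ^ J * (2 * lam ^ 2 / τ ^ 2) * av d (fun j => if S j then 1 else 0) := by
  have h1 : τ ^ 2 * cnt J (fun x => S (x / 2 ^ (J - d)) ∧ τ < ‖locAvg J k0 κ f u d x‖) ≤
      ∑ x ∈ range (2 ^ J), (if S (x / 2 ^ (J - d)) then 1 else 0) *
        ‖locAvg J k0 κ f u d x‖ ^ 2 := by
    refine mul_cnt_le (fun x => by positivity) fun x _ hx => ?_
    rw [if_pos hx.1, one_mul]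
    have := hx.2.le
    gcongr
  have h2 : ∑ x ∈ range (2 ^ J), (if S (x / 2 ^ (J - d)) then (1 : ℝ) else 0) *
        ‖locAvg J k0 κ f u d x‖ ^ 2 ≤
      ∑ j ∈ range (2 ^ d), (if S j then 1 else 0) * (2 * lam ^ 2 * 2 ^ (J - d)) := by
    rw [sum_range_nodes (show d ≤ J by omega)]
    refine sum_le_sum fun j hj => ?_
    calc _ = (if S j then (1 : ℝ) else 0) * ∑ x ∈ Ico (j * 2 ^ (J - d))
          (j * 2 ^ (J - d) + 2 ^ (J - d)), ‖locAvg J k0 κ f u d x‖ ^ 2 := by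
          rw [mul_sum]
          exact sum_congr rfl fun x hx => by rw [div_node hx]
      _ ≤ _ := by
          gcongr
          exact sum_norm_sq_locAvg_le hf hd hκ (hu j (mem_range.1 hj))
  have h3 : (2 : ℝ) ^ J = 2 ^ (J - d) * 2 ^ d := by rw [← pow_add]; congr 1; omega
  rw [← sum_mul] at h2
  have h4 : 2 ^ J * (2 * lam ^ 2 / τ ^ 2) * av d (fun j => if S j then 1 else 0) =
      ((∑ j ∈ range (2 ^ d), if S j then 1 else 0) * (2 * lam ^ 2 * 2 ^ (J - d))) / τ ^ 2 := by
    rw [h3, av]; field_simp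
  rw [h4, le_div_iff₀ (by positivity)]
  linarith

lemma cnt_energy_le {D : ℕ} (hD : D ≤ J) (hΛ : 0 < Λ)
    (hE : av D (fun j => energy (W D j)) ≤ 2) :
    cnt J (fun x => Λ < energy (W D (x / 2 ^ (J - D)))) ≤ 2 ^ J * (2 / Λ) := by
  have h1 : Λ * cnt J (fun x => Λ < energy (W D (x / 2 ^ (J - D)))) ≤
      ∑ x ∈ range (2 ^ J), energy (W D (x / 2 ^ (J - D))) :=
    mul_cnt_le (fun x => energy_nonneg _) fun x _ hx => hx.le
  rw [sum_range_node_const hD (fun j => energy (W D j))] at h1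
  have h2 : (2 : ℝ) ^ J * av D (fun j => energy (W D j)) ≤ 2 ^ J * 2 := by gcongr
  rw [← mul_div_assoc, le_div_iff₀ hΛ]
  linarith

/-- Off the exceptional points the localised averages along the chain of `x` are controlled by
their value at the last stopping node. -/
lemma norm_locAvg_le_of_halts (hf : ∀ z, ‖f z‖ ≤ 1) (hW : ∀ d j, W d (j / 2) ≤ W (d + 1) j)
    (hL : ∀ d ≤ J, ∀ j < 2 ^ d, Light (j * 2 ^ (J - d)) (2 ^ (J - d)) lam (synth (W d j)))
    (hτ : 0 < τ) (hk : k0 ≤ k) (hq4 : 4 ≤ q) (hq : 16 * q ≤ 2 ^ k) (hκ1 : 2 ^ k0 ≤ 16 * κ)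
    (hκ2 : 16 * κ + 16 ≤ 15 * 2 ^ k0) {x d : ℕ} (hx : x < 2 ^ J) (hd : d + k ≤ J)
    (hs : ∀ d' ≤ d, Halts W (clipAvg J f q k k0 κ (x % 2)) τ d' (x / 2 ^ (J - d')) →
      ‖locAvg J k0 κ f (fun d j => synth (W d j)) d' x‖ ≤ τ) :
    ‖locAvg J k0 κ f (fun d j => synth (W d j)) d x‖ ≤ 3 * τ + 2 * (lam * q * 2 ^ k) := by
  set X := clipAvg J f q k k0 κ (x % 2) with hX
  set Y := locAvg J k0 κ f (fun d j => synth (W d j)) with hY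
  set Z : ℕ → ℂ := fun d => pair (W d (x / 2 ^ (J - d))) (X d (x / 2 ^ (J - d))) x with hZ
  have happrox : ∀ d', d' + k ≤ J → ‖Y d' x - Z d'‖ ≤ lam * q * 2 ^ k := fun d' hd' =>
    norm_bil_sub_pair_le hf hd' hk hq hκ1 hκ2
      (hL d' (by omega) _ (by
        rw [Nat.div_lt_iff_lt_mul (by positivity), ← pow_add]
        rwa [show d' + (J - d') = J by omega]))
      (mem_parityIco.2 ⟨mem_Ico.1 (mem_node J d' x), rfl⟩)
  obtain ⟨d₀, h0, h1, h2⟩ := fz_chain (W := W) (X := X) (τ := τ) x (show d ≤ J by omega)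
  have h3 := norm_pair_sub_pair_le (P₀ := (d₀, x / 2 ^ (J - d₀))) (P := (d, x / 2 ^ (J - d)))
    (by have := W_fz_le (X := X) (τ := τ) hW d (x / 2 ^ (J - d)); rwa [h1] at this)
    (fun d j η => norm_clipAvg_le hf hq4 d j η)
    (by have := not_viol_fz (W := W) (X := X) hτ d (x / 2 ^ (J - d)); rwa [h1] at this) x
  have h4 : ‖Z d - Z d₀‖ ≤ 2 * τ := h3
  have h5 := hs d₀ h0 h2
  have h6 := happrox d hd
  have h7 := happrox d₀ (by omega)
  rw [norm_sub_rev] at h7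
  calc ‖Y d x‖ = ‖(Y d x - Z d) + (Z d - Z d₀) + (Z d₀ - Y d₀ x) + Y d₀ x‖ := by congr 1; ring
    _ ≤ ‖Y d x - Z d‖ + ‖Z d - Z d₀‖ + ‖Z d₀ - Y d₀ x‖ + ‖Y d₀ x‖ := by
      refine (norm_add_le _ _).trans ?_
      gcongr
      exact norm_add₃_le
    _ ≤ _ := by linarith

theorem cnt_locAvg_large_le (hf : ∀ z, ‖f z‖ ≤ 1) (hρ : 0 < ρ)
    (hW : ∀ d j, W d (j / 2) ≤ W (d + 1) j)
    (hamp : ∀ d j, ∀ c ∈ W d j, ρ ≤ ‖c.1‖) (hE : ∀ d ≤ J, av d (fun j => energy (W d j)) ≤ 2)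
    (hL : ∀ d ≤ J, ∀ j < 2 ^ d, Light (j * 2 ^ (J - d)) (2 ^ (J - d)) lam (synth (W d j)))
    (hτ : 0 < τ) (hΛ : 0 < Λ) (hk : k0 ≤ k) (hq4 : 4 ≤ q) (hq : 16 * q ≤ 2 ^ k)
    (hκ1 : 2 ^ k0 ≤ 16 * κ)
    (hκ2 : 16 * κ + 16 ≤ 15 * 2 ^ k0) {D : ℕ} (hD : D + k ≤ J) :
    cnt J (fun x => ∃ d ≤ D, 3 * τ + 2 * (lam * q * 2 ^ k) <
      ‖locAvg J k0 κ f (fun d j => synth (W d j)) d x‖) ≤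
    2 ^ J * (2 / Λ + 4 * lam ^ 2 / τ ^ 2 * (1 + 2 / (ρ * τ) +
      Λ / τ ^ 2 * ((24 * k + 36) * clipFun q 1 / ρ ^ 2))) := by
  have hκ : κ < 2 ^ k0 := by omega
  set S : ℕ → ℕ → ℕ → Prop := fun p d j => Halts W (clipAvg J f q k k0 κ p) τ d j ∧
    energy (W d j) ≤ Λ with hS
  set Y := locAvg J k0 κ f (fun d j => synth (W d j)) with hY
  have hWd : ∀ d i j : ℕ, W d (j / 2 ^ i) ≤ W (d + i) j :=
    (treeData_clipAvg (q := q) (p := 0) hf hρ hW hamp hE hk hκ).W_mono_depth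
  have hcover : ∀ x < 2 ^ J, (∃ d ≤ D, 3 * τ + 2 * (lam * q * 2 ^ k) < ‖Y d x‖) →
      Λ < energy (W D (x / 2 ^ (J - D))) ∨ ∃ p ∈ range 2, ∃ d ∈ range (D + 1),
        S p d (x / 2 ^ (J - d)) ∧ τ < ‖Y d x‖ := by
    rintro x hx ⟨d, hd, h⟩
    by_contra hcon
    push Not at hcon
    obtain ⟨h1, h2⟩ := hcon
    refine absurd (norm_locAvg_le_of_halts hf hW hL hτ hk hq4 hq hκ1 hκ2 hx (d := d) (by omega)
      fun d' hd' hst => ?_) (not_le.2 h)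
    refine h2 (x % 2) (mem_range.2 (by omega)) d' (mem_range.2 (by omega)) ⟨hst, ?_⟩
    refine le_trans (energy_mono ?_) h1
    have h3 := hWd d' (D - d') (x / 2 ^ (J - D))
    have h4 := div_node_add (J := J) (d := d') (i := D - d') (by omega) x
    rw [show d' + (D - d') = D by omega] at h3 h4
    rwa [h4] at h3
  have hp : ∀ p, cnt J (fun x => ∃ d ∈ range (D + 1), S p d (x / 2 ^ (J - d)) ∧ τ < ‖Y d x‖) ≤
      2 ^ J * (2 * lam ^ 2 / τ ^ 2) * (1 + 2 / (ρ * τ) +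
      Λ / τ ^ 2 * ((24 * k + 36) * clipFun q 1 / ρ ^ 2)) := fun p => by
    refine (cnt_exists_le _ _).trans ?_
    calc _ ≤ ∑ d ∈ range (D + 1), 2 ^ J * (2 * lam ^ 2 / τ ^ 2) *
          av d (fun j => open Classical in if S p d j then 1 else 0) :=
          sum_le_sum fun d hd => by
            have hd := mem_range.1 hd
            refine (cnt_node_le (u := fun d j => synth (W d j)) hf (by omega) hκ hτ (S p d)
              (hL d (by omega))).trans (le_of_eq ?_)
            congr!
      _ = 2 ^ J * (2 * lam ^ 2 / τ ^ 2) * ∑ d ∈ range (D + 1),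
          av d (fun j => open Classical in if S p d j then 1 else 0) := by rw [mul_sum]
      _ ≤ _ := by
          gcongr
          exact (treeData_clipAvg (p := p) hf hρ hW hamp hE hk hκ).sum_av_halts_le hτ hΛ hD
  refine (cnt_mono hcover).trans (cnt_or_le.trans ?_)
  have h1 := cnt_energy_le (show D ≤ J by omega) hΛ (hE D (by omega))
  have h2 := cnt_exists_le (J := J) (range 2)
    (fun p x => ∃ d ∈ range (D + 1), S p d (x / 2 ^ (J - d)) ∧ τ < ‖Y d x‖)
  rw [sum_range_succ, sum_range_one] at h2
  refine (add_le_add h1 (h2.trans (add_le_add (hp 0) (hp 1)))).trans (le_of_eq ?_)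
  ring

/-- The frequencies of size about `2 ^ (-40 m)` produce averages of size `2 ^ (-m)` off a set of
density `2 ^ (-m)`. -/
theorem cnt_locAvg_le (hf : ∀ z, ‖f z‖ ≤ 1) {m : ℕ} (hm : 2 ≤ m) (hρ : ρ = 1 / (2 ^ m) ^ 40)
    (hW : ∀ d j, W d (j / 2) ≤ W (d + 1) j)
    (hamp : ∀ d j, ∀ c ∈ W d j, ρ ≤ ‖c.1‖) (hE : ∀ d ≤ J, av d (fun j => energy (W d j)) ≤ 2)
    (hL : ∀ d ≤ J, ∀ j < 2 ^ d,
      Light (j * 2 ^ (J - d)) (2 ^ (J - d)) (2 ^ 41 * ρ) (synth (W d j)))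
    (hk : k0 ≤ 16 * m + 6) (hκ1 : 2 ^ k0 ≤ 16 * κ) (hκ2 : 16 * κ + 16 ≤ 15 * 2 ^ k0) :
    cnt J (fun x => ∃ d, d + k0 ≤ J ∧ 2 ^ 100 / 2 ^ m <
      ‖locAvg J k0 κ f (fun d j => synth (W d j)) d x‖) ≤ 2 ^ J * (2 ^ 100 / 2 ^ m) := by
  have hκ : κ < 2 ^ k0 := by omega
  obtain ⟨A, hA⟩ : ∃ A : ℝ, A = 2 ^ m := ⟨_, rfl⟩
  have hA4 : 4 ≤ A := by
    rw [hA]; calc (4 : ℝ) = 2 ^ 2 := by norm_num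
      _ ≤ 2 ^ m := pow_le_pow_right₀ (by norm_num) hm
  have hA0 : 0 < A := by linarith
  have hA1 : ∀ i : ℕ, 1 ≤ A ^ i := fun i => one_le_pow₀ (by linarith)
  have hρ0 : 0 < ρ := by rw [hρ]; positivity
  have hsmall : ∀ x < 2 ^ J, ∀ d, d + k0 ≤ J → J - d ≤ 20 * m →
      ‖locAvg J k0 κ f (fun d j => synth (W d j)) d x‖ ≤ 2 ^ 100 / 2 ^ m := by
    intro x hx d hd hs
    refine (norm_locAvg_le (lam := 2 ^ 41 * ρ) (u := fun d j => synth (W d j)) hf hd hκ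
      (hL d (by omega) _ (by
        rw [Nat.div_lt_iff_lt_mul (by positivity), ← pow_add]
        rwa [show d + (J - d) = J by omega]))).trans ?_
    calc 2 ^ 41 * ρ * 2 ^ (J - d) ≤ 2 ^ 41 * ρ * 2 ^ (20 * m) := by
          gcongr; norm_num
      _ = 2 ^ 41 / A ^ 20 := by
          rw [mul_comm 20 m, pow_mul, ← hA, hρ, ← hA]; field_simp
      _ ≤ 2 ^ 100 / A := by
          gcongr
          · norm_num
          · norm_num
          · exact le_self_pow₀ (by linarith) (by norm_num)
      _ = _ := by rw [hA]
  by_cases hJ : 20 * m ≤ J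
  · set q := 2 ^ (16 * m) with hq
    have hqA : (q : ℝ) = A ^ 16 := by rw [hq, hA]; push_cast; rw [← pow_mul]; congr 1; ring
    have hkA : (2 : ℝ) ^ (16 * m + 6) = 64 * A ^ 16 := by
      rw [pow_add, hA, ← pow_mul, mul_comm m]; ring
    have hq4 : 4 ≤ q := by
      rw [hq]; calc 4 = 2 ^ 2 := by norm_num
        _ ≤ _ := Nat.pow_le_pow_right (by norm_num) (by omega)
    have hclip : clipFun q 1 ≤ 2 / A ^ 8 := by
      refine (clipFun_one_le (by omega)).trans (le_of_eq ?_)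
      rw [hqA, show A ^ 16 = (A ^ 8) ^ 2 by ring, Real.sqrt_sq (by positivity)]
    have hclip0 : 0 ≤ clipFun q 1 := (norm_nonneg _).trans (norm_chi_le (a := 0) (by simp))
    have hmA : (m : ℝ) + 1 ≤ A := by
      rw [hA]; exact_mod_cast Nat.lt_two_pow_self
    have main := cnt_locAvg_large_le (k := 16 * m + 6) (q := q) (lam := 2 ^ 41 * ρ) (τ := 1 / A)
      (Λ := A) hf hρ0 hW hamp hE hL (by positivity) hA0 hk hq4
      (by rw [hq, pow_add]; omega) hκ1 hκ2 (D := J - 20 * m) (by omega)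
    refine le_trans (cnt_mono ?_) (main.trans ?_)
    · rintro x hx ⟨d, hd, h⟩
      by_cases hs : J - d ≤ 20 * m
      · exact absurd (hsmall x hx d hd hs) (not_le.2 h)
      · refine ⟨d, by omega, lt_of_le_of_lt ?_ h⟩
        rw [hqA, hkA, hρ, ← hA]
        have : 2 * (2 ^ 41 * (1 / A ^ 40) * A ^ 16 * (64 * A ^ 16)) ≤ 2 ^ 48 / A := by
          calc _ = 2 ^ 48 / A ^ 8 := by field_simp; norm_num
            _ ≤ _ := by
              gcongr
              exact le_self_pow₀ (by linarith) (by norm_num)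
        have h3 : 3 * (1 / A) + 2 ^ 48 / A ≤ 2 ^ 100 / A := by
          rw [← mul_div_assoc, ← add_div]; gcongr; norm_num
        linarith
    · gcongr
      rw [← hA]
      have h24 : (24 * ((16 * m + 6 : ℕ) : ℝ) + 36) ≤ 2 ^ 9 * A := by push_cast; linarith
      have h1 : 4 * (2 ^ 41 * ρ) ^ 2 / (1 / A) ^ 2 * 1 ≤ 2 ^ 84 / A := by
        calc _ = 2 ^ 84 / A ^ 78 := by rw [hρ, ← hA]; field_simp; norm_num
          _ ≤ _ := by gcongr; exact le_self_pow₀ (by linarith) (by norm_num)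
      have h2 : 4 * (2 ^ 41 * ρ) ^ 2 / (1 / A) ^ 2 * (2 / (ρ * (1 / A))) ≤ 2 ^ 85 / A := by
        calc _ = 2 ^ 85 / A ^ 37 := by rw [hρ, ← hA]; field_simp; norm_num
          _ ≤ _ := by gcongr; exact le_self_pow₀ (by linarith) (by norm_num)
      have h3 : 4 * (2 ^ 41 * ρ) ^ 2 / (1 / A) ^ 2 * (A / (1 / A) ^ 2 *
          ((24 * ((16 * m + 6 : ℕ) : ℝ) + 36) * clipFun q 1 / ρ ^ 2)) ≤ 2 ^ 94 / A := by
        calc _ ≤ 4 * (2 ^ 41 * ρ) ^ 2 / (1 / A) ^ 2 * (A / (1 / A) ^ 2 *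
              ((2 ^ 9 * A) * (2 / A ^ 8) / ρ ^ 2)) := by gcongr
          _ = 2 ^ 94 / A ^ 2 := by field_simp; norm_num
          _ ≤ _ := by gcongr; exact le_self_pow₀ (by linarith) (by norm_num)
      have h4 : 2 / A + 2 ^ 84 / A + 2 ^ 85 / A + 2 ^ 94 / A ≤ 2 ^ 100 / A := by
        rw [← add_div, ← add_div, ← add_div]; gcongr; norm_num
      rw [mul_add, mul_add]
      linarith
  · refine le_trans (le_of_eq ?_) (by positivity : (0 : ℝ) ≤ _)
    refine sum_eq_zero fun x hx => if_neg ?_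
    rintro ⟨d, hd, h⟩
    exact absurd (hsmall x (mem_range.1 hx) d hd (by omega)) (not_le.2 h)

end level

/-- The list with all amplitudes negated. -/
noncomputable def negAmp (L : Multiset (ℂ × ℝ)) : Multiset (ℂ × ℝ) := L.map fun c => (-c.1, c.2)

lemma synth_negAmp (L : Multiset (ℂ × ℝ)) (y : ℕ) : synth (negAmp L) y = -synth L y := by
  simp [synth, negAmp, Multiset.map_map]

lemma energy_negAmp (L : Multiset (ℂ × ℝ)) : energy (negAmp L) = energy L := by
  simp [energy, negAmp, Multiset.map_map]

lemma Light.sub {b n : ℕ} {ρ ρ' : ℝ} {u v : ℕ → ℂ} (hu : Light b n ρ u) (hv : Light b n ρ' v) :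
    Light b n (ρ + ρ') (fun y => u y - v y) := fun θ => by
  have : coef b n (fun y => u y - v y) θ = coef b n u θ - coef b n v θ := by
    simp only [coef, sub_mul, sum_sub_distrib, mul_sub]
  rw [this]
  exact (norm_sub_le _ _).trans (add_le_add (hu θ) (hv θ))

lemma Light.mono {b n : ℕ} {ρ ρ' : ℝ} {u : ℕ → ℂ} (hu : Light b n ρ u) (h : ρ ≤ ρ') :
    Light b n ρ' u := fun θ => (hu θ).trans h

/-- The threshold of level `m`. -/
noncomputable def lev (m : ℕ) : ℝ := 1 / (2 ^ m) ^ 40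

lemma lev_pos (m : ℕ) : 0 < lev m := by unfold lev; positivity

lemma lev_succ (m : ℕ) : lev m = 2 ^ 40 * lev (m + 1) := by
  unfold lev; rw [pow_succ (2 : ℝ) m, mul_pow]; field_simp

lemma lev_le (m : ℕ) : lev m ≤ 1 / 2 ^ m := by
  unfold lev
  gcongr
  exact le_self_pow₀ (one_le_pow₀ (by norm_num)) (by norm_num)

/-- The frequencies appearing between the levels `m` and `m + 1`. -/
noncomputable def incr (J : ℕ) (f : ℕ → ℂ) (m d j : ℕ) : Multiset (ℂ × ℝ) :=
  births J (lev (m + 1)) f d j + negAmp (births J (lev m) f d j)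

section incr
variable {J k0 κ : ℕ} {f₁ f₂ : ℕ → ℂ} {m : ℕ}

lemma incr_mono (d j : ℕ) : incr J f₁ m d (j / 2) ≤ incr J f₁ m (d + 1) j :=
  add_le_add (births_mono J f₁ d j) (Multiset.map_le_map (births_mono J f₁ d j))

lemma incr_amp (d j : ℕ) : ∀ c ∈ incr J f₁ m d j, lev (m + 1) ≤ ‖c.1‖ := by
  intro c hc
  rcases Multiset.mem_add.1 hc with hc | hc
  · exact births_amp J (lev_pos _) f₁ d j c hc
  · obtain ⟨c', hc', rfl⟩ := Multiset.mem_map.1 hc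
    have h1 := births_amp J (lev_pos _) f₁ d j c' hc'
    have h2 := lev_succ m
    have h3 := lev_pos (m + 1)
    simp only [norm_neg]
    nlinarith

lemma incr_energy (hf : ∀ y, ‖f₁ y‖ ≤ 1) {d : ℕ} (hd : d ≤ J) :
    av d (fun j => energy (incr J f₁ m d j)) ≤ 2 := by
  simp only [incr, energy_add, energy_negAmp, av_add]
  have h : ∀ m, av d (fun j => energy (births J (lev m) f₁ d j)) ≤ 1 := fun m => by
    rw [av, div_le_one (by positivity)]
    exact births_energy J (lev_pos m) hf hd
  linarith [h m, h (m + 1)]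

lemma synth_incr (d j y : ℕ) : synth (incr J f₁ m d j) y =
    (f₁ y - synth (births J (lev m) f₁ d j) y) -
      (f₁ y - synth (births J (lev (m + 1)) f₁ d j) y) := by
  rw [incr, synth_add, synth_negAmp]; ring

lemma incr_light (d j : ℕ) :
    Light (j * 2 ^ (J - d)) (2 ^ (J - d)) (2 ^ 41 * lev (m + 1)) (synth (incr J f₁ m d j)) := by
  have h := (births_light J (lev_pos m) f₁ d j).sub (births_light J (lev_pos (m + 1)) f₁ d j)
  rw [show synth (incr J f₁ m d j) = _ from funext fun y => synth_incr d j y]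
  refine h.mono ?_
  have := lev_succ m
  have := lev_pos (m + 1)
  linarith

lemma locAvg_sub (u v : ℕ → ℕ → ℕ → ℂ) (d x : ℕ) :
    locAvg J k0 κ f₂ (fun d j y => u d j y - v d j y) d x =
      locAvg J k0 κ f₂ u d x - locAvg J k0 κ f₂ v d x := by
  simp only [locAvg, bil, sub_mul, sum_sub_distrib, mul_sub]

lemma locAvg_telescope (m I d x : ℕ) :
    locAvg J k0 κ f₂ (fun d j y => f₁ y - synth (births J (lev m) f₁ d j) y) d x =
      ∑ i ∈ range I, locAvg J k0 κ f₂ (fun d j => synth (incr J f₁ (m + i) d j)) d x +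
      locAvg J k0 κ f₂ (fun d j y => f₁ y - synth (births J (lev (m + I)) f₁ d j) y) d x := by
  induction I with
  | zero => simp
  | succ I ih =>
    rw [sum_range_succ, ih, add_assoc]
    congr 1
    have : (fun d j => synth (incr J f₁ (m + I) d j)) = fun d j y =>
      (f₁ y - synth (births J (lev (m + I)) f₁ d j) y) -
      (f₁ y - synth (births J (lev (m + I + 1)) f₁ d j) y) := by
      funext d j y; exact synth_incr d j y
    rw [this, locAvg_sub (fun d j y => f₁ y - synth (births J (lev (m + I)) f₁ d j) y)
      (fun d j y => f₁ y - synth (births J (lev (m + I + 1)) f₁ d j) y), ← add_assoc m,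
      sub_add_cancel]

lemma sum_geom_le (m I : ℕ) (B : ℝ) (hB : 0 ≤ B) :
    ∑ i ∈ range I, B / 2 ^ (m + i + 1) ≤ B / 2 ^ m := by
  have : ∑ i ∈ range I, B / 2 ^ (m + i + 1) = B / 2 ^ m - B / 2 ^ (m + I) := by
    induction I with
    | zero => simp
    | succ I ih => rw [sum_range_succ, ih]; field_simp; ring
  rw [this]
  linarith [show 0 ≤ B / 2 ^ (m + I) by positivity]

/-- If `f₁` has no large Fourier coefficient on the nodes around `x`, then the localised averages
of `f₁` against `f₂` are small for most `x`. -/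
theorem cnt_locAvg_light_le (hf₁ : ∀ z, ‖f₁ z‖ ≤ 1) (hf₂ : ∀ z, ‖f₂ z‖ ≤ 1) (hm : 1 ≤ m) {i₀ : ℕ}
    (hi₀ : k0 ≤ i₀) (hk : k0 ≤ 16 * m) (hκ1 : 2 ^ k0 ≤ 16 * κ) (hκ2 : 16 * κ + 16 ≤ 15 * 2 ^ k0) :
    cnt J (fun x => (∀ d, d + i₀ ≤ J → Light (x / 2 ^ (J - d) * 2 ^ (J - d)) (2 ^ (J - d))
      (lev m) f₁) ∧ ∃ d, d + i₀ ≤ J ∧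
        2 ^ 101 / 2 ^ m < ‖locAvg J k0 κ f₂ (fun _ _ => f₁) d x‖) ≤ 2 ^ J * (2 ^ 101 / 2 ^ m) := by
  have hκ : κ < 2 ^ k0 := by omega
  set t : ℝ := 2 ^ 100 / 2 ^ m with ht
  have ht0 : 0 < t := by positivity
  obtain ⟨I, hI⟩ : ∃ I : ℕ, (J + 1) * (2 * lev (m + I) ^ 2 / t ^ 2) ≤ t := by
    obtain ⟨I, hI⟩ := exists_nat_gt ((J + 1) * 2 / t ^ 3)
    refine ⟨I, ?_⟩
    have h1 : lev (m + I) ^ 2 * I ≤ 1 := by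
      have h2 := lev_le (m + I)
      have h3 := lev_pos (m + I)
      have h4 : (I : ℝ) ≤ 2 ^ (m + I) := by
        exact_mod_cast (Nat.lt_two_pow_self).le.trans
          (Nat.pow_le_pow_right (by norm_num) (Nat.le_add_left I m))
      have h5 : (1 : ℝ) ≤ 2 ^ (m + I) := one_le_pow₀ (by norm_num)
      calc lev (m + I) ^ 2 * I ≤ (1 / 2 ^ (m + I)) ^ 2 * 2 ^ (m + I) := by gcongr
        _ = 1 / 2 ^ (m + I) := by field_simp
        _ ≤ 1 := by rw [div_le_one (by positivity)]; exact h5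
    rw [div_lt_iff₀ (by positivity)] at hI
    have hI0 : (0 : ℝ) < I := by
      by_contra h
      have : (0 : ℝ) < (J + 1) * 2 := by positivity
      nlinarith [show 0 < t ^ 3 by positivity]
    rw [← mul_div_assoc, div_le_iff₀ (by positivity)]
    have : ((J : ℝ) + 1) * (2 * lev (m + I) ^ 2) ≤ (I * t ^ 3) * lev (m + I) ^ 2 := by
      rw [← mul_assoc]; gcongr
    calc _ ≤ _ := this
      _ = t ^ 3 * (lev (m + I) ^ 2 * I) := by ring
      _ ≤ t ^ 3 * 1 := by gcongr
      _ = _ := by ring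
  set Y := fun i => locAvg J k0 κ f₂ (fun d j => synth (incr J f₁ (m + i) d j)) with hY
  set R := locAvg J k0 κ f₂ (fun d j y => f₁ y - synth (births J (lev (m + I)) f₁ d j) y) with hR
  have hcover : ∀ x < 2 ^ J, ((∀ d, d + i₀ ≤ J →
      Light (x / 2 ^ (J - d) * 2 ^ (J - d)) (2 ^ (J - d)) (lev m) f₁) ∧ ∃ d, d + i₀ ≤ J ∧
        2 ^ 101 / 2 ^ m < ‖locAvg J k0 κ f₂ (fun _ _ => f₁) d x‖) →
      (∃ i ∈ range I, ∃ d, d + k0 ≤ J ∧ 2 ^ 100 / 2 ^ (m + i + 1) < ‖Y i d x‖) ∨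
      ∃ d ∈ range (J + 1 - k0), True ∧ t < ‖R d x‖ := by
    rintro x hx ⟨hG, d, hd, h⟩
    by_contra hcon
    push Not at hcon
    obtain ⟨h1, h2⟩ := hcon
    have hz : births J (lev m) f₁ d (x / 2 ^ (J - d)) = 0 :=
      births_eq_zero J (lev_pos m) f₁ d _ fun k hk => by
        have h3 := div_node_add (J := J) (d := k) (i := d - k) (by omega) x
        rw [show k + (d - k) = d by omega] at h3
        rw [h3]; exact hG k (by omega)
    have h3 : locAvg J k0 κ f₂ (fun _ _ => f₁) d x =
        locAvg J k0 κ f₂ (fun d j y => f₁ y - synth (births J (lev m) f₁ d j) y) d x := by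
      simp only [locAvg, hz, synth_zero, sub_zero]
    rw [h3, locAvg_telescope m I] at h
    have h4 : ‖∑ i ∈ range I, Y i d x‖ ≤ t := by
      refine (norm_sum_le _ _).trans (le_trans (sum_le_sum fun i hi => h1 i hi d (by omega)) ?_)
      exact sum_geom_le m I (2 ^ 100) (by positivity)
    have h5 := h2 d (mem_range.2 (by omega)) trivial
    have h6 := norm_add_le (∑ i ∈ range I, Y i d x) (R d x)
    have h7 : (2 : ℝ) ^ 101 / 2 ^ m = t + t := by rw [ht]; ring
    rw [h7] at h
    exact absurd h (not_lt.2 (h6.trans (add_le_add h4 h5)))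
  refine (cnt_mono hcover).trans (cnt_or_le.trans ?_)
  have h1 : cnt J (fun x => ∃ i ∈ range I, ∃ d, d + k0 ≤ J ∧
      2 ^ 100 / 2 ^ (m + i + 1) < ‖Y i d x‖) ≤ 2 ^ J * t := by
    refine (cnt_exists_le _ _).trans ?_
    calc _ ≤ ∑ i ∈ range I, (2 : ℝ) ^ J * (2 ^ 100 / 2 ^ (m + i + 1)) := sum_le_sum fun i _ =>
          cnt_locAvg_le (W := fun d j => incr J f₁ (m + i) d j) hf₂ (by omega) (rfl) incr_mono
            incr_amp (fun d hd => incr_energy hf₁ hd) (fun d _ j _ => incr_light d j)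
            (by omega) hκ1 hκ2
      _ ≤ _ := by
          rw [← mul_sum]; gcongr; exact sum_geom_le m I (2 ^ 100) (by positivity)
  have h2 : cnt J (fun x => ∃ d ∈ range (J + 1 - k0), True ∧ t < ‖R d x‖) ≤ 2 ^ J * t := by
    refine (cnt_exists_le _ _).trans ?_
    calc _ ≤ ∑ d ∈ range (J + 1 - k0), (2 : ℝ) ^ J * (2 * lev (m + I) ^ 2 / t ^ 2) :=
          sum_le_sum fun d hd => by
            have hd := mem_range.1 hd
            have := cnt_node_le (J := J) (lam := lev (m + I))
              (u := fun d j y => f₁ y - synth (births J (lev (m + I)) f₁ d j) y) hf₂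
              (show d + k0 ≤ J by omega) hκ ht0 (fun _ => True)
              (fun j _ => births_light J (lev_pos _) f₁ d j)
            refine this.trans (le_of_eq ?_)
            simp [av]
      _ = (J + 1 - k0 : ℕ) * ((2 : ℝ) ^ J * (2 * lev (m + I) ^ 2 / t ^ 2)) := by simp
      _ ≤ (J + 1) * ((2 : ℝ) ^ J * (2 * lev (m + I) ^ 2 / t ^ 2)) := by
          gcongr; exact_mod_cast Nat.sub_le _ _
      _ = 2 ^ J * ((J + 1) * (2 * lev (m + I) ^ 2 / t ^ 2)) := by ring
      _ ≤ _ := by gcongr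
  have h7 : (2 : ℝ) ^ 101 / 2 ^ m = t + t := by rw [ht]; ring
  rw [h7]
  linarith

end incr

lemma norm_sum_Ico_sub_shift_le {u : ℕ → ℂ} (hu : ∀ y, ‖u y‖ ≤ 1) (b n h : ℕ) :
    ‖∑ y ∈ Ico b (b + n), u y - ∑ y ∈ Ico b (b + n), u (y + h)‖ ≤ 2 * h := by
  have h1 : ∑ y ∈ Ico b (b + n), u (y + h) = ∑ y ∈ Ico (b + h) (b + n + h), u y :=
    sum_Ico_add' u b (b + n) h
  have h2 : ∑ y ∈ Ico b (b + n), u y - ∑ y ∈ Ico (b + h) (b + n + h), u y =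
      ∑ y ∈ Ico b (b + h), u y - ∑ y ∈ Ico (b + n) (b + n + h), u y := by
    rw [sub_eq_sub_iff_add_eq_add, sum_Ico_consecutive _ (by omega) (by omega),
      sum_Ico_consecutive _ (by omega) (by omega)]
  have h3 : ∀ a, ‖∑ y ∈ Ico a (a + h), u y‖ ≤ h := fun a => by
    refine (norm_sum_le_of_le _ fun y _ => hu y).trans ?_
    simp
  rw [h1, h2]
  refine (norm_sub_le _ _).trans ?_
  linarith [h3 b, h3 (b + n)]

/-- Van der Corput's inequality. -/
lemma norm_coef_le {φ : ℕ → ℝ} (hφ : ∀ y, |φ y| ≤ 1) (b : ℕ) {n H : ℕ} (hn : 0 < n) (hH : 0 < H)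
    (θ : ℝ) : ‖coef b n (fun y => (φ y : ℂ)) θ‖ ≤
      √((1 / (H : ℝ) ^ 2) * ∑ h ∈ range H, ∑ h' ∈ range H,
        |(1 / (n : ℝ)) * ∑ y ∈ Ico b (b + n), φ (y + h) * φ (y + h')|) + 2 * H / n := by
  have hn' : (0 : ℝ) < n := by exact_mod_cast hn
  have hH' : (0 : ℝ) < H := by exact_mod_cast hH
  set u : ℕ → ℂ := fun y => φ y * e (-(θ * y)) with hu
  have hu1 : ∀ y, ‖u y‖ ≤ 1 := fun y => by
    rw [hu]; simp only [norm_mul, norm_e, mul_one, Complex.norm_real]; exact hφ y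
  set U : ℕ → ℂ := fun y => ∑ h ∈ range H, u (y + h) with hU
  set V := (1 / (H : ℝ) ^ 2) * ∑ h ∈ range H, ∑ h' ∈ range H,
        |(1 / (n : ℝ)) * ∑ y ∈ Ico b (b + n), φ (y + h) * φ (y + h')| with hV
  have h1 : ‖(H : ℂ) * ∑ y ∈ Ico b (b + n), u y - ∑ y ∈ Ico b (b + n), U y‖ ≤ H * (2 * H) := by
    rw [hU, sum_comm, show (H : ℂ) * ∑ y ∈ Ico b (b + n), u y =
      ∑ h ∈ range H, ∑ y ∈ Ico b (b + n), u y by simp, ← sum_sub_distrib]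
    refine (norm_sum_le_of_le _ (f := fun h : ℕ => (∑ y ∈ Ico b (b + n), u y -
      ∑ y ∈ Ico b (b + n), u (y + h))) (n := fun _ => (2 * H : ℝ)) fun h hh => ?_).trans (by simp)
    refine (norm_sum_Ico_sub_shift_le hu1 b n h).trans ?_
    have := (mem_range.1 hh).le
    gcongr
  have h2 : ‖∑ y ∈ Ico b (b + n), U y‖ ^ 2 ≤ n * ∑ y ∈ Ico b (b + n), ‖U y‖ ^ 2 := by
    calc _ ≤ (∑ y ∈ Ico b (b + n), ‖U y‖) ^ 2 := by gcongr; exact norm_sum_le _ _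
      _ ≤ _ := by
        have := sq_sum_le_card_mul_sum_sq (s := Ico b (b + n)) (f := fun y => ‖U y‖)
        simpa using this
  have h3 : ∑ y ∈ Ico b (b + n), ‖U y‖ ^ 2 ≤ n * H ^ 2 * V := by
    have h4 : ((∑ y ∈ Ico b (b + n), ‖U y‖ ^ 2 : ℝ) : ℂ) =
        ∑ h ∈ range H, ∑ h' ∈ range H, e (θ * h' - θ * h) *
          ((∑ y ∈ Ico b (b + n), φ (y + h) * φ (y + h') : ℝ) : ℂ) := by
      push_cast
      simp_rw [mul_sum]
      simp_rw [sum_comm (s := range H) (t := Ico b (b + n))]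
      refine sum_congr rfl fun y _ => ?_
      rw [← Complex.mul_conj', hU]
      simp only
      rw [map_sum, sum_mul_sum]
      refine sum_congr rfl fun h _ => sum_congr rfl fun h' _ => ?_
      simp only [hu, map_mul, Complex.conj_ofReal, ← e_neg]
      rw [show θ * h' - θ * h = -(θ * (y + h : ℕ)) + - -(θ * (y + h' : ℕ)) by push_cast; ring,
        e_add]
      ring
    have h5 : ∑ y ∈ Ico b (b + n), ‖U y‖ ^ 2 = ‖((∑ y ∈ Ico b (b + n), ‖U y‖ ^ 2 : ℝ) : ℂ)‖ := by
      rw [Complex.norm_real, Real.norm_of_nonneg (by positivity)]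
    rw [h5, h4]
    calc _ ≤ ∑ h ∈ range H, ∑ h' ∈ range H, |∑ y ∈ Ico b (b + n), φ (y + h) * φ (y + h')| := by
          refine norm_sum_le_of_le _ fun h _ => norm_sum_le_of_le _ fun h' _ => ?_
          rw [norm_mul, norm_e, one_mul, Complex.norm_real, Real.norm_eq_abs]
      _ = _ := by
          rw [hV]
          simp_rw [abs_mul, abs_of_pos (show 0 < 1 / (n : ℝ) by positivity), ← mul_sum]
          field_simp
  have hV0 : 0 ≤ V := by positivity
  have h6 : ‖∑ y ∈ Ico b (b + n), U y‖ ≤ n * H * √V := by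
    refine abs_le_of_sq_le_sq' ?_ (by positivity) |>.2
    rw [mul_pow, Real.sq_sqrt hV0]
    calc _ ≤ _ := h2
      _ ≤ n * (n * H ^ 2 * V) := by gcongr
      _ = _ := by ring
  have h7 : H * ‖∑ y ∈ Ico b (b + n), u y‖ ≤ n * H * √V + H * (2 * H) := by
    calc _ = ‖(H : ℂ) * ∑ y ∈ Ico b (b + n), u y‖ := by rw [norm_mul, Complex.norm_natCast]
      _ ≤ ‖∑ y ∈ Ico b (b + n), U y‖ +
          ‖(H : ℂ) * ∑ y ∈ Ico b (b + n), u y - ∑ y ∈ Ico b (b + n), U y‖ := norm_le_insert' _ _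
      _ ≤ _ := add_le_add h6 h1
  rw [coef, norm_mul, norm_div, norm_one, Complex.norm_natCast, one_div, inv_mul_le_iff₀ hn']
  have h8 : H * ‖∑ y ∈ Ico b (b + n), u y‖ ≤ H * (n * (√V + 2 * H / n)) := by
    refine h7.trans (le_of_eq ?_)
    field_simp
  exact le_of_mul_le_mul_left h8 hH'

open Classical in
/-- The maximal inequality for a nonnegative dyadic martingale. -/
lemma mul_av_exceed_le {a : ℕ → ℕ → ℝ} (ha : ∀ d j, 0 ≤ a d j) {D : ℕ}
    (hm : ∀ d < D, ∀ j, a d j = (a (d + 1) (2 * j) + a (d + 1) (2 * j + 1)) / 2) {δ : ℝ} :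
    δ * av D (fun j => if ∃ d ≤ D, δ < a d (j / 2 ^ (D - d)) then 1 else 0) ≤ av D (a D) := by
  suffices h : ∀ D' ≤ D,
      δ * av D' (fun j => if ∃ d ≤ D', δ < a d (j / 2 ^ (D' - d)) then 1 else 0) ≤
      av D' (fun j => a D' j * if ∃ d ≤ D', δ < a d (j / 2 ^ (D' - d)) then 1 else 0) by
    refine (h D le_rfl).trans (av_mono fun j => ?_)
    split_ifs
    · simp
    · simpa using ha D j
  intro D'
  induction D' with
  | zero =>
    intro _
    rw [← av_mul_left]
    refine av_mono fun j => ?_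
    split_ifs with h
    · obtain ⟨d, hd, h⟩ := h
      obtain rfl : d = 0 := by omega
      simpa using h.le
    · simp
  | succ D' ih =>
    intro hD'
    set E : ℕ → Prop := fun j => ∃ d ≤ D', δ < a d (j / 2 ^ (D' - d)) with hE
    have hiff : ∀ j, (∃ d ≤ D' + 1, δ < a d (j / 2 ^ (D' + 1 - d))) ↔
        E (j / 2) ∨ δ < a (D' + 1) j := by
      intro j
      have hdiv : ∀ d ≤ D', j / 2 / 2 ^ (D' - d) = j / 2 ^ (D' + 1 - d) := fun d hd => by
        rw [Nat.div_div_eq_div_mul, ← pow_succ']; congr 2; omega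
      constructor
      · rintro ⟨d, hd, h⟩
        rcases Nat.lt_or_ge D' d with h1 | h1
        · obtain rfl : d = D' + 1 := by omega
          right; simpa using h
        · left; exact ⟨d, h1, by rwa [hdiv d h1]⟩
      · rintro (⟨d, hd, h⟩ | h)
        · exact ⟨d, by omega, by rwa [hdiv d hd] at h⟩
        · exact ⟨D' + 1, le_rfl, by simpa using h⟩
    simp_rw [hiff]
    have h1 : av (D' + 1) (fun j => a (D' + 1) j * if E (j / 2) then 1 else 0) =
        av D' (fun j => a D' j * if E j then 1 else 0) := by
      rw [av_succ]
      congr 1; ext j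
      rw [hm D' (by omega) j, show 2 * j / 2 = j by omega, show (2 * j + 1) / 2 = j by omega]
      ring
    have h2 : av (D' + 1) (fun j => if E (j / 2) then 1 else 0) =
        av D' (fun j => if E j then 1 else 0) := av_parent fun j => if E j then 1 else 0
    have h3 := ih (by omega)
    have h4 : av (D' + 1) (fun j => δ * (if E (j / 2) ∨ δ < a (D' + 1) j then 1 else 0) -
        δ * (if E (j / 2) then 1 else 0)) ≤
        av (D' + 1) (fun j => (a (D' + 1) j * if E (j / 2) ∨ δ < a (D' + 1) j then 1 else 0) -
          a (D' + 1) j * if E (j / 2) then 1 else 0) := by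
      refine av_mono fun j => ?_
      by_cases h5 : E (j / 2)
      · simp [h5]
      · by_cases h6 : δ < a (D' + 1) j
        · simp [h5, h6, h6.le]
        · simp [h5, h6]
    rw [av_sub, av_sub, av_mul_left, av_mul_left, h1, h2] at h4
    linarith

/-- Covering an interval by windows of length `w` inside it and two boundary pieces. -/
lemma norm_sum_Ico_le_of_windows {h : ℕ → ℂ} (hh : ∀ z, ‖h z‖ ≤ 1) {b w A B : ℕ} (hw : 0 < w)
    (hb : b ≤ A) (hAB : A ≤ B) {C : ℝ} (hC : 0 ≤ C)
    (hwin : ∀ κ, A ≤ b + κ * w → b + κ * w + w ≤ B →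
      ‖∑ z ∈ Ico (b + κ * w) (b + κ * w + w), h z‖ ≤ C) :
    ‖∑ z ∈ Ico A B, h z‖ ≤ ((B - A : ℕ) / w) * C + 2 * w := by
  have hbd : ∀ A' B', ‖∑ z ∈ Ico A' B', h z‖ ≤ (B' - A' : ℕ) := fun A' B' => by
    refine (norm_sum_le_of_le _ fun y _ => hh y).trans ?_
    simp
  have hw' : (0 : ℝ) < w := by exact_mod_cast hw
  obtain ⟨κ₀, hκ₀, hκ₀'⟩ : ∃ κ₀, A ≤ b + κ₀ * w ∧ b + κ₀ * w < A + w := by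
    refine ⟨(A - b + w - 1) / w, ?_, ?_⟩
    · have h1 := Nat.div_add_mod (A - b + w - 1) w
      have h2 := Nat.mod_lt (A - b + w - 1) hw
      rw [mul_comm] at h1
      omega
    · have h1 := Nat.div_mul_le_self (A - b + w - 1) w
      omega
  by_cases hlt : b + κ₀ * w ≤ B
  · set M := (B - (b + κ₀ * w)) / w with hM
    have h1 := Nat.div_add_mod (B - (b + κ₀ * w)) w
    have h2 := Nat.mod_lt (B - (b + κ₀ * w)) hw
    rw [mul_comm, ← hM] at h1
    have hsplit : ∑ z ∈ Ico A B, h z = ∑ z ∈ Ico A (b + κ₀ * w), h z +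
        ∑ z ∈ Ico (b + κ₀ * w) (b + κ₀ * w + M * w), h z +
        ∑ z ∈ Ico (b + κ₀ * w + M * w) B, h z := by
      rw [sum_Ico_consecutive _ (by omega) (by omega), sum_Ico_consecutive _ (by omega) (by omega)]
    have h3 : ‖∑ z ∈ Ico (b + κ₀ * w) (b + κ₀ * w + M * w), h z‖ ≤ M * C := by
      rw [sum_Ico_mul]
      refine (norm_sum_le_of_le _ (n := fun _ => C) fun c hc => ?_).trans (by simp)
      rw [show b + κ₀ * w + c * w = b + (κ₀ + c) * w by ring]
      have hc' := mem_range.1 hc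
      have h4 : (c + 1) * w ≤ M * w := Nat.mul_le_mul_right _ hc'
      refine hwin _ ?_ ?_
      · rw [add_mul]; omega
      · rw [add_mul]; rw [add_mul] at h4; omega
    have h5 : (M : ℝ) ≤ (B - A : ℕ) / w := by
      rw [le_div_iff₀ hw']
      have : M * w ≤ B - A := by omega
      exact_mod_cast this
    have h6 := hbd A (b + κ₀ * w)
    have h7 := hbd (b + κ₀ * w + M * w) B
    have h8 : ((b + κ₀ * w - A : ℕ) : ℝ) ≤ w := by exact_mod_cast (show _ ≤ w by omega)
    have h9 : ((B - (b + κ₀ * w + M * w) : ℕ) : ℝ) ≤ w := by exact_mod_cast (show _ ≤ w by omega)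
    have h10 : (M : ℝ) * C ≤ ((B - A : ℕ) / w) * C := by gcongr
    rw [hsplit]
    refine norm_add₃_le.trans ?_
    linarith
  · have h1 := hbd A B
    have h2 : ((B - A : ℕ) : ℝ) ≤ w := by exact_mod_cast (show _ ≤ w by omega)
    have h3 : 0 ≤ (((B - A : ℕ) : ℝ) / w) * C := by positivity
    linarith

/-- The node of `x` at depth `d` controls the averages along `x + t`, `x + 2 t` that stay in its
middle part. -/
lemma norm_sum_le_of_locAvg {J k0 d x N : ℕ} {f₁ f₂ : ℕ → ℂ} (hf₁ : ∀ z, ‖f₁ z‖ ≤ 1)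
    (hf₂ : ∀ z, ‖f₂ z‖ ≤ 1) (hd : d + k0 ≤ J) {c : ℝ} (hc : 0 ≤ c)
    (hloc : ∀ κ, 2 ^ k0 ≤ 16 * κ → 16 * κ + 16 ≤ 15 * 2 ^ k0 →
      ‖locAvg J k0 κ f₂ (fun _ _ => f₁) d x‖ ≤ c)
    (hlo : 2 ^ (J - d) ≤ 16 * (x % 2 ^ (J - d)))
    (hhi : 16 * (x % 2 ^ (J - d)) + 32 * N + 16 ≤ 15 * 2 ^ (J - d)) :
    ‖∑ t ∈ Icc 1 N, f₁ (x + t) * f₂ (x + 2 * t)‖ ≤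
      2 * N * 2 ^ k0 * c + 2 * 2 ^ (J - (d + k0)) := by
  set n := 2 ^ (J - d) with hn
  set w := 2 ^ (J - (d + k0)) with hw
  have hnw : n = 2 ^ k0 * w := by rw [hn, hw, ← pow_add]; congr 1; omega
  have hw0 : 0 < w := by positivity
  set b := x / n * n with hb
  have hx : x = b + x % n := by rw [hb, mul_comm]; exact (Nat.div_add_mod x n).symm
  set h : ℕ → ℂ := fun z => if z % 2 = x % 2 then f₁ ((x + z) / 2) * f₂ z else 0 with hh
  have hh1 : ∀ z, ‖h z‖ ≤ 1 := fun z => by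
    simp only [hh]
    split_ifs
    · rw [norm_mul]; exact mul_le_one₀ (hf₁ _) (norm_nonneg _) (hf₂ _)
    · simp
  have hsum : ∑ t ∈ Icc 1 N, f₁ (x + t) * f₂ (x + 2 * t) =
      ∑ z ∈ Ico (x + 1) (x + 2 * N + 1), h z := by
    clear hhi
    induction N with
    | zero => simp
    | succ N ih =>
      rw [sum_Icc_succ_top (by omega), ih, show x + 2 * (N + 1) + 1 = x + 2 * N + 1 + 1 + 1 by ring,
        sum_Ico_succ_top (show x + 1 ≤ x + 2 * N + 1 + 1 by omega),
        sum_Ico_succ_top (show x + 1 ≤ x + 2 * N + 1 by omega)]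
      have e1 : h (x + 2 * N + 1) = 0 := if_neg (by omega)
      have e2 : h (x + 2 * N + 1 + 1) = f₁ (x + (N + 1)) * f₂ (x + 2 * (N + 1)) := by
        simp only [hh]
        rw [if_pos (by omega), show (x + (x + 2 * N + 1 + 1)) / 2 = x + (N + 1) by omega]
        rfl
      rw [e1, e2, add_zero]
  have hwin : ∀ κ, x + 1 ≤ b + κ * w → b + κ * w + w ≤ x + 2 * N + 1 →
      ‖∑ z ∈ Ico (b + κ * w) (b + κ * w + w), h z‖ ≤ n * c := by
    intro κ h1 h2
    have h3 : 2 ^ k0 ≤ 16 * κ := by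
      by_contra hcon
      have : (16 * κ + 1) * w ≤ 2 ^ k0 * w := Nat.mul_le_mul_right _ (by omega)
      rw [← hnw] at this
      nlinarith
    have h4 : 16 * κ + 16 ≤ 15 * 2 ^ k0 := by
      by_contra hcon
      have : (15 * 2 ^ k0 + 1) * w ≤ (16 * κ + 16) * w := Nat.mul_le_mul_right _ (by omega)
      rw [add_mul, mul_assoc, ← hnw] at this
      nlinarith
    have h5 := hloc κ h3 h4
    have hn0 : (0 : ℝ) < n := by rw [hn]; positivity
    rw [locAvg, bil, norm_mul, norm_div, norm_one, Complex.norm_natCast, ← hn, one_div,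
      inv_mul_le_iff₀ hn0, sum_filter] at h5
    have h6 : window J k0 κ d (x / n) = Ico (b + κ * w) (b + κ * w + w) := by
      rw [window, ← hw, show (x / n * 2 ^ k0 + κ) * w = b + κ * w by rw [hb, hnw]; ring]
    rwa [h6] at h5
  have := norm_sum_Ico_le_of_windows hh1 hw0 (b := b) (A := x + 1) (B := x + 2 * N + 1)
    (by omega) (by omega) (C := n * c) (by positivity) hwin
  rw [hsum]
  refine this.trans (le_of_eq ?_)
  have hw' : (w : ℝ) ≠ 0 := by positivity
  have hwr : (w : ℝ) = 2 ^ (J - (d + k0)) := by rw [hw]; push_cast; rfl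
  rw [show x + 2 * N + 1 - (x + 1) = 2 * N by omega, hnw, ← hwr]
  push_cast
  field_simp

/-- Some averaging window of some node containing `x` carries a large local average. -/
def BadAt (J k0 i₀ : ℕ) (c : ℝ) (f₁ f₂ : ℕ → ℂ) (x : ℕ) : Prop :=
  ∃ κ ∈ range (2 ^ k0), (2 ^ k0 ≤ 16 * κ ∧ 16 * κ + 16 ≤ 15 * 2 ^ k0) ∧
    ∃ d, d + i₀ ≤ J ∧ c < ‖locAvg J k0 κ f₂ (fun _ _ => f₁) d x‖

lemma three_mul_mod_add_one {s n : ℕ} (hn : 0 < n) (h : n ∣ 3 * s + 1) :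
    3 * (s % n) + 1 = n ∨ 3 * (s % n) + 1 = 2 * n := by
  have h1 := Nat.mod_lt s hn
  have h2 : n ∣ 3 * (s % n) + 1 := by
    have h3 := Nat.div_add_mod s n
    have h4 : n ∣ n * (s / n) * 3 := ⟨s / n * 3, by ring⟩
    have h5 : 3 * s + 1 = n * (s / n) * 3 + (3 * (s % n) + 1) := by omega
    rw [h5] at h
    exact (Nat.dvd_add_right h4).1 h
  obtain ⟨k, hk⟩ := h2
  have h6 : k < 3 := by
    by_contra hcon
    have : n * 3 ≤ n * k := Nat.mul_le_mul_left _ (by omega)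
    omega
  interval_cases k <;> omega

/-- The average over the one-third translate of the dyadic grid or over the grid itself controls
the averages starting at `x`. -/
lemma norm_sum_le_of_not_badAt {J k0 i₀ s x N : ℕ} {f₁ f₂ : ℕ → ℂ} (hf₁ : ∀ z, ‖f₁ z‖ ≤ 1)
    (hf₂ : ∀ z, ‖f₂ z‖ ≤ 1) {c : ℝ} (hc : 0 ≤ c) (hi₀ : k0 ≤ i₀) (hs : 3 * s + 1 = 2 ^ J)
    (hsx : s ≤ x) (hN : 2 ^ i₀ ≤ N) (hNJ : 128 * N ≤ 2 ^ J)
    (h1 : ¬ BadAt J k0 i₀ c f₁ f₂ x)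
    (h2 : ¬ BadAt J k0 i₀ c (fun y => f₁ (y + s)) (fun y => f₂ (y + s)) (x - s)) :
    ‖∑ t ∈ Icc 1 N, f₁ (x + t) * f₂ (x + 2 * t)‖ ≤ N * (2 * 2 ^ k0 * c + 256 / 2 ^ k0) := by
  have hN0 : N ≠ 0 := by have := Nat.one_le_two_pow (n := i₀); omega
  set i := Nat.log 2 N + 7 with hi
  have hlog : i₀ ≤ Nat.log 2 N := (Nat.le_log_iff_pow_le (by norm_num) hN0).2 hN
  have hn1 : 2 ^ i ≤ 128 * N := by
    have := Nat.pow_log_le_self 2 hN0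
    rw [hi, pow_add]; omega
  have hn2 : 64 * N < 2 ^ i := by
    have := Nat.lt_pow_succ_log_self (b := 2) (by norm_num) N
    rw [hi, pow_add]; rw [pow_succ] at this; omega
  have hiJ : i ≤ J := (Nat.pow_le_pow_iff_right (by norm_num)).1 (hn1.trans hNJ)
  have hw : (2 : ℝ) * 2 ^ (i - k0) ≤ N * (256 / 2 ^ k0) := by
    have h3 : (2 : ℝ) ^ (i - k0) * 2 ^ k0 = 2 ^ i := by rw [← pow_add]; congr 1; omega
    have h4 : (2 : ℝ) ^ i ≤ 128 * N := by exact_mod_cast hn1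
    rw [← mul_div_assoc, le_div_iff₀ (by positivity)]
    linarith
  have hdvd : 2 ^ i ∣ 3 * s + 1 := hs ▸ pow_dvd_pow 2 hiJ
  have key : ∀ (g₁ g₂ : ℕ → ℂ) (x' : ℕ), (∀ z, ‖g₁ z‖ ≤ 1) → (∀ z, ‖g₂ z‖ ≤ 1) →
      ¬ BadAt J k0 i₀ c g₁ g₂ x' → 2 ^ i ≤ 16 * (x' % 2 ^ i) →
      16 * (x' % 2 ^ i) + 32 * N + 16 ≤ 15 * 2 ^ i →
      ‖∑ t ∈ Icc 1 N, g₁ (x' + t) * g₂ (x' + 2 * t)‖ ≤ N * (2 * 2 ^ k0 * c + 256 / 2 ^ k0) := by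
    intro g₁ g₂ x' hg₁ hg₂ hbad hlo hhi
    have hd : J - (J - i) = i := by omega
    have := norm_sum_le_of_locAvg (J := J) (k0 := k0) (d := J - i) (x := x') (N := N) hg₁ hg₂
      (by omega) hc (fun κ h3 h4 => by
        by_contra hcon
        refine hbad ⟨κ, mem_range.2 ?_, ⟨h3, h4⟩, J - i, by omega, not_le.1 hcon⟩
        omega) (by rwa [hd]) (by rwa [hd])
    refine this.trans ?_
    rw [show J - (J - i + k0) = i - k0 by omega]
    linarith
  have hn0 : 0 < 2 ^ i := by positivity
  by_cases hmid : 2 ^ i ≤ 16 * (x % 2 ^ i) ∧ 16 * (x % 2 ^ i) + 32 * N + 16 ≤ 15 * 2 ^ i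
  · exact key f₁ f₂ x hf₁ hf₂ h1 hmid.1 hmid.2
  have h3 := key (fun y => f₁ (y + s)) (fun y => f₂ (y + s)) (x - s) (fun z => hf₁ _)
    (fun z => hf₂ _) h2
  have h4 : x % 2 ^ i = ((x - s) % 2 ^ i + s % 2 ^ i) % 2 ^ i := by
    rw [← Nat.add_mod, Nat.sub_add_cancel hsx]
  have h5 := Nat.mod_lt (x - s) hn0
  have h6 := Nat.mod_lt s hn0
  have h7 := three_mul_mod_add_one hn0 hdvd
  have h8 : ∀ t, x - s + t + s = x + t := fun t => by omega
  simp only [h8] at h3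
  have h10 : 1 ≤ N := Nat.one_le_iff_ne_zero.2 hN0
  have h11 : x % 2 ^ i = (x - s) % 2 ^ i + s % 2 ^ i ∨
      x % 2 ^ i + 2 ^ i = (x - s) % 2 ^ i + s % 2 ^ i := by
    generalize (x - s) % 2 ^ i = a at *
    generalize s % 2 ^ i = b at *
    rcases lt_or_ge (a + b) (2 ^ i) with h9 | h9
    · left; rw [h4, Nat.mod_eq_of_lt h9]
    · right; rw [h4, Nat.mod_eq_sub_mod h9, Nat.mod_eq_of_lt (a := a + b - 2 ^ i) (by omega)]; omega
  have h12 := Nat.mod_lt x hn0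
  clear h4 key hw h1 h2 hdvd hs
  generalize (x - s) % 2 ^ i = a at *
  generalize s % 2 ^ i = b at *
  generalize x % 2 ^ i = r at *
  generalize 2 ^ i = n at *
  refine h3 ?_ ?_ <;> omega

/-- Mean deviation on `[z, z + L)` of the correlations of `φ` with lags below `H` from `γ`. -/
noncomputable def corrDev (H L : ℕ) (γ : ℕ → ℕ → ℝ) (φ : ℕ → ℝ) (z : ℕ) : ℝ :=
  (1 / (H : ℝ) ^ 2) * ∑ h ∈ range H, ∑ h' ∈ range H,
    |(1 / (L : ℝ)) * ∑ y ∈ range L, (φ (z + y + h) * φ (z + y + h') - γ h h')|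

lemma corrDev_nonneg {H L : ℕ} {γ : ℕ → ℕ → ℝ} {φ : ℕ → ℝ} {z : ℕ} : 0 ≤ corrDev H L γ φ z := by
  unfold corrDev; positivity

/-- Averages of `β` over the `2 ^ (D - d)` leaves below the node `(d, j)`. -/
noncomputable def nodeAv (D : ℕ) (β : ℕ → ℝ) (d j : ℕ) : ℝ :=
  av (D - d) (fun c => β (j * 2 ^ (D - d) + c))

lemma nodeAv_eq_half_add {D d : ℕ} (β : ℕ → ℝ) (hd : d < D) (j : ℕ) :
    nodeAv D β d j = (nodeAv D β (d + 1) (2 * j) + nodeAv D β (d + 1) (2 * j + 1)) / 2 := by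
  obtain ⟨k, rfl⟩ : ∃ k, D = d + 1 + k := ⟨D - (d + 1), by omega⟩
  have h1 : d + 1 + k - d = k + 1 := by omega
  have h2 : d + 1 + k - (d + 1) = k := by omega
  have h3 : ∀ c, j * (2 ^ k * 2) + c = 2 * j * 2 ^ k + c := fun c => by ring
  have h4 : ∀ c, 2 * j * 2 ^ k + (2 ^ k + c) = (2 * j + 1) * 2 ^ k + c := fun c => by ring
  simp only [nodeAv, h1, h2, av]
  rw [pow_succ, mul_two, sum_range_add, pow_succ, ← mul_two]
  simp only [h3, h4]
  field_simp

lemma corrDev_split {H i k : ℕ} (γ : ℕ → ℕ → ℝ) (φ : ℕ → ℝ) (b : ℕ) :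
    (1 / (H : ℝ) ^ 2) * ∑ h ∈ range H, ∑ h' ∈ range H,
      |(1 / ((2 ^ (i + k) : ℕ) : ℝ)) * ∑ y ∈ Ico b (b + 2 ^ (i + k)), φ (y + h) * φ (y + h')| ≤
    (1 / (H : ℝ) ^ 2) * ∑ h ∈ range H, ∑ h' ∈ range H, |γ h h'| +
      av k (fun c => corrDev H (2 ^ i) γ φ (b + c * 2 ^ i)) := by
  have h1 : av k (fun c => corrDev H (2 ^ i) γ φ (b + c * 2 ^ i)) =
      (1 / (H : ℝ) ^ 2) * ∑ h ∈ range H, ∑ h' ∈ range H, av k (fun c =>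
        |(1 / ((2 ^ i : ℕ) : ℝ)) * ∑ y ∈ range (2 ^ i),
          (φ (b + c * 2 ^ i + y + h) * φ (b + c * 2 ^ i + y + h') - γ h h')|) := by
    unfold corrDev
    rw [av_mul_left]
    congr 1
    simp only [av]
    rw [sum_comm, sum_div]
    refine sum_congr rfl fun h _ => ?_
    rw [sum_comm, sum_div]
  rw [h1, ← mul_add, ← sum_add_distrib]
  simp_rw [← sum_add_distrib]
  gcongr with h _ h' _
  have h2 : (1 / ((2 ^ (i + k) : ℕ) : ℝ)) * ∑ y ∈ Ico b (b + 2 ^ (i + k)), φ (y + h) * φ (y + h') =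
      γ h h' + av k (fun c => (1 / ((2 ^ i : ℕ) : ℝ)) * ∑ y ∈ range (2 ^ i),
          (φ (b + c * 2 ^ i + y + h) * φ (b + c * 2 ^ i + y + h') - γ h h')) := by
    have h3 : ∀ c, ∑ y ∈ Ico (b + c * 2 ^ i) (b + c * 2 ^ i + 2 ^ i), φ (y + h) * φ (y + h') =
      ∑ y ∈ range (2 ^ i), φ (b + c * 2 ^ i + y + h) * φ (b + c * 2 ^ i + y + h') := by
      intro c
      rw [sum_Ico_eq_sum_range]
      simp
    rw [show (2 : ℕ) ^ (i + k) = 2 ^ k * 2 ^ i by rw [pow_add, mul_comm], sum_Ico_mul]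
    simp_rw [h3]
    rw [av_mul_left, av]
    simp only [sum_sub_distrib, sum_const, card_range, nsmul_eq_mul]
    push_cast
    field_simp
    ring
  rw [h2]
  refine (abs_add_le _ _).trans ?_
  gcongr
  unfold av
  rw [abs_div, abs_of_pos (show (0 : ℝ) < 2 ^ k by positivity)]
  gcongr
  exact abs_sum_le_sum_abs _ _

/-- A node on which the correlations of `φ` are close to small numbers is light. -/
lemma light_of_nodeAv_le {J i₀ d H m : ℕ} {φ : ℕ → ℝ} (hφ : ∀ y, |φ y| ≤ 1) {γ : ℕ → ℕ → ℝ}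
    (hd : d + i₀ ≤ J) (hH : 0 < H) (hHi : 2 * H / 2 ^ i₀ ≤ lev m / 2)
    (hΓ : (1 / (H : ℝ) ^ 2) * ∑ h ∈ range H, ∑ h' ∈ range H, |γ h h'| ≤ lev m ^ 2 / 8) {j : ℕ}
    (hj : nodeAv (J - i₀) (fun c => corrDev H (2 ^ i₀) γ φ (c * 2 ^ i₀)) d j ≤ lev m ^ 2 / 8) :
    Light (j * 2 ^ (J - d)) (2 ^ (J - d)) (lev m) (fun y => (φ y : ℂ)) := by
  intro θ
  have hl := lev_pos (m := m)
  refine (norm_coef_le hφ (j * 2 ^ (J - d)) (n := 2 ^ (J - d)) (by positivity) hH θ).trans ?_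
  have hJd : J - d = i₀ + (J - i₀ - d) := by omega
  have h1 := corrDev_split (H := H) (i := i₀) (k := J - i₀ - d) γ φ (j * 2 ^ (J - d))
  rw [← hJd] at h1
  have h2 : av (J - i₀ - d) (fun c => corrDev H (2 ^ i₀) γ φ (j * 2 ^ (J - d) + c * 2 ^ i₀)) ≤
      lev m ^ 2 / 8 := by
    refine le_trans (le_of_eq ?_) hj
    unfold nodeAv
    have h3 : ∀ c, (j * 2 ^ (J - i₀ - d) + c) * 2 ^ i₀ = j * 2 ^ (J - d) + c * 2 ^ i₀ := by
      intro c
      rw [hJd, pow_add]; ring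
    simp only [h3]
  have h4 : (2 * H / ((2 ^ (J - d) : ℕ) : ℝ)) ≤ 2 * H / 2 ^ i₀ := by
    push_cast
    gcongr
    · norm_num
    · omega
  have h5 : √(lev m ^ 2 / 4) = lev m / 2 := by
    rw [show lev m ^ 2 / 4 = (lev m / 2) ^ 2 by ring, Real.sqrt_sq (by positivity)]
  have h6 := Real.sqrt_le_sqrt (h1.trans ((add_le_add hΓ h2).trans
    (show _ ≤ lev m ^ 2 / 4 by linarith)))
  refine (add_le_add h6 (h4.trans hHi)).trans ?_
  rw [h5]; linarith

lemma cnt_badAt_le {J i₀ k0 H m : ℕ} {φ : ℕ → ℝ} (hφ : ∀ y, |φ y| ≤ 1) {f₂ : ℕ → ℂ}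
    (hf₂ : ∀ y, ‖f₂ y‖ ≤ 1) {γ : ℕ → ℕ → ℝ} (hm : 1 ≤ m) (hi₀ : k0 ≤ i₀) (hk : k0 ≤ 16 * m)
    (hiJ : i₀ ≤ J) (hH : 0 < H) (hHi : 2 * H / 2 ^ i₀ ≤ lev m / 2)
    (hΓ : (1 / (H : ℝ) ^ 2) * ∑ h ∈ range H, ∑ h' ∈ range H, |γ h h'| ≤ lev m ^ 2 / 8) :
    cnt J (BadAt J k0 i₀ (2 ^ 101 / 2 ^ m) (fun y => (φ y : ℂ)) f₂) ≤
      2 ^ J * (2 ^ k0 * (2 ^ 101 / 2 ^ m)) + 2 ^ J * (8 / lev m ^ 2 *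
        av (J - i₀) (fun c => corrDev H (2 ^ i₀) γ φ (c * 2 ^ i₀))) := by
  classical
  have hf₁ : ∀ z, ‖(φ z : ℂ)‖ ≤ 1 := fun z => by rw [Complex.norm_real]; exact hφ z
  have hl := lev_pos (m := m)
  set D := J - i₀ with hD
  set β : ℕ → ℝ := fun c => corrDev H (2 ^ i₀) γ φ (c * 2 ^ i₀) with hβ
  set δ := lev m ^ 2 / 8 with hδ
  set S := (range (2 ^ k0)).filter (fun κ => 2 ^ k0 ≤ 16 * κ ∧ 16 * κ + 16 ≤ 15 * 2 ^ k0) with hS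
  have h1 : cnt J (BadAt J k0 i₀ (2 ^ 101 / 2 ^ m) (fun y => (φ y : ℂ)) f₂) ≤
      cnt J (fun x => (∃ κ ∈ S, (∀ d, d + i₀ ≤ J → Light (x / 2 ^ (J - d) * 2 ^ (J - d))
        (2 ^ (J - d)) (lev m) (fun y => (φ y : ℂ))) ∧ ∃ d, d + i₀ ≤ J ∧
        2 ^ 101 / 2 ^ m < ‖locAvg J k0 κ f₂ (fun _ _ => (fun y => (φ y : ℂ))) d x‖) ∨
        ∃ d ≤ D, δ < nodeAv D β d (x / 2 ^ (J - d))) := by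
    refine cnt_mono fun x _ hx => ?_
    by_cases hlight : ∀ d, d + i₀ ≤ J → Light (x / 2 ^ (J - d) * 2 ^ (J - d))
        (2 ^ (J - d)) (lev m) (fun y => (φ y : ℂ))
    · obtain ⟨κ, hκ, hκ', hx⟩ := hx
      exact Or.inl ⟨κ, mem_filter.2 ⟨hκ, hκ'⟩, hlight, hx⟩
    · right
      push Not at hlight
      obtain ⟨d, hd, hnl⟩ := hlight
      refine ⟨d, by omega, ?_⟩
      by_contra hcon
      exact hnl (light_of_nodeAv_le hφ hd hH hHi hΓ (not_lt.1 hcon))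
  have h2 : cnt J (fun x => ∃ κ ∈ S, (∀ d, d + i₀ ≤ J → Light (x / 2 ^ (J - d) * 2 ^ (J - d))
        (2 ^ (J - d)) (lev m) (fun y => (φ y : ℂ))) ∧ ∃ d, d + i₀ ≤ J ∧
        2 ^ 101 / 2 ^ m < ‖locAvg J k0 κ f₂ (fun _ _ => (fun y => (φ y : ℂ))) d x‖) ≤
      2 ^ J * (2 ^ k0 * (2 ^ 101 / 2 ^ m)) := by
    refine (cnt_exists_le S _).trans ?_
    refine (sum_le_sum (g := fun _ => (2 : ℝ) ^ J * (2 ^ 101 / 2 ^ m)) fun κ hκ => ?_).trans ?_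
    · have hκ' := (mem_filter.1 hκ).2
      exact cnt_locAvg_light_le hf₁ hf₂ hm hi₀ hk hκ'.1 hκ'.2
    · have h3 : (S.card : ℝ) ≤ 2 ^ k0 := by
        have : S.card ≤ 2 ^ k0 := (card_filter_le _ _).trans (by simp)
        exact_mod_cast this
      rw [sum_const, nsmul_eq_mul]
      calc (S.card : ℝ) * (2 ^ J * (2 ^ 101 / 2 ^ m))
          ≤ 2 ^ k0 * (2 ^ J * (2 ^ 101 / 2 ^ m)) := by gcongr
        _ = _ := by ring
  have h4 : cnt J (fun x => ∃ d ≤ D, δ < nodeAv D β d (x / 2 ^ (J - d))) ≤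
      2 ^ J * (8 / lev m ^ 2 * av D β) := by
    have h5 : cnt J (fun x => ∃ d ≤ D, δ < nodeAv D β d (x / 2 ^ (J - d))) =
        2 ^ J * av D (fun j => if ∃ d ≤ D, δ < nodeAv D β d (j / 2 ^ (D - d)) then 1 else 0) := by
      rw [← sum_range_node_const (J := J) (by omega), cnt]
      refine sum_congr rfl fun x _ => ?_
      have h6 : ∀ d ≤ D, x / 2 ^ (J - D) / 2 ^ (D - d) = x / 2 ^ (J - d) := fun d hd => by
        rw [Nat.div_div_eq_div_mul, ← pow_add, show J - D + (D - d) = J - d by omega]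
      have h7 : (∃ d ≤ D, δ < nodeAv D β d (x / 2 ^ (J - d))) ↔
          ∃ d ≤ D, δ < nodeAv D β d (x / 2 ^ (J - D) / 2 ^ (D - d)) := by
        refine exists_congr fun d => and_congr_right fun hd => ?_
        rw [h6 d hd]
      simp only [h7]
    have h8 := mul_av_exceed_le (a := nodeAv D β)
      (fun d j => av_nonneg fun c => corrDev_nonneg) (D := D)
      (fun d hd j => nodeAv_eq_half_add β hd j) (δ := δ)
    have h9 : nodeAv D β D = β := by
      ext j
      simp [nodeAv, av]
    rw [h9] at h8
    rw [h5]
    gcongr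
    rw [div_mul_eq_mul_div, le_div_iff₀ (by positivity)]
    have h10 : lev m ^ 2 = 8 * δ := by rw [hδ]; ring
    rw [h10]
    convert (mul_le_mul_of_nonneg_left h8 (show (0 : ℝ) ≤ 8 by norm_num)) using 1
    rw [mul_comm, mul_assoc]
  exact h1.trans (cnt_or_le.trans (add_le_add h2 h4))

lemma sum_dist_le {c : ℕ → ℝ} (hc : ∀ k, 0 ≤ c k) {h H : ℕ} (hh : h < H) :
    ∑ h' ∈ range H, c (h - h' + (h' - h)) ≤ 2 * ∑ k ∈ range H, c k := by
  rw [range_eq_Ico, ← sum_Ico_consecutive _ (Nat.zero_le h) hh.le, two_mul]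
  refine add_le_add ?_ ?_
  · have h1 : ∑ i ∈ Ico 0 h, c (h - i + (i - h)) = ∑ k ∈ range h, c (k + 1) := by
      rw [← range_eq_Ico, ← sum_range_reflect]
      refine sum_congr rfl fun i hi => ?_
      have := mem_range.1 hi
      congr 1; omega
    rw [h1, ← range_eq_Ico]
    refine le_trans ?_ (sum_le_sum_of_subset_of_nonneg (range_subset_range.2 hh) fun i _ _ => hc i)
    rw [sum_range_succ']
    linarith [hc 0]
  · rw [sum_Ico_eq_sum_range, ← range_eq_Ico]
    refine le_trans (le_of_eq ?_) (sum_le_sum_of_subset_of_nonneg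
      (range_subset_range.2 (Nat.sub_le H h)) fun i _ _ => hc i)
    refine sum_congr rfl fun i _ => ?_
    congr 1; omega

section dynamics
variable {X : Type*} [MeasurableSpace X] {μ : Measure X} [IsProbabilityMeasure μ] {T : X → X}
  {f : X → ℝ}

omit [IsProbabilityMeasure μ] in
lemma integral_comp_iterate (hT : MeasurePreserving T μ μ) {g : X → ℝ} (hg : Measurable g) (n : ℕ) :
    ∫ x, g (T^[n] x) ∂μ = ∫ x, g x ∂μ := by
  have h := hT.iterate n
  conv_rhs => rw [← h.map_eq]
  exact (integral_map h.measurable.aemeasurable hg.aestronglyMeasurable).symm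

omit [IsProbabilityMeasure μ] in
lemma integral_corr (hT : MeasurePreserving T μ μ) (hf : Measurable f) (h h' : ℕ) :
    ∫ x, f (T^[h] x) * f (T^[h'] x) ∂μ = ∫ x, f x * f (T^[h - h' + (h' - h)] x) ∂μ := by
  have hm : ∀ k, Measurable (fun x => f x * f (T^[k] x)) := fun k =>
    hf.mul (hf.comp (hT.measurable.iterate k))
  rcases le_total h h' with hle | hle
  · have h1 := integral_comp_iterate hT (hm (h' - h)) h
    simp only [← Function.iterate_add_apply, Nat.sub_add_cancel hle] at h1
    rw [h1, Nat.sub_eq_zero_of_le hle, zero_add]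
  · have h1 := integral_comp_iterate hT (hm (h - h')) h'
    simp only [← Function.iterate_add_apply, Nat.sub_add_cancel hle] at h1
    rw [Nat.sub_eq_zero_of_le hle, add_zero, ← h1]
    simp_rw [mul_comm]

lemma abs_integral_le_one {g : X → ℝ} (hg : ∀ x, |g x| ≤ 1) : |∫ x, g x ∂μ| ≤ 1 := by
  have := norm_integral_le_of_norm_le_const (μ := μ) (f := g) (C := 1) (ae_of_all _ hg)
  simpa using this

/-- Vanishing of the seminorm makes the doubly averaged correlations small. -/
lemma exists_sum_corr_le (hT : MeasurePreserving T μ μ) (hf : Measurable f) (hf1 : ∀ x, |f x| ≤ 1)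
    (hperp : hkSeminorm2pow4 μ T f = 0) {δ : ℝ} (hδ : 0 < δ) : ∃ H : ℕ, 0 < H ∧
      (1 / (H : ℝ) ^ 2) * ∑ h ∈ range H, ∑ h' ∈ range H,
        |∫ x, f (T^[h] x) * f (T^[h'] x) ∂μ| ≤ δ := by
  set c : ℕ → ℝ := fun k => |∫ x, f x * f (T^[k] x) ∂μ| with hc
  have hc0 : ∀ k, 0 ≤ c k := fun k => abs_nonneg _
  have hc1 : ∀ k, c k ≤ 1 := fun k => abs_integral_le_one fun x => by
    rw [abs_mul]; exact mul_le_one₀ (hf1 _) (abs_nonneg _) (hf1 _)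
  have hev : ∀ᶠ H : ℕ in atTop, (1 / (H : ℝ)) * ∑ h ∈ Icc 1 H, c h ^ 2 < (δ / 4) ^ 2 := by
    refine eventually_lt_of_limsup_lt (b := (δ / 4) ^ 2) ?_ ?_
    · have : hkSeminorm2pow4 μ T f < (δ / 4) ^ 2 := by rw [hperp]; positivity
      exact this
    · refine isBoundedUnder_of ⟨1, fun H => ?_⟩
      have h1 : ∑ h ∈ Icc 1 H, c h ^ 2 ≤ H := by
        refine (sum_le_sum (g := fun _ => (1 : ℝ)) fun h _ =>
          pow_le_one₀ (hc0 h) (hc1 h)).trans (by simp)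
      rw [one_div, ← div_eq_inv_mul]
      exact div_le_one_of_le₀ h1 (by positivity)
  obtain ⟨n₀, hn₀⟩ := exists_nat_gt (4 / δ)
  obtain ⟨H, hH, hHn, hH1⟩ :=
    (hev.and ((eventually_ge_atTop n₀).and (eventually_ge_atTop 1))).exists
  have hH0 : (0 : ℝ) < H := by exact_mod_cast hH1
  refine ⟨H, hH1, ?_⟩
  have h2 : ∑ h ∈ range H, ∑ h' ∈ range H, |∫ x, f (T^[h] x) * f (T^[h'] x) ∂μ| ≤
      H * (2 * ∑ k ∈ range H, c k) := by
    refine (sum_le_sum (g := fun _ => 2 * ∑ k ∈ range H, c k) fun h hh => ?_).trans (by simp)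
    refine le_trans (le_of_eq ?_) (sum_dist_le hc0 (mem_range.1 hh))
    exact sum_congr rfl fun h' _ => by rw [integral_corr hT hf]
  have h3 : ∑ k ∈ range H, c k ≤ 1 + ∑ k ∈ Icc 1 H, c k := by
    obtain ⟨M, rfl⟩ : ∃ M, H = M + 1 := ⟨H - 1, by omega⟩
    rw [sum_range_succ', add_comm]
    refine add_le_add (hc1 0) ?_
    rw [range_eq_Ico, sum_Ico_add' c 0 M 1]
    refine sum_le_sum_of_subset_of_nonneg (fun k hk => ?_) fun i _ _ => hc0 i
    simp only [mem_Ico, mem_Icc] at hk ⊢; omega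
  have h4 : (∑ k ∈ Icc 1 H, c k) ^ 2 ≤ (H * (δ / 4)) ^ 2 := by
    have h5 := sq_sum_le_card_mul_sum_sq (s := Icc 1 H) (f := c)
    have h6 : ∑ h ∈ Icc 1 H, c h ^ 2 ≤ H * (δ / 4) ^ 2 := by
      rw [one_div, inv_mul_lt_iff₀ hH0] at hH; exact hH.le
    simp only [Nat.card_Icc, Nat.add_sub_cancel] at h5
    calc _ ≤ _ := h5
      _ ≤ H * (H * (δ / 4) ^ 2) := by gcongr
      _ = _ := by ring
  have h7 : ∑ k ∈ Icc 1 H, c k ≤ H * (δ / 4) := (abs_le_of_sq_le_sq' h4 (by positivity)).2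
  have h8 : 1 ≤ H * (δ / 4) := by
    have h9 : 4 / δ < H := hn₀.trans_le (by exact_mod_cast hHn)
    rw [div_lt_iff₀ hδ] at h9; linarith
  rw [one_div, inv_mul_le_iff₀ (by positivity)]
  calc _ ≤ _ := h2
    _ ≤ H * (2 * (H * (δ / 4) + H * (δ / 4))) := by gcongr; linarith
    _ = _ := by ring

lemma integral_abs_le_norm (w : Lp ℝ 2 μ) : ∫ x, |w x| ∂μ ≤ ‖w‖ := by
  have h1 : ∫ x, |w x| ∂μ = (eLpNorm w 1 μ).toReal := by
    rw [eLpNorm_one_eq_lintegral_enorm,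
      ← integral_norm_eq_lintegral_enorm (Lp.aestronglyMeasurable w)]
    rfl
  rw [h1, Lp.norm_def]
  exact ENNReal.toReal_mono (Lp.eLpNorm_ne_top w)
    (eLpNorm_le_eLpNorm_of_exponent_le (by norm_num) (Lp.aestronglyMeasurable w))

/-- The mean ergodic theorem in `L¹` for bounded functions. -/
lemma tendsto_integral_abs_avg_sub (hT : Ergodic T μ) {g : X → ℝ} (hg : Measurable g)
    (hg1 : ∀ x, |g x| ≤ 1) :
    Tendsto (fun n : ℕ => ∫ x, |(1 / (n : ℝ)) * ∑ y ∈ range n, (g (T^[y] x) - ∫ z, g z ∂μ)| ∂μ)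
      atTop (nhds 0) := by
  have hgL : MemLp g 2 μ := MemLp.of_bound hg.aestronglyMeasurable 1 (ae_of_all _ hg1)
  set u : Lp ℝ 2 μ := hgL.toLp g with hu
  set U : Lp ℝ 2 μ →L[ℝ] Lp ℝ 2 μ :=
    (Lp.compMeasurePreservingₗᵢ ℝ T hT.toMeasurePreserving).toContinuousLinearMap with hU
  obtain ⟨v, hv, hmean⟩ : ∃ v, U v = v ∧
      Tendsto (fun n => birkhoffAverage ℝ U _root_.id n u) atTop (nhds v) :=
    have h := ContinuousLinearMap.tendsto_birkhoffAverage_orthogonalProjection U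
      (LinearIsometry.norm_toContinuousLinearMap_le _) u
    ⟨_, LinearMap.mem_eqLocus.1 (Submodule.coe_mem _), h⟩
  have hUw : ∀ w : Lp ℝ 2 μ, U w =ᵐ[μ] w ∘ T := fun w =>
    Lp.coeFn_compMeasurePreserving w hT.toMeasurePreserving
  obtain ⟨C, hC⟩ := hT.ae_eq_const_of_ae_eq_comp_ae (Lp.aestronglyMeasurable v)
    ((hUw v).symm.trans (by rw [hv]))
  have hiter : ∀ k, (U^[k] u : Lp ℝ 2 μ) =ᵐ[μ] fun x => g (T^[k] x) := by
    intro k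
    induction k with
    | zero => exact hgL.coeFn_toLp
    | succ k ih =>
      rw [Function.iterate_succ_apply']
      refine (hUw _).trans ?_
      exact hT.quasiMeasurePreserving.ae_eq_comp ih
  set a : ℕ → X → ℝ := fun n x => (1 / (n : ℝ)) * ∑ y ∈ range n, g (T^[y] x) with ha
  have hbirk : ∀ n, (birkhoffAverage ℝ U _root_.id n u - v : Lp ℝ 2 μ) =ᵐ[μ]
      fun x => a n x - C := by
    intro n
    have h1 := Lp.coeFn_finsetSum (range n) (fun k => (U^[k] u : Lp ℝ 2 μ))
    have h2 := Lp.coeFn_smul ((n : ℝ)⁻¹) (∑ k ∈ range n, (U^[k] u : Lp ℝ 2 μ))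
    have h3 := Lp.coeFn_sub (birkhoffAverage ℝ U _root_.id n u) v
    have h4 : ∀ᵐ x ∂μ, ∀ k, (U^[k] u : Lp ℝ 2 μ) x = g (T^[k] x) := ae_all_iff.2 hiter
    filter_upwards [h1, h2, h3, h4, hC] with x h1 h2 h3 h4 hC
    rw [h3, Pi.sub_apply, hC]
    have h5 : birkhoffAverage ℝ U _root_.id n u = (n : ℝ)⁻¹ • ∑ k ∈ range n, U^[k] u := rfl
    rw [h5, h2, Pi.smul_apply, h1, Finset.sum_apply]
    simp only [h4, ha, smul_eq_mul, one_div, Function.const_apply]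
  have hlim : Tendsto (fun n => ∫ x, |a n x - C| ∂μ) atTop (nhds 0) := by
    have h1 : Tendsto (fun n => ‖birkhoffAverage ℝ U _root_.id n u - v‖) atTop (nhds 0) :=
      tendsto_iff_norm_sub_tendsto_zero.1 hmean
    refine squeeze_zero (fun n => integral_nonneg fun x => abs_nonneg _) (fun n => ?_) h1
    refine le_trans (le_of_eq ?_) (integral_abs_le_norm _)
    refine integral_congr_ae ?_
    filter_upwards [hbirk n] with x hx
    rw [hx]
  have hint : ∀ y, Integrable (fun x => g (T^[y] x)) μ := fun y =>
    Integrable.of_bound (hg.comp (hT.measurable.iterate y)).aestronglyMeasurable 1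
      (ae_of_all _ fun x => hg1 _)
  have hCeq : C = ∫ z, g z ∂μ := by
    have h1 : Tendsto (fun n => ∫ x, (a n x - C) ∂μ) atTop (nhds 0) :=
      squeeze_zero_norm (fun n => norm_integral_le_integral_norm _) hlim
    have h2 : ∀ᶠ n : ℕ in atTop, ∫ x, (a n x - C) ∂μ = ∫ z, g z ∂μ - C := by
      filter_upwards [eventually_ge_atTop 1] with n hn
      have hn' : (n : ℝ) ≠ 0 := by positivity
      rw [integral_sub ((integrable_finsetSum _ fun y _ => hint y).const_mul _)
        (integrable_const _), integral_const_mul, integral_finsetSum _ fun y _ => hint y]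
      simp only [integral_comp_iterate hT.toMeasurePreserving hg]
      simp [hn']
    have h3 := tendsto_nhds_unique (h1.congr' h2) tendsto_const_nhds
    linarith
  refine hlim.congr' ?_
  filter_upwards [eventually_ge_atTop 1] with n hn
  have hn' : (n : ℝ) ≠ 0 := by positivity
  refine integral_congr_ae (ae_of_all _ fun x => ?_)
  simp only [ha, hCeq, sum_sub_distrib, sum_const, card_range, nsmul_eq_mul, mul_sub]
  congr 2
  field_simp

lemma tendsto_integral_corrDev (hT : Ergodic T μ) (hf : Measurable f) (hf1 : ∀ x, |f x| ≤ 1)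
    (H : ℕ) : Tendsto (fun L : ℕ => ∫ x, corrDev H L
      (fun h h' => ∫ z, f (T^[h] z) * f (T^[h'] z) ∂μ) (fun y => f (T^[y] x)) 0 ∂μ)
      atTop (nhds 0) := by
  have hm : ∀ k, Measurable (fun x => f (T^[k] x)) := fun k => hf.comp (hT.measurable.iterate k)
  have hm2 : ∀ h h', Measurable (fun x => f (T^[h] x) * f (T^[h'] x)) := fun h h' =>
    (hm h).mul (hm h')
  have hb : ∀ h h' x, |f (T^[h] x) * f (T^[h'] x)| ≤ 1 := fun h h' x => by
    rw [abs_mul]; exact mul_le_one₀ (hf1 _) (abs_nonneg _) (hf1 _)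
  have h1 : Tendsto (fun L : ℕ => (1 / (H : ℝ) ^ 2) * ∑ h ∈ range H, ∑ h' ∈ range H,
      ∫ x, |(1 / (L : ℝ)) * ∑ y ∈ range L, (f (T^[h] (T^[y] x)) * f (T^[h'] (T^[y] x)) -
        ∫ z, f (T^[h] z) * f (T^[h'] z) ∂μ)| ∂μ) atTop (nhds 0) := by
    have h2 := (tendsto_finsetSum (range H) fun h _ => tendsto_finsetSum (range H) fun h' _ =>
      tendsto_integral_abs_avg_sub hT (hm2 h h') (hb h h')).const_mul (1 / (H : ℝ) ^ 2)
    simpa using h2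
  refine h1.congr fun L => ?_
  have hi : ∀ h h', Integrable (fun x => |(1 / (L : ℝ)) * ∑ y ∈ range L,
      (f (T^[h] (T^[y] x)) * f (T^[h'] (T^[y] x)) -
        ∫ z, f (T^[h] z) * f (T^[h'] z) ∂μ)|) μ := fun h h' => by
    refine Integrable.abs (Integrable.const_mul (integrable_finsetSum _ fun y _ => ?_) _)
    refine Integrable.sub ?_ (integrable_const _)
    exact Integrable.of_bound ((hm2 h h').comp (hT.measurable.iterate y)).aestronglyMeasurable 1
      (ae_of_all _ fun x => hb _ _ _)
  have h3 : ∀ x, corrDev H L (fun h h' => ∫ z, f (T^[h] z) * f (T^[h'] z) ∂μ)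
      (fun y => f (T^[y] x)) 0 = (1 / (H : ℝ) ^ 2) * ∑ h ∈ range H, ∑ h' ∈ range H,
      |(1 / (L : ℝ)) * ∑ y ∈ range L, (f (T^[h] (T^[y] x)) * f (T^[h'] (T^[y] x)) -
        ∫ z, f (T^[h] z) * f (T^[h'] z) ∂μ)| := by
    intro x
    have h4 : ∀ h y, T^[h] (T^[y] x) = T^[0 + y + h] x := fun h y => by
      rw [← Function.iterate_add_apply]; congr 1; omega
    simp only [corrDev, h4]
  simp only [h3]
  rw [integral_const_mul,
    integral_finsetSum _ fun h _ => integrable_finsetSum _ fun h' _ => hi h h']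
  congr 1
  refine sum_congr rfl fun h _ => ?_
  rw [integral_finsetSum _ fun h' _ => hi h h']

end dynamics

section assembly
variable {X : Type*} [MeasurableSpace X] {μ : Measure X} [IsProbabilityMeasure μ] {T : X → X}
  {f F₁ F₂ : X → ℝ}

omit [MeasurableSpace X] in
lemma corrDev_shift (H L : ℕ) (γ : ℕ → ℕ → ℝ) (z : ℕ) (x : X) :
    corrDev H L γ (fun y => f (T^[y] x)) z = corrDev H L γ (fun y => f (T^[y] (T^[z] x))) 0 := by
  have h : ∀ y k, T^[0 + y + k] (T^[z] x) = T^[z + y + k] x := fun y k => by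
    rw [← Function.iterate_add_apply]; congr 1; omega
  simp only [corrDev, h]

lemma measurable_corrDev (hT : Measurable T) (hf : Measurable f) (H L : ℕ) (γ : ℕ → ℕ → ℝ)
    (z : ℕ) : Measurable (fun x => corrDev H L γ (fun y => f (T^[y] x)) z) := by
  have hm : ∀ k, Measurable (fun x => f (T^[k] x)) := fun k => hf.comp (hT.iterate k)
  unfold corrDev
  refine Measurable.const_mul (Finset.measurable_fun_sum _ fun h _ =>
    Finset.measurable_fun_sum _ fun h' _ => ?_) _
  have h1 : Measurable (fun x => (1 / (L : ℝ)) * ∑ y ∈ range L,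
      (f (T^[z + y + h] x) * f (T^[z + y + h'] x) - γ h h')) :=
    Measurable.const_mul (Finset.measurable_fun_sum _ fun y _ =>
      ((hm _).mul (hm _)).sub_const _) _
  exact h1.abs

lemma integrable_corrDev (hT : Measurable T) (hf : Measurable f) (hf1 : ∀ x, |f x| ≤ 1) (H L : ℕ)
    (γ : ℕ → ℕ → ℝ) (z : ℕ) :
    Integrable (fun x => corrDev H L γ (fun y => f (T^[y] x)) z) μ := by
  have hm : ∀ k, Measurable (fun x => f (T^[k] x)) := fun k => hf.comp (hT.iterate k)
  unfold corrDev
  refine Integrable.const_mul (integrable_finsetSum _ fun h _ =>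
    integrable_finsetSum _ fun h' _ => Integrable.abs (Integrable.const_mul
    (integrable_finsetSum _ fun y _ => Integrable.sub ?_ (integrable_const _)) _)) _
  refine Integrable.of_bound ((hm _).mul (hm _)).aestronglyMeasurable 1 (ae_of_all _ fun x => ?_)
  rw [Real.norm_eq_abs, abs_mul]
  exact mul_le_one₀ (hf1 _) (abs_nonneg _) (hf1 _)

lemma integral_av_corrDev (hT : MeasurePreserving T μ μ) (hf : Measurable f)
    (hf1 : ∀ x, |f x| ≤ 1) (H L : ℕ) (γ : ℕ → ℕ → ℝ) (D : ℕ) (p : ℕ → ℕ) :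
    ∫ x, av D (fun c => corrDev H L γ (fun y => f (T^[y] x)) (p c)) ∂μ =
      ∫ x, corrDev H L γ (fun y => f (T^[y] x)) 0 ∂μ := by
  have h1 : ∀ z, ∫ x, corrDev H L γ (fun y => f (T^[y] x)) z ∂μ =
      ∫ x, corrDev H L γ (fun y => f (T^[y] x)) 0 ∂μ := fun z => by
    rw [← integral_comp_iterate hT (measurable_corrDev hT.measurable hf H L γ 0) z]
    exact integral_congr_ae (ae_of_all _ fun x => corrDev_shift H L γ z x)
  unfold av
  rw [integral_div, integral_finsetSum _ fun c _ =>
    integrable_corrDev hT.measurable hf hf1 H L γ _]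
  simp [h1]

lemma measurableSet_badAt (hT : Measurable T) (hF₁ : Measurable F₁) (hF₂ : Measurable F₂)
    (J k0 i₀ : ℕ) (c : ℝ) (x : ℕ) :
    MeasurableSet {ω | BadAt J k0 i₀ c (fun y => (F₁ (T^[y] ω) : ℂ))
      (fun y => (F₂ (T^[y] ω) : ℂ)) x} := by
  have hm₁ : ∀ k, Measurable (fun x => (F₁ (T^[k] x) : ℂ)) := fun k =>
    Complex.measurable_ofReal.comp (hF₁.comp (hT.iterate k))
  have hm₂ : ∀ k, Measurable (fun x => (F₂ (T^[k] x) : ℂ)) := fun k =>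
    Complex.measurable_ofReal.comp (hF₂.comp (hT.iterate k))
  have h1 : ∀ κ d, Measurable (fun ω => ‖locAvg J k0 κ (fun y => (F₂ (T^[y] ω) : ℂ))
      (fun _ _ => (fun y => (F₁ (T^[y] ω) : ℂ))) d x‖) := fun κ d => by
    unfold locAvg bil
    exact (Measurable.const_mul (Finset.measurable_fun_sum _ fun y _ =>
      (hm₁ _).mul (hm₂ _)) _).norm
  unfold BadAt
  simp only [Set.ofPred_exists, Set.ofPred_and]
  refine MeasurableSet.iUnion fun κ => ?_
  refine (MeasurableSet.const _).inter
    (((MeasurableSet.const _).inter (MeasurableSet.const _)).inter ?_)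
  refine MeasurableSet.iUnion fun d => (MeasurableSet.const _).inter ?_
  exact measurableSet_lt measurable_const (h1 κ d)

/-- Integrated form of `cnt_badAt_le`. -/
lemma sum_measureReal_badAt_le (hT : MeasurePreserving T μ μ) (hF₁m : Measurable F₁)
    (hF₂m : Measurable F₂) (hF₁ : ∀ x, |F₁ x| ≤ 1) (hF₂ : ∀ x, |F₂ x| ≤ 1)
    {J i₀ k0 H m : ℕ} {γ : ℕ → ℕ → ℝ} (hm : 1 ≤ m) (hi₀ : k0 ≤ i₀) (hk : k0 ≤ 16 * m)
    (hiJ : i₀ ≤ J) (hH : 0 < H) (hHi : 2 * H / 2 ^ i₀ ≤ lev m / 2)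
    (hΓ : (1 / (H : ℝ) ^ 2) * ∑ h ∈ range H, ∑ h' ∈ range H, |γ h h'| ≤ lev m ^ 2 / 8) :
    ∑ x ∈ range (2 ^ J), μ.real {ω | BadAt J k0 i₀ (2 ^ 101 / 2 ^ m)
      (fun y => (F₁ (T^[y] ω) : ℂ)) (fun y => (F₂ (T^[y] ω) : ℂ)) x} ≤
      2 ^ J * (2 ^ k0 * (2 ^ 101 / 2 ^ m)) + 2 ^ J * (8 / lev m ^ 2 *
        ∫ ω, corrDev H (2 ^ i₀) γ (fun y => F₁ (T^[y] ω)) 0 ∂μ) := by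
  classical
  set E : ℕ → Set X := fun x => {ω | BadAt J k0 i₀ (2 ^ 101 / 2 ^ m)
      (fun y => (F₁ (T^[y] ω) : ℂ)) (fun y => (F₂ (T^[y] ω) : ℂ)) x} with hE
  have hEm : ∀ x, MeasurableSet (E x) := fun x =>
    measurableSet_badAt hT.measurable hF₁m hF₂m J k0 i₀ _ x
  have h1 : ∀ x, Integrable ((E x).indicator (1 : X → ℝ)) μ := fun x =>
    (integrable_const (1 : ℝ)).indicator (hEm x)
  have h2 : ∑ x ∈ range (2 ^ J), μ.real (E x) =
      ∫ ω, ∑ x ∈ range (2 ^ J), (E x).indicator (1 : X → ℝ) ω ∂μ := by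
    rw [integral_finsetSum _ fun x _ => h1 x]
    exact sum_congr rfl fun x _ => (integral_indicator_one (hEm x)).symm
  have h3 : Integrable (fun ω => av (J - i₀) (fun c =>
      corrDev H (2 ^ i₀) γ (fun y => F₁ (T^[y] ω)) (c * 2 ^ i₀))) μ := by
    unfold av
    exact (integrable_finsetSum _ fun c _ =>
      integrable_corrDev hT.measurable hF₁m hF₁ H _ γ _).div_const _
  rw [h2, ← integral_av_corrDev hT hF₁m hF₁ H (2 ^ i₀) γ (J - i₀) (fun c => c * 2 ^ i₀)]
  refine (integral_mono (integrable_finsetSum _ fun x _ => h1 x)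
    ((integrable_const (2 ^ J * (2 ^ k0 * (2 ^ 101 / 2 ^ m)) : ℝ)).add
      ((h3.const_mul (8 / lev m ^ 2)).const_mul (2 ^ J))) fun ω => ?_).trans
    (le_of_eq ?_)
  · refine le_trans (le_of_eq ?_) (cnt_badAt_le (fun y => hF₁ (T^[y] ω)) (f₂ := fun y =>
      (F₂ (T^[y] ω) : ℂ)) (fun y => by rw [Complex.norm_real]; exact hF₂ _) hm hi₀ hk hiJ hH hHi hΓ)
    unfold cnt
    refine sum_congr rfl fun x _ => ?_
    simp only [Set.indicator, hE, Set.mem_ofPred_eq, Pi.one_apply]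
  · rw [integral_add' (integrable_const _) ((h3.const_mul (8 / lev m ^ 2)).const_mul (2 ^ J))]
    simp [integral_const_mul]

lemma exists_three_mul_add_one (K : ℕ) : ∃ s, 3 * s + 1 = 2 ^ (2 * K) := by
  induction K with
  | zero => exact ⟨0, rfl⟩
  | succ K ih =>
    obtain ⟨s, hs⟩ := ih
    refine ⟨4 * s + 1, ?_⟩
    rw [show 2 * (K + 1) = 2 * K + 2 by ring, pow_add, ← hs]; ring

/-- The averages `(1 / N) ∑_{n = 1}^N F₁ (Tⁿ x) F₂ (T²ⁿ x)`. -/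
noncomputable def dblAvg (T : X → X) (F₁ F₂ : X → ℝ) (N : ℕ) (x : X) : ℝ :=
  (1 / (N : ℝ)) * ∑ n ∈ Icc 1 N, F₁ (T^[n] x) * F₂ (T^[2 * n] x)

omit [MeasurableSpace X] in
lemma abs_dblAvg_le_of_not_badAt (hF₁ : ∀ x, |F₁ x| ≤ 1) (hF₂ : ∀ x, |F₂ x| ≤ 1)
    {J k0 i₀ s x N : ℕ} {c : ℝ} (hc : 0 ≤ c) (hi₀ : k0 ≤ i₀) (hs : 3 * s + 1 = 2 ^ J)
    (hsx : s ≤ x) (hN : 2 ^ i₀ ≤ N) (hNJ : 128 * N ≤ 2 ^ J) {ω : X}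
    (h1 : ¬ BadAt J k0 i₀ c (fun y => (F₁ (T^[y] ω) : ℂ)) (fun y => (F₂ (T^[y] ω) : ℂ)) x)
    (h2 : ¬ BadAt J k0 i₀ c (fun y => (F₁ (T^[y] (T^[s] ω)) : ℂ))
      (fun y => (F₂ (T^[y] (T^[s] ω)) : ℂ)) (x - s)) :
    |dblAvg T F₁ F₂ N (T^[x] ω)| ≤ 2 * 2 ^ k0 * c + 256 / 2 ^ k0 := by
  have hN0 : (0 : ℝ) < N := by
    have : 0 < N := lt_of_lt_of_le (by positivity) hN
    exact_mod_cast this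
  simp only [← Function.iterate_add_apply] at h2
  have h3 := norm_sum_le_of_not_badAt (f₁ := fun y => (F₁ (T^[y] ω) : ℂ))
    (f₂ := fun y => (F₂ (T^[y] ω) : ℂ)) (fun z => by rw [Complex.norm_real]; exact hF₁ _)
    (fun z => by rw [Complex.norm_real]; exact hF₂ _) hc hi₀ hs hsx hN hNJ h1 h2
  have h4 : ∑ t ∈ Icc 1 N, (F₁ (T^[x + t] ω) : ℂ) * (F₂ (T^[x + 2 * t] ω) : ℂ) =
      ((∑ n ∈ Icc 1 N, F₁ (T^[n] (T^[x] ω)) * F₂ (T^[2 * n] (T^[x] ω)) : ℝ) : ℂ) := by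
    push_cast
    simp only [← Function.iterate_add_apply, add_comm x]
  rw [h4, Complex.norm_real, Real.norm_eq_abs] at h3
  rw [dblAvg, abs_mul, abs_of_pos (by positivity), one_div, inv_mul_le_iff₀ hN0]
  exact h3

lemma measurable_dblAvg (hT : Measurable T) (hF₁ : Measurable F₁) (hF₂ : Measurable F₂) (N : ℕ) :
    Measurable (dblAvg T F₁ F₂ N) :=
  Measurable.const_mul (Finset.measurable_fun_sum _ fun n _ =>
    (hF₁.comp (hT.iterate n)).mul (hF₂.comp (hT.iterate (2 * n)))) _

/-- The maximal inequality behind pointwise convergence. -/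
lemma exists_measure_dblAvg_le (hT : Ergodic T μ) (hF₁m : Measurable F₁)
    (hF₂m : Measurable F₂) (hF₁ : ∀ x, |F₁ x| ≤ 1) (hF₂ : ∀ x, |F₂ x| ≤ 1)
    (hperp : hkSeminorm2pow4 μ T F₁ = 0) {ε : ℝ} (hε : 0 < ε) :
    ∃ N₀, ∀ N₁, μ {ω | ∃ N ∈ Icc N₀ N₁, ε < |dblAvg T F₁ F₂ N ω|} ≤ ENNReal.ofReal ε := by
  have hTm := hT.toMeasurePreserving
  have hpow : ∀ {a r : ℝ}, 0 < r → ∀ᶠ k : ℕ in atTop, a / 2 ^ k ≤ r := fun {a r} hr => by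
    have h := (tendsto_pow_atTop_nhds_zero_of_lt_one (r := (1 / 2 : ℝ)) (by norm_num)
      (by norm_num)).const_mul a
    rw [mul_zero] at h
    filter_upwards [h.eventually (gt_mem_nhds hr)] with k hk
    rw [one_div, inv_pow, ← div_eq_mul_inv] at hk
    exact hk.le
  obtain ⟨k0, hk0⟩ := (hpow (a := 256) (half_pos hε)).exists
  obtain ⟨m, hmε, hm⟩ := ((hpow (a := 2 ^ k0 * 2 ^ 101) (show 0 < ε / 8 by positivity)).and
    (eventually_ge_atTop (k0 + 1))).exists
  have hl := lev_pos (m := m)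
  obtain ⟨H, hH, hΓ⟩ := exists_sum_corr_le hTm hF₁m hF₁ hperp
    (show 0 < lev m ^ 2 / 8 by positivity)
  set γ : ℕ → ℕ → ℝ := fun h h' => ∫ x, F₁ (T^[h] x) * F₁ (T^[h'] x) ∂μ with hγ
  have hdev := ((tendsto_integral_corrDev hT hF₁m hF₁ H).comp
    (tendsto_pow_atTop_atTop_of_one_lt (show 1 < 2 by norm_num))).eventually
    (gt_mem_nhds (show 0 < lev m ^ 2 / 8 * (ε / 8) by positivity))
  obtain ⟨i₀, hb, hHi, hi₀⟩ := (hdev.and ((hpow (a := 2 * H) (half_pos hl)).and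
    (eventually_ge_atTop k0))).exists
  set c : ℝ := 2 ^ 101 / 2 ^ m with hc
  have hc0 : 0 ≤ c := by positivity
  have hkc : 2 ^ k0 * c ≤ ε / 8 := by rw [hc, ← mul_div_assoc]; exact hmε
  refine ⟨2 ^ i₀, fun N₁ => ?_⟩
  obtain ⟨s, hs⟩ := exists_three_mul_add_one (N₁ + 7 + i₀)
  set J := 2 * (N₁ + 7 + i₀) with hJ
  have hNJ : 128 * N₁ ≤ 2 ^ J := by
    have h1 : N₁ < 2 ^ N₁ := Nat.lt_two_pow_self
    have h2 : 2 ^ (N₁ + 7) ≤ 2 ^ J := Nat.pow_le_pow_right (by norm_num) (by omega)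
    rw [pow_add] at h2
    omega
  set E : ℕ → Set X := fun x => {ω | BadAt J k0 i₀ c
      (fun y => (F₁ (T^[y] ω) : ℂ)) (fun y => (F₂ (T^[y] ω) : ℂ)) x} with hE
  have hEm : ∀ x, MeasurableSet (E x) := fun x =>
    measurableSet_badAt hTm.measurable hF₁m hF₂m J k0 i₀ _ x
  set G : Set X := {ω | ∃ N ∈ Icc (2 ^ i₀) N₁, ε < |dblAvg T F₁ F₂ N ω|} with hG
  have hGm : MeasurableSet G := by
    have : G = ⋃ N ∈ Icc (2 ^ i₀) N₁, {ω | ε < |dblAvg T F₁ F₂ N ω|} := by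
      ext ω; simp [hG]
    rw [this]
    exact Finset.measurableSet_biUnion _ fun N _ => measurableSet_lt measurable_const
      (measurable_dblAvg hTm.measurable hF₁m hF₂m N).abs
  have hGE : ∀ x ∈ Ico s (2 ^ J), μ.real G ≤ μ.real (E x) + μ.real (E (x - s)) := by
    intro x hx
    have hsx := (mem_Ico.1 hx).1
    have hsub : T^[x] ⁻¹' G ⊆ E x ∪ T^[s] ⁻¹' E (x - s) := by
      intro ω hω
      by_contra hcon
      simp only [Set.mem_union, not_or] at hcon
      obtain ⟨N, hN, hlt⟩ := hω
      have hN' := mem_Icc.1 hN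
      have := abs_dblAvg_le_of_not_badAt hF₁ hF₂ hc0 hi₀ hs hsx hN'.1 (by omega) hcon.1 hcon.2
      linarith
    calc μ.real G = μ.real (T^[x] ⁻¹' G) :=
          ((hTm.iterate x).measureReal_preimage hGm.nullMeasurableSet).symm
      _ ≤ μ.real (E x ∪ T^[s] ⁻¹' E (x - s)) := measureReal_mono hsub
      _ ≤ μ.real (E x) + μ.real (T^[s] ⁻¹' E (x - s)) := measureReal_union_le _ _
      _ = _ := by rw [(hTm.iterate s).measureReal_preimage (hEm _).nullMeasurableSet]
  have hsum := sum_measureReal_badAt_le (γ := γ) hTm hF₁m hF₂m hF₁ hF₂ (show 1 ≤ m by omega) hi₀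
    (show k0 ≤ 16 * m by omega) (show i₀ ≤ J by omega) hH hHi hΓ
  have hsum' : ∑ x ∈ range (2 ^ J), μ.real (E x) ≤ 2 ^ J * (ε / 4) := by
    refine hsum.trans ?_
    have h1 : 8 / lev m ^ 2 * ∫ ω, corrDev H (2 ^ i₀) γ (fun y => F₁ (T^[y] ω)) 0 ∂μ ≤ ε / 8 := by
      rw [div_mul_eq_mul_div, div_le_iff₀ (by positivity)]
      have h2 : ∫ ω, corrDev H (2 ^ i₀) γ (fun y => F₁ (T^[y] ω)) 0 ∂μ <
        lev m ^ 2 / 8 * (ε / 8) := hb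
      linarith
    rw [← mul_add]
    gcongr
    exact (add_le_add hkc h1).trans (by linarith)
  have hsJ : s ≤ 2 ^ J := by omega
  have h5 : ∑ x ∈ Ico s (2 ^ J), μ.real (E x) ≤ 2 ^ J * (ε / 4) :=
    (sum_le_sum_of_subset_of_nonneg (fun x hx => mem_range.2 (mem_Ico.1 hx).2)
      fun _ _ _ => measureReal_nonneg).trans hsum'
  have h6 : ∑ x ∈ Ico s (2 ^ J), μ.real (E (x - s)) ≤ 2 ^ J * (ε / 4) := by
    rw [sum_Ico_eq_sum_range]
    simp only [Nat.add_sub_cancel_left]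
    exact (sum_le_sum_of_subset_of_nonneg (range_subset_range.2 (Nat.sub_le _ _))
      fun _ _ _ => measureReal_nonneg).trans hsum'
  have h7 := sum_le_sum hGE
  rw [sum_const, nsmul_eq_mul, sum_add_distrib, Nat.card_Ico, Nat.cast_sub hsJ] at h7
  have h8 : (3 : ℝ) * s + 1 = 2 ^ J := by exact_mod_cast hs
  have h9 : (2 : ℝ) ^ J * (μ.real G / 2) ≤ 2 ^ J * (ε / 2) := by
    have h10 : (2 : ℝ) ^ J / 2 ≤ (2 ^ J : ℕ) - s := by
      push_cast
      have : (0 : ℝ) ≤ s := by positivity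
      linarith
    have h11 := mul_le_mul_of_nonneg_right h10 (measureReal_nonneg (μ := μ) (s := G))
    linarith
  have h12 := le_of_mul_le_mul_left h9 (by positivity)
  rw [← ofReal_measureReal]
  exact ENNReal.ofReal_le_ofReal (by linarith)

/-- For every `ε > 0`, almost surely the averages are eventually at most `ε`. -/
lemma ae_eventually_abs_dblAvg_le (hT : Ergodic T μ) (hF₁m : Measurable F₁)
    (hF₂m : Measurable F₂) (hF₁ : ∀ x, |F₁ x| ≤ 1) (hF₂ : ∀ x, |F₂ x| ≤ 1)
    (hperp : hkSeminorm2pow4 μ T F₁ = 0) {ε : ℝ} (hε : 0 < ε) :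
    ∀ᵐ ω ∂μ, ∀ᶠ N in atTop, |dblAvg T F₁ F₂ N ω| ≤ ε := by
  rw [ae_iff]
  refine le_antisymm (ENNReal.le_of_forall_pos_le_add fun η hη _ => ?_) zero_le
  have hη' : 0 < min ε η := lt_min hε (by exact_mod_cast hη)
  obtain ⟨N₀, hN₀⟩ := exists_measure_dblAvg_le hT hF₁m hF₂m hF₁ hF₂ hperp hη'
  have hmono : Monotone fun N₁ => {ω | ∃ N ∈ Icc N₀ N₁, min ε η < |dblAvg T F₁ F₂ N ω|} := by
    rintro a b hab ω ⟨N, hN, hlt⟩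
    exact ⟨N, Icc_subset_Icc_right hab hN, hlt⟩
  calc μ {ω | ¬ ∀ᶠ N in atTop, |dblAvg T F₁ F₂ N ω| ≤ ε}
      ≤ μ (⋃ N₁, {ω | ∃ N ∈ Icc N₀ N₁, min ε η < |dblAvg T F₁ F₂ N ω|}) := by
        refine measure_mono fun ω hω => ?_
        obtain ⟨N, hN, hlt⟩ := frequently_atTop.1 (not_eventually.1 hω) N₀
        exact Set.mem_iUnion.2 ⟨N, N, mem_Icc.2 ⟨hN, le_rfl⟩,
          (min_le_left _ _).trans_lt (not_le.1 hlt)⟩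
    _ = ⨆ N₁, μ {ω | ∃ N ∈ Icc N₀ N₁, min ε η < |dblAvg T F₁ F₂ N ω|} := hmono.measure_iUnion
    _ ≤ ENNReal.ofReal (min ε η) := iSup_le hN₀
    _ ≤ ENNReal.ofReal η := ENNReal.ofReal_le_ofReal (min_le_right _ _)
    _ = 0 + η := by simp

end assembly

end DoubleRec

/-- the Kronecker factor is pointwise characteristic for the double recurrence
averages: if `⦀F₁⦀₂ = 0` (equivalently `⦀F₁⦀₂⁴ = 0`, i.e. `F₁ ⊥ 𝒜₁`), then for a.e. `x`,
`(1/N) ∑_{n=1}^N F₁(Tⁿx) F₂(T²ⁿx) → 0`. -/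
theorem double_recurrence_avg_tendsto_zero_of_kronecker_perp
    {X : Type*} [MeasurableSpace X] (μ : Measure X) [IsProbabilityMeasure μ]
    (T : X → X) (hT : Ergodic T μ)
    (F₁ F₂ : X → ℝ) (hF₁m : Measurable F₁) (hF₂m : Measurable F₂)
    (hF₁ : ∀ x, |F₁ x| ≤ 1) (hF₂ : ∀ x, |F₂ x| ≤ 1)
    (hperp : hkSeminorm2pow4 μ T F₁ = 0) :
    ∀ᵐ x ∂μ, Tendsto (fun N : ℕ =>
      (1 / (N : ℝ)) * ∑ n ∈ Finset.Icc 1 N, F₁ (T^[n] x) * F₂ (T^[2 * n] x))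
      atTop (nhds 0) := by
  have h := ae_all_iff.2 fun k : ℕ => DoubleRec.ae_eventually_abs_dblAvg_le hT hF₁m hF₂m hF₁ hF₂
    hperp (Nat.one_div_pos_of_nat (α := ℝ) (n := k))
  filter_upwards [h] with x hx
  refine Metric.tendsto_nhds.2 fun ε hε => ?_
  obtain ⟨k, hk⟩ := exists_nat_one_div_lt hε
  filter_upwards [hx k] with N hN
  rw [Real.dist_eq, sub_zero]
  exact hN.trans_lt hk
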